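/- arXiv:1211.1940 — 2 statements merged into one kernel-verified Lean document; each statement's English description precedes it below -/
import Mathlib

section
/- Let f ∈ ℝ[x₁,…,xₙ] and let h = (h₁,…,h_{m₁}), g = (g₁,…,g_{m₂}) be tuples of polynomials. If the feasible set K is nonempty and finite, then the preordering-based hierarchy has finite convergence: there exists N such that f_k^{pre} = f_min for all k ≥ N. -/
open MvPolynomial Pointwise

/-- A polynomial is a sum of squares. -/
def IsSOS {n : ℕ} (p : MvPolynomial (Fin n) ℝ) : Prop :=
  ∃ (m : ℕ) (q : Fin m → MvPolynomial (Fin n) ℝ), p = ∑ i, q i ^ 2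

/-- The `2k`-th truncated ideal generated by the tuple `h`. -/
def truncIdeal {n m : ℕ} (h : Fin m → MvPolynomial (Fin n) ℝ) (k : ℕ) :
    Set (MvPolynomial (Fin n) ℝ) :=
  {p | ∃ φ : Fin m → MvPolynomial (Fin n) ℝ,
    (∀ i, (φ i * h i).totalDegree ≤ 2 * k) ∧ p = ∑ i, φ i * h i}

/-- The `k`-th truncated quadratic module generated by the tuple `g` (with `g₀ = 1`). -/
def truncQM {n m : ℕ} (g : Fin m → MvPolynomial (Fin n) ℝ) (k : ℕ) :
    Set (MvPolynomial (Fin n) ℝ) :=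
  {p | ∃ σ : Fin (m + 1) → MvPolynomial (Fin n) ℝ,
    (∀ j, IsSOS (σ j) ∧
      (σ j * (Fin.cons 1 g : Fin (m + 1) → MvPolynomial (Fin n) ℝ) j).totalDegree ≤ 2 * k) ∧
    p = ∑ j, σ j * (Fin.cons 1 g : Fin (m + 1) → MvPolynomial (Fin n) ℝ) j}

/-- The feasible set `K` of the problem `h = 0, g ≥ 0`. -/
def feasSet {n m₁ m₂ : ℕ} (h : Fin m₁ → MvPolynomial (Fin n) ℝ)
    (g : Fin m₂ → MvPolynomial (Fin n) ℝ) : Set (Fin n → ℝ) :=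
  {x | (∀ i, eval x (h i) = 0) ∧ ∀ j, 0 ≤ eval x (g j)}

/-- The real variety `V_ℝ(h)`. -/
def realVariety {n m : ℕ} (h : Fin m → MvPolynomial (Fin n) ℝ) : Set (Fin n → ℝ) :=
  {x | ∀ i, eval x (h i) = 0}

/-- The vanishing ideal `I(S)` of a set `S ⊆ ℝⁿ`. -/
def vanishIdeal {n : ℕ} (S : Set (Fin n → ℝ)) : Set (MvPolynomial (Fin n) ℝ) :=
  {p | ∀ u ∈ S, eval u p = 0}

/-- The `k`-th Lasserre bound `f_k` (an extended real). -/
noncomputable def lasserreBound {n m₁ m₂ : ℕ} (f : MvPolynomial (Fin n) ℝ)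
    (h : Fin m₁ → MvPolynomial (Fin n) ℝ) (g : Fin m₂ → MvPolynomial (Fin n) ℝ)
    (k : ℕ) : EReal :=
  sSup {γ : EReal | ∃ r : ℝ, γ = (r : EReal) ∧ f - C r ∈ truncIdeal h k + truncQM g k}

/-- `f_min`, the infimum of `f` over `K`, as an extended real (`⊤` if `K = ∅`). -/
noncomputable def fMin {n : ℕ} (f : MvPolynomial (Fin n) ℝ) (K : Set (Fin n → ℝ)) : EReal :=
  ⨅ x ∈ K, (eval x f : EReal)

/-- The `k`-th truncated preordering generated by `g`. -/
def truncPreord {n m : ℕ} (g : Fin m → MvPolynomial (Fin n) ℝ) (k : ℕ) :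
    Set (MvPolynomial (Fin n) ℝ) :=
  {p | ∃ σ : Finset (Fin m) → MvPolynomial (Fin n) ℝ,
    (∀ S : Finset (Fin m), IsSOS (σ S) ∧ (σ S * ∏ j ∈ S, g j).totalDegree ≤ 2 * k) ∧
    p = ∑ S : Finset (Fin m), σ S * ∏ j ∈ S, g j}

/-- The `k`-th preordering-based Lasserre bound `f_k^{pre}`. -/
noncomputable def lasserrePreBound {n m₁ m₂ : ℕ} (f : MvPolynomial (Fin n) ℝ)
    (h : Fin m₁ → MvPolynomial (Fin n) ℝ) (g : Fin m₂ → MvPolynomial (Fin n) ℝ)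
    (k : ℕ) : EReal :=
  sSup {γ : EReal | ∃ r : ℝ, γ = (r : EReal) ∧ f - C r ∈ truncIdeal h k + truncPreord g k}

/-- For a subsemiring `P` containing all squares, the subsemiring `P + a P`. -/
def Subsemiring.adjoinElement {A : Type*} [CommRing A] (P : Subsemiring A)
    (hsq : ∀ a, a * a ∈ P) (a : A) : Subsemiring A where
  carrier := {z | ∃ x ∈ P, ∃ y ∈ P, z = x + a * y}
  zero_mem' := ⟨0, P.zero_mem, 0, P.zero_mem, by ring⟩
  one_mem' := ⟨1, P.one_mem, 0, P.zero_mem, by ring⟩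
  add_mem' := by
    rintro _ _ ⟨x, hx, y, hy, rfl⟩ ⟨z, hz, w, hw, rfl⟩
    exact ⟨x + z, P.add_mem hx hz, y + w, P.add_mem hy hw, by ring⟩
  mul_mem' := by
    rintro _ _ ⟨x, hx, y, hy, rfl⟩ ⟨z, hz, w, hw, rfl⟩
    exact ⟨x * z + a * a * (y * w),
      P.add_mem (P.mul_mem hx hz) (P.mul_mem (hsq a) (P.mul_mem hy hw)),
      x * w + y * z, P.add_mem (P.mul_mem hx hw) (P.mul_mem hy hz), by ring⟩

/-- A preordering that avoids the negatives of all even powers of `p` extends to an ordering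
(total, with prime support) with the same property. -/
theorem exists_ordering_of_neg_pow_notMem {A : Type*} [CommRing A] (T : Subsemiring A)
    (hsq : ∀ a, a * a ∈ T) (p : A) (hp : ∀ l : ℕ, -(p ^ 2) ^ l ∉ T) :
    ∃ P : Subsemiring A, T ≤ P ∧ (∀ a, a ∈ P ∨ -a ∈ P) ∧ (∀ l : ℕ, -(p ^ 2) ^ l ∉ P) ∧
      ∀ a b, a * b ∈ P → -(a * b) ∈ P → (a ∈ P ∧ -a ∈ P) ∨ (b ∈ P ∧ -b ∈ P) := by
  obtain ⟨P, hTP, hP⟩ := zorn_le_nonempty₀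
    {P : Subsemiring A | (∀ a, a * a ∈ P) ∧ ∀ l : ℕ, -(p ^ 2) ^ l ∉ P}
    (fun c hc hchain y hy => by
      refine ⟨sSup c, ⟨fun a => ?_, fun l hl => ?_⟩, fun z hz => le_sSup hz⟩
      · exact (le_sSup hy : y ≤ sSup c) ((hc hy).1 a)
      · obtain ⟨Q, hQ, hm⟩ :=
          (Subsemiring.mem_sSup_of_directedOn ⟨y, hy⟩ hchain.directedOn).1 hl
        exact (hc hQ).2 l hm)
    T ⟨hsq, hp⟩
  have hPsq := hP.prop.1
  have hPp := hP.prop.2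
  have key : ∀ a, a ∉ P → ∃ l : ℕ, ∃ x ∈ P, ∃ y ∈ P, -(p ^ 2) ^ l = x + a * y := by
    intro a ha
    by_contra hcon
    push Not at hcon
    have hle : P ≤ P.adjoinElement hPsq a := fun x hx => ⟨x, hx, 0, P.zero_mem, by ring⟩
    have hmem : P.adjoinElement hPsq a ∈
        {P : Subsemiring A | (∀ a, a * a ∈ P) ∧ ∀ l : ℕ, -(p ^ 2) ^ l ∉ P} :=
      ⟨fun b => hle (hPsq b), fun l ⟨x, hx, y, hy, h⟩ => hcon l x hx y hy h⟩
    exact ha (hP.le_of_ge hmem hle ⟨0, P.zero_mem, 1, P.one_mem, by ring⟩)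
  have hpow : ∀ l : ℕ, (p ^ 2) ^ l ∈ P := fun l => P.pow_mem (by rw [sq]; exact hPsq p) l
  have htot : ∀ a, a ∈ P ∨ -a ∈ P := by
    intro a
    by_contra! hcon
    obtain ⟨l, x, hx, y, hy, h1⟩ := key a hcon.1
    obtain ⟨m, z, hz, w, hw, h2⟩ := key (-a) hcon.2
    refine hPp (l + m) ?_
    have : -(p ^ 2) ^ (l + m) =
        a * a * (y * w) + (p ^ 2) ^ l * z + (p ^ 2) ^ m * x + x * z := by
      rw [pow_add]
      linear_combination ((p ^ 2) ^ m + z) * h1 - a * y * h2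
    rw [this]
    exact P.add_mem (P.add_mem (P.add_mem (P.mul_mem (hPsq a) (P.mul_mem hy hw))
      (P.mul_mem (hpow l) hz)) (P.mul_mem (hpow m) hx)) (P.mul_mem hx hz)
  refine ⟨P, hTP, htot, hPp, ?_⟩
  have hprime : ∀ a b, a * b ∈ P → -(a * b) ∈ P → a ∉ P → b ∉ P → False := by
    intro a b h1 h2 ha hb
    obtain ⟨l, x, hx, y, hy, e1⟩ := key a ha
    obtain ⟨m, z, hz, w, hw, e2⟩ := key b hb
    refine hPp (l + m) ?_
    have : -(p ^ 2) ^ (l + m) =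
        -(a * b) * (y * w) + (p ^ 2) ^ l * z + (p ^ 2) ^ m * x + x * z := by
      rw [pow_add]
      linear_combination ((p ^ 2) ^ m + z) * e1 - a * y * e2
    rw [this]
    exact P.add_mem (P.add_mem (P.add_mem (P.mul_mem h2 (P.mul_mem hy hw))
      (P.mul_mem (hpow l) hz)) (P.mul_mem (hpow m) hx)) (P.mul_mem hx hz)
  intro a b h1 h2
  by_contra! hcon
  obtain ⟨ha, hb⟩ := hcon
  by_cases a1 : a ∈ P <;> by_cases b1 : b ∈ P
  · exact hprime (-a) (-b) (by simpa using h1) (by simpa using h2) (ha a1) (hb b1)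
  · exact hprime (-a) b (by simpa using h2) (by simpa using h1) (ha a1) b1
  · exact hprime a (-b) (by simpa using h2) (by simpa using h1) a1 (hb b1)
  · exact hprime a b h1 h2 a1 b1

/-- The intermediate value property for polynomials over an ordered field. -/
def Polynomial.PolyIVT (R : Type*) [CommRing R] [LinearOrder R] : Prop :=
  ∀ (P : Polynomial R) (a b : R), a < b → P.eval a * P.eval b < 0 →
    ∃ x, a < x ∧ x < b ∧ P.eval x = 0

/-- A subsemiring `N` of a field that is the nonnegative cone of a linear order on `N ∪ -N`. -/
structure IsOrderCone {Ω : Type*} [Field Ω] (N : Subsemiring Ω) : Prop where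
  eq_zero : ∀ x ∈ N, -x ∈ N → x = 0
  total : ∀ x ∈ N, ∀ y ∈ N, x - y ∈ N ∨ y - x ∈ N

/-- The image of an ordering of a ring under a map whose kernel is the support is a cone. -/
theorem IsOrderCone.map {A Ω : Type*} [CommRing A] [Field Ω] (φ : A →+* Ω) (P : Subsemiring A)
    (htot : ∀ a, a ∈ P ∨ -a ∈ P) (hker : ∀ a, φ a = 0 ↔ a ∈ P ∧ -a ∈ P) :
    IsOrderCone (P.map φ) where
  eq_zero := by
    rintro _ ⟨a, ha, rfl⟩ ⟨b, hb, hab⟩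
    refine (hker a).2 ⟨ha, ?_⟩
    have h : φ (a + b) = 0 := by rw [map_add, hab, add_neg_cancel]
    simpa using P.add_mem hb ((hker _).1 h).2
  total := by
    rintro _ ⟨a, ha, rfl⟩ _ ⟨b, hb, rfl⟩
    rcases htot (a - b) with h | h
    · exact Or.inl ⟨_, h, map_sub φ a b⟩
    · exact Or.inr ⟨_, h, by simp⟩

/-- Every cone is contained in a maximal one. -/
theorem IsOrderCone.exists_le_maximal {Ω : Type*} [Field Ω] {N : Subsemiring Ω}
    (hN : IsOrderCone N) : ∃ M, N ≤ M ∧ Maximal IsOrderCone M := by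
  refine zorn_le_nonempty₀ {M : Subsemiring Ω | IsOrderCone M} (fun c hc hchain y hy => ?_) N hN
  have hmem {x : Ω} : x ∈ sSup c ↔ ∃ s ∈ c, x ∈ s :=
    Subsemiring.mem_sSup_of_directedOn ⟨y, hy⟩ hchain.directedOn
  have hpair : ∀ x ∈ sSup c, ∀ z ∈ sSup c, ∃ s ∈ c, x ∈ s ∧ z ∈ s := by
    intro x hx z hz
    obtain ⟨s, hs, hxs⟩ := hmem.1 hx
    obtain ⟨t, ht, hzt⟩ := hmem.1 hz
    obtain ⟨u, hu, hsu, htu⟩ := hchain.directedOn s hs t ht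
    exact ⟨u, hu, hsu hxs, htu hzt⟩
  refine ⟨sSup c, ⟨fun x hx hx' => ?_, fun x hx z hz => ?_⟩, fun z hz => le_sSup hz⟩
  · obtain ⟨s, hs, h1, h2⟩ := hpair x hx _ hx'
    exact (hc hs).eq_zero x h1 h2
  · obtain ⟨s, hs, h1, h2⟩ := hpair x hx z hz
    exact ((hc hs).total x h1 z h2).imp (fun h => hmem.2 ⟨s, hs, h⟩) fun h => hmem.2 ⟨s, hs, h⟩

/-- Allowing denominators from a cone gives a cone. -/
def Subsemiring.withDenominators {Ω : Type*} [Field Ω] (N : Subsemiring Ω) : Subsemiring Ω where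
  carrier := {x | ∃ s ∈ N, s ≠ 0 ∧ x * s ∈ N}
  zero_mem' := ⟨1, N.one_mem, one_ne_zero, by simp⟩
  one_mem' := ⟨1, N.one_mem, one_ne_zero, by simp⟩
  add_mem' := by
    rintro x y ⟨s, hs, hs0, hx⟩ ⟨t, ht, ht0, hy⟩
    refine ⟨s * t, N.mul_mem hs ht, mul_ne_zero hs0 ht0, ?_⟩
    have : (x + y) * (s * t) = x * s * t + y * t * s := by ring
    rw [this]
    exact N.add_mem (N.mul_mem hx ht) (N.mul_mem hy hs)
  mul_mem' := by
    rintro x y ⟨s, hs, hs0, hx⟩ ⟨t, ht, ht0, hy⟩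
    refine ⟨s * t, N.mul_mem hs ht, mul_ne_zero hs0 ht0, ?_⟩
    have : (x * y) * (s * t) = x * s * (y * t) := by ring
    rw [this]
    exact N.mul_mem hx hy

theorem IsOrderCone.inv_mem_of_maximal {Ω : Type*} [Field Ω] {N : Subsemiring Ω}
    (hN : Maximal IsOrderCone N) {x : Ω} (hx : x ∈ N) : x⁻¹ ∈ N := by
  rcases eq_or_ne x 0 with rfl | hx0
  · simp [N.zero_mem]
  have hle : N ≤ N.withDenominators := fun y hy => ⟨1, N.one_mem, one_ne_zero, by simpa using hy⟩
  refine hN.le_of_ge (y := N.withDenominators) ⟨?_, ?_⟩ hle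
    ⟨x, hx, hx0, by simp [hx0, N.one_mem]⟩
  · rintro y ⟨s, hs, hs0, hy⟩ ⟨t, ht, ht0, hy'⟩
    have h := hN.prop.eq_zero (y * s * t) (N.mul_mem hy ht) (by
      have : -(y * s * t) = -y * t * s := by ring
      rw [this]
      exact N.mul_mem hy' hs)
    simpa [hs0, ht0] using h
  · rintro y ⟨s, hs, hs0, hy⟩ z ⟨t, ht, ht0, hz⟩
    have hst0 := mul_ne_zero hs0 ht0
    have hst := N.mul_mem hs ht
    rcases hN.prop.total _ (N.mul_mem hy ht) _ (N.mul_mem hz hs) with h | h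
    · exact Or.inl ⟨s * t, hst, hst0, by convert h using 1; ring⟩
    · exact Or.inr ⟨s * t, hst, hst0, by convert h using 1; ring⟩

/-- The subfield `N ∪ -N` attached to a maximal cone `N`. -/
def IsOrderCone.subfield {Ω : Type*} [Field Ω] {N : Subsemiring Ω}
    (hN : Maximal IsOrderCone N) : Subfield Ω where
  carrier := {x | x ∈ N ∨ -x ∈ N}
  zero_mem' := Or.inl N.zero_mem
  one_mem' := Or.inl N.one_mem
  neg_mem' := by
    rintro x (h | h)
    · exact Or.inr (by simpa using h)
    · exact Or.inl h
  add_mem' := by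
    rintro x y (hx | hx) (hy | hy)
    · exact Or.inl (N.add_mem hx hy)
    · exact (hN.prop.total _ hx _ hy).imp (fun h => by simpa using h)
        fun h => by convert h using 1; ring
    · exact (hN.prop.total _ hy _ hx).imp (fun h => by convert h using 1; ring)
        fun h => by convert h using 1; ring
    · exact Or.inr (by convert N.add_mem hx hy using 1; ring)
  mul_mem' := by
    rintro x y (hx | hx) (hy | hy)
    · exact Or.inl (N.mul_mem hx hy)
    · exact Or.inr (by simpa using N.mul_mem hx hy)
    · exact Or.inr (by simpa using N.mul_mem hx hy)
    · exact Or.inl (by simpa using N.mul_mem hx hy)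
  inv_mem' := by
    rintro x (h | h)
    · exact Or.inl (IsOrderCone.inv_mem_of_maximal hN h)
    · exact Or.inr (by simpa [inv_neg] using IsOrderCone.inv_mem_of_maximal hN h)

/-- The nonnegative elements of the subfield attached to a maximal cone. -/
def IsOrderCone.ringCone {Ω : Type*} [Field Ω] {N : Subsemiring Ω}
    (hN : Maximal IsOrderCone N) : RingCone (IsOrderCone.subfield hN) where
  __ := N.comap (IsOrderCone.subfield hN).subtype
  eq_zero_of_mem_of_neg_mem' := by
    intro x h1 h2
    exact Subtype.ext (hN.prop.eq_zero _ h1 (by simpa using h2))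

namespace Polynomial

/-- An ordered field whose order does not extend to a larger subring of an algebraically closed
overfield has the intermediate value property for polynomials. -/
theorem polyIVT_of_maximal {R Ω : Type*} [Field R] [LinearOrder R] [IsStrictOrderedRing R]
    [Field Ω] [IsAlgClosed Ω] [Algebra R Ω]
    (hmax : ∀ N : Subsemiring Ω, IsOrderCone N → (∀ r : R, 0 ≤ r → algebraMap R Ω r ∈ N) →
      ∀ x ∈ N, ∃ r, algebraMap R Ω r = x) : PolyIVT R := by
  intro P a b hab
  induction hd : P.natDegree using Nat.strong_induction_on generalizing P with
  | _ d ih =>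
  intro hP
  have hP0 : P ≠ 0 := by rintro rfl; simp at hP
  have hnu : ¬ IsUnit P := by
    intro hu
    obtain ⟨c, -, rfl⟩ := Polynomial.isUnit_iff.1 hu
    simp only [eval_C] at hP
    nlinarith [mul_self_nonneg c]
  have hpos : ∀ u : R[X], u ≠ 0 → ¬ IsUnit u → 0 < u.natDegree := by
    intro u hu0 hu
    by_contra! h
    refine hu (Polynomial.isUnit_iff_degree_eq_zero.2 ?_)
    rw [degree_eq_natDegree hu0, Nat.le_zero.1 h, Nat.cast_zero]
  by_cases hirr : Irreducible P
  swap
  · rw [irreducible_iff] at hirr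
    push Not at hirr
    obtain ⟨u, v, huv, hu, hv⟩ := hirr hnu
    have hu0 : u ≠ 0 := by rintro rfl; simp_all
    have hv0 : v ≠ 0 := by rintro rfl; simp_all
    have hdeg : P.natDegree = u.natDegree + v.natDegree := by rw [huv, natDegree_mul hu0 hv0]
    have hud := hpos u hu0 hu
    have hvd := hpos v hv0 hv
    have hcases : u.eval a * u.eval b < 0 ∨ v.eval a * v.eval b < 0 := by
      by_contra! h
      simp only [huv, eval_mul] at hP
      nlinarith [mul_nonneg h.1 h.2]
    rcases hcases with h | h
    · obtain ⟨x, h1, h2, h3⟩ := ih _ (by omega) u rfl h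
      exact ⟨x, h1, h2, by simp [huv, h3]⟩
    · obtain ⟨x, h1, h2, h3⟩ := ih _ (by omega) v rfl h
      exact ⟨x, h1, h2, by simp [huv, h3]⟩
  by_cases hr : ∃ x, P.IsRoot x
  · obtain ⟨x, hx⟩ := hr
    obtain ⟨Q, hQ⟩ := dvd_iff_isRoot.2 hx
    have hQu : IsUnit Q := (hirr.isUnit_or_isUnit hQ).resolve_left (not_isUnit_X_sub_C x)
    obtain ⟨q, -, rfl⟩ := Polynomial.isUnit_iff.1 hQu
    simp only [hQ, eval_mul, eval_sub, eval_X, eval_C] at hP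
    have h2 : (a - x) * (b - x) < 0 := by
      by_contra! h
      nlinarith [mul_nonneg h (mul_self_nonneg q)]
    refine ⟨x, ?_, ?_, hx⟩
    · by_contra! h
      nlinarith [mul_nonneg (sub_nonneg.2 h) (sub_nonneg.2 (h.trans hab.le))]
    · by_contra! h
      nlinarith [mul_nonneg (sub_nonneg.2 h) (sub_nonneg.2 (hab.le.trans h))]
  exfalso
  have hdpos : 0 < P.natDegree := hpos P hP0 hnu
  let M : Submonoid R[X] :=
    { carrier := {s | ∃ n : R, 0 ≤ n ∧ ∃ q, s = C n * q ^ 2}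
      one_mem' := ⟨1, zero_le_one, 1, by simp⟩
      mul_mem' := by
        rintro _ _ ⟨n, hn, q, rfl⟩ ⟨m, hm, r, rfl⟩
        exact ⟨n * m, mul_nonneg hn hm, q * r, by rw [C_mul]; ring⟩ }
  have hred : ∀ s ∈ M.subsemiringClosure, ∃ t : R[X], (∀ x, 0 ≤ t.eval x) ∧
      t.natDegree ≤ 2 * (P.natDegree - 1) ∧ P ∣ s - t := by
    intro s hs
    rw [Submonoid.subsemiringClosure_mem] at hs
    induction hs using AddSubmonoid.closure_induction with
    | mem s hs =>
      obtain ⟨n, hn, q, rfl⟩ := hs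
      refine ⟨C n * (q % P) ^ 2, fun x => ?_, ?_, ?_⟩
      · simp only [eval_mul, eval_C, eval_pow]
        positivity
      · have := natDegree_mod_lt q hdpos.ne'
        have h2 : ((q % P) ^ 2).natDegree ≤ 2 * (q % P).natDegree := natDegree_pow_le
        have := natDegree_C_mul_le n ((q % P) ^ 2)
        omega
      · have : P ∣ q - q % P := ⟨q / P, by linear_combination (EuclideanDomain.div_add_mod q P).symm⟩
        have h3 : C n * q ^ 2 - C n * (q % P) ^ 2 = (q - q % P) * (C n * (q + q % P)) := by ring
        rw [h3]
        exact this.mul_right _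
    | zero => exact ⟨0, by simp, by simp, by simp⟩
    | add s s' _ _ h h' =>
      obtain ⟨t, h1, h2, h3⟩ := h
      obtain ⟨t', h1', h2', h3'⟩ := h'
      refine ⟨t + t', fun x => ?_, ?_, ?_⟩
      · rw [eval_add]; exact add_nonneg (h1 x) (h1' x)
      · exact natDegree_add_le_of_degree_le h2 h2'
      · convert dvd_add h3 h3' using 1; ring
  let T : Subsemiring R[X] :=
    { carrier := {s | ∃ t ∈ M.subsemiringClosure, P ∣ s - t}
      zero_mem' := ⟨0, zero_mem _, by simp⟩
      one_mem' := ⟨1, one_mem _, by simp⟩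
      add_mem' := by
        rintro s s' ⟨t, ht, h⟩ ⟨t', ht', h'⟩
        exact ⟨t + t', add_mem ht ht', by convert dvd_add h h' using 1; ring⟩
      mul_mem' := by
        rintro s s' ⟨t, ht, h⟩ ⟨t', ht', h'⟩
        refine ⟨t * t', mul_mem ht ht', ?_⟩
        convert dvd_add (h.mul_right s') (h'.mul_left t) using 1; ring }
  have hMT : ∀ n : R, 0 ≤ n → ∀ q, C n * q ^ 2 ∈ T := fun n hn q =>
    ⟨_, (Submonoid.subsemiringClosure_mem M).2 (AddSubmonoid.subset_closure ⟨n, hn, q, rfl⟩),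
      by rw [sub_self]; exact dvd_zero P⟩
  have hPT : ∀ s, P ∣ s → s ∈ T := fun s hs => ⟨0, zero_mem _, by simpa using hs⟩
  have hneg : (-1 : R[X]) ∉ T := by
    rintro ⟨s, hs, hPs⟩
    obtain ⟨t, h1, h2, h3⟩ := hred s hs
    obtain ⟨r, hr'⟩ : P ∣ -1 - t := by convert dvd_add hPs h3 using 1; ring
    have hev : ∀ x, -1 - t.eval x = P.eval x * r.eval x := fun x => by
      simpa using congrArg (eval x) hr'
    have hr0 : r ≠ 0 := by
      rintro rfl
      have := hev 0
      simp only [eval_zero, mul_zero] at this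
      linarith [h1 0]
    have hdeg : r.natDegree < d := by
      have e1 : (-1 - t).natDegree ≤ 2 * (P.natDegree - 1) :=
        (natDegree_sub_le_of_le (m := 0) (by rw [natDegree_neg, natDegree_one]) h2).trans (by simp)
      rw [hr', natDegree_mul hP0 hr0] at e1
      omega
    have hra : P.eval a * r.eval a < 0 := by rw [← hev]; linarith [h1 a]
    have hrb : P.eval b * r.eval b < 0 := by rw [← hev]; linarith [h1 b]
    have hrab : r.eval a * r.eval b < 0 := by
      by_contra! h
      have := mul_pos_of_neg_of_neg hra hrb
      nlinarith [mul_nonneg h (neg_nonneg.2 hP.le)]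
    obtain ⟨x, -, -, hx⟩ := ih _ hdeg r rfl hrab
    have := hev x
    rw [hx, mul_zero] at this
    linarith [h1 x]
  obtain ⟨Q, hTQ, htot, hQ1, -⟩ := exists_ordering_of_neg_pow_notMem T
    (fun q => by simpa [sq] using hMT 1 zero_le_one q) 1 (by simpa using hneg)
  replace hQ1 : (-1 : R[X]) ∉ Q := by simpa using hQ1 0
  obtain ⟨α, hα⟩ := IsAlgClosed.exists_aeval_eq_zero Ω P
    (by rw [Ne, ← isUnit_iff_degree_eq_zero]; exact hnu)
  have hker : ∀ s : R[X], (aeval α : R[X] →ₐ[R] Ω).toRingHom s = 0 ↔ s ∈ Q ∧ -s ∈ Q := by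
    intro s
    rw [AlgHom.toRingHom_eq_coe, RingHom.coe_coe]
    by_cases hs : P ∣ s
    · refine iff_of_true ?_ ⟨hTQ (hPT s hs), hTQ (hPT _ hs.neg_right)⟩
      obtain ⟨r, rfl⟩ := hs
      simp [hα]
    · obtain ⟨u, v, huv⟩ := (hirr.coprime_iff_not_dvd).2 hs
      refine iff_of_false (fun h => ?_) fun ⟨h1, h2⟩ => hQ1 ?_
      · have := congrArg (aeval α) huv
        simp [hα, h] at this
      · have e1 : -(u * P) ∈ Q := hTQ (hPT _ (dvd_neg.2 (dvd_mul_left P u)))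
        have e2 : -(v * s) ∈ Q := by
          rcases htot v with h | h
          · simpa using Q.mul_mem h h2
          · simpa using Q.mul_mem h h1
        convert Q.add_mem e1 e2 using 1
        rw [← huv]; ring
  have hN := IsOrderCone.map _ Q htot hker
  have hNR := hmax _ hN fun r hr => ⟨C r, hTQ (by simpa using hMT r hr 1), by simp⟩
  have hα' : ∃ r, algebraMap R Ω r = α := by
    rcases htot X with h | h
    · exact hNR α ⟨X, h, by simp⟩
    · obtain ⟨r, hr⟩ := hNR (-α) ⟨-X, h, by simp⟩
      exact ⟨-r, by simp [hr]⟩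
  obtain ⟨r, rfl⟩ := hα'
  refine hr ⟨r, ?_⟩
  rw [aeval_algebraMap_apply, coe_aeval_eq_eval] at hα
  simpa using hα

end Polynomial

universe u in
/-- Every ordering of a commutative ring is induced by a homomorphism to an ordered field with
the intermediate value property for polynomials. -/
theorem exists_ringHom_polyIVT {A : Type u} [CommRing A] (P : Subsemiring A)
    (htot : ∀ a, a ∈ P ∨ -a ∈ P) (hone : -1 ∉ P)
    (hprime : ∀ a b, a * b ∈ P → -(a * b) ∈ P → (a ∈ P ∧ -a ∈ P) ∨ (b ∈ P ∧ -b ∈ P)) :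
    ∃ (R : Type u) (_ : Field R) (_ : LinearOrder R) (_ : IsStrictOrderedRing R),
      Polynomial.PolyIVT R ∧ ∃ ψ : A →+* R, ∀ a, 0 ≤ ψ a ↔ a ∈ P := by
  classical
  let I : Ideal A :=
    { carrier := {a | a ∈ P ∧ -a ∈ P}
      zero_mem' := ⟨P.zero_mem, by simp [P.zero_mem]⟩
      add_mem' := by
        rintro a b ⟨h1, h2⟩ ⟨h3, h4⟩
        exact ⟨P.add_mem h1 h3, by rw [neg_add]; exact P.add_mem h2 h4⟩
      smul_mem' := by
        rintro c a ⟨h1, h2⟩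
        simp only [smul_eq_mul, Set.mem_ofPred_eq]
        rcases htot c with h | h
        · exact ⟨P.mul_mem h h1, by simpa using P.mul_mem h h2⟩
        · exact ⟨by simpa using P.mul_mem h h2, by simpa using P.mul_mem h h1⟩ }
  have hI : I.IsPrime :=
    { ne_top' := fun h => hone ((Ideal.eq_top_iff_one I).1 h).2
      mem_or_mem' := fun {a b} h => hprime a b h.1 h.2 }
  let Ω := AlgebraicClosure (FractionRing (A ⧸ I))
  let φ : A →+* Ω := (algebraMap (FractionRing (A ⧸ I)) Ω).comp
    ((algebraMap (A ⧸ I) (FractionRing (A ⧸ I))).comp (Ideal.Quotient.mk I))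
  have hker : ∀ a, φ a = 0 ↔ a ∈ P ∧ -a ∈ P := by
    intro a
    have : φ a = algebraMap (FractionRing (A ⧸ I)) Ω
      (algebraMap (A ⧸ I) (FractionRing (A ⧸ I)) (Ideal.Quotient.mk I a)) := rfl
    rw [this, map_eq_zero_iff _ (algebraMap (FractionRing (A ⧸ I)) Ω).injective,
      map_eq_zero_iff _ (IsFractionRing.injective (A ⧸ I) (FractionRing (A ⧸ I))),
      Ideal.Quotient.eq_zero_iff_mem]
    rfl
  obtain ⟨N, hPN, hN⟩ := (IsOrderCone.map φ P htot hker).exists_le_maximal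
  let K := IsOrderCone.subfield hN
  have : HasMemOrNegMem (IsOrderCone.ringCone hN) := ⟨fun x => x.2⟩
  let _ : LinearOrder K := LinearOrder.mkOfAddGroupCone (IsOrderCone.ringCone hN)
  have hnonneg : ∀ x : K, 0 ≤ x ↔ (x : Ω) ∈ N := by
    intro x
    change (x - 0 : K) ∈ IsOrderCone.ringCone hN ↔ _
    rw [sub_zero]
    rfl
  have : IsOrderedRing K := IsOrderedRing.mkOfCone (IsOrderCone.ringCone hN)
  have : IsStrictOrderedRing K := IsOrderedRing.toIsStrictOrderedRing K
  refine ⟨K, inferInstance, inferInstance, inferInstance,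
    Polynomial.polyIVT_of_maximal (Ω := Ω) fun N' hN' hsub x hx => ?_, φ.codRestrict K fun a => ?_,
    fun a => ?_⟩
  · have hle : N ≤ N' := fun y hy => hsub ⟨y, Or.inl hy⟩ ((hnonneg _).2 hy)
    exact ⟨⟨x, Or.inl (hN.le_of_ge hN' hle hx)⟩, rfl⟩
  · rcases htot a with h | h
    · exact Or.inl (hPN ⟨a, h, rfl⟩)
    · exact Or.inr (hPN ⟨-a, h, map_neg φ a⟩)
  · rw [hnonneg]
    change φ a ∈ N ↔ a ∈ P
    refine ⟨fun h => ?_, fun h => hPN ⟨a, h, rfl⟩⟩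
    rcases htot a with h' | h'
    · exact h'
    · exact ((hker a).1 (hN.prop.eq_zero _ h (hPN ⟨-a, h', map_neg φ a⟩))).1

namespace Polynomial

open SignType

theorem sign_eq_of_not_mul_neg {R : Type*} [Field R] [LinearOrder R] [IsStrictOrderedRing R]
    {x y : R} (hx : x ≠ 0) (hy : y ≠ 0) (h : ¬ x * y < 0) : sign x = sign y := by
  rcases hx.lt_or_gt with hx | hx <;> rcases hy.lt_or_gt with hy | hy
  · rw [sign_neg hx, sign_neg hy]
  · exact absurd (mul_neg_of_neg_of_pos hx hy) h
  · exact absurd (mul_neg_of_pos_of_neg hx hy) h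
  · rw [sign_pos hx, sign_pos hy]

theorem PolyIVT.sign_eval_eq {R : Type*} [Field R] [LinearOrder R] [IsStrictOrderedRing R]
    (hR : PolyIVT R) (Q : R[X]) {a b : R} (hab : a ≤ b)
    (hQ : ∀ x, a ≤ x → x ≤ b → Q.eval x ≠ 0) : sign (Q.eval a) = sign (Q.eval b) := by
  rcases hab.eq_or_lt with rfl | hab'
  · rfl
  refine sign_eq_of_not_mul_neg (hQ a le_rfl hab) (hQ b hab le_rfl) fun h => ?_
  obtain ⟨x, h1, h2, h3⟩ := hR Q a b hab' h
  exact hQ x h1.le h2.le h3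

/-- A weak form of Rolle's theorem: the critical point may be an end point. -/
theorem PolyIVT.exists_derivative_eval_eq_zero {R : Type*} [Field R] [LinearOrder R]
    [IsStrictOrderedRing R] (hR : PolyIVT R) (P : R[X]) {u v : R} (huv : u < v)
    (hu : P.eval u = 0) (hv : P.eval v = 0) :
    ∃ x, u ≤ x ∧ x ≤ v ∧ (derivative P).eval x = 0 := by
  by_contra! hcon
  have hP0 : P ≠ 0 := by
    rintro rfl
    exact hcon u le_rfl huv.le (by simp)
  obtain ⟨w, hw, hmin⟩ := Finset.exists_min_image
    (P.roots.toFinset.filter fun x => u < x) id ⟨v, by simp [hP0, hv, huv]⟩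
  simp only [Finset.mem_filter, Multiset.mem_toFinset, mem_roots hP0, IsRoot.def, id] at hw hmin
  have hwv : w ≤ v := hmin v ⟨hv, huv⟩
  obtain ⟨Q, hQ⟩ := dvd_iff_isRoot.2 (show P.IsRoot u from hu)
  have hQw : Q.IsRoot w := by
    have := hw.1
    rw [hQ, eval_mul] at this
    refine (mul_eq_zero.1 this).resolve_left ?_
    simpa [sub_eq_zero] using hw.2.ne'
  obtain ⟨s, hs⟩ := dvd_iff_isRoot.2 hQw
  have hPs : P = (X - C u) * ((X - C w) * s) := by rw [hQ, hs]
  have hdu : (derivative P).eval u = (u - w) * s.eval u := by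
    rw [hPs]; simp
  have hdw : (derivative P).eval w = (w - u) * s.eval w := by
    rw [hPs]; simp
  have hsign : sign (s.eval u) = sign (s.eval w) := by
    refine hR.sign_eval_eq s hw.2.le fun x h1 h2 h3 => ?_
    rcases h1.eq_or_lt with rfl | h1
    · exact hcon u le_rfl huv.le (by rw [hdu, h3, mul_zero])
    rcases h2.eq_or_lt with rfl | h2
    · exact hcon x hw.2.le hwv (by rw [hdw, h3, mul_zero])
    · exact absurd (hmin x ⟨by rw [hPs]; simp [h3], h1⟩) (not_le.2 h2)
  have hD : sign ((derivative P).eval u) ≠ sign ((derivative P).eval w) := by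
    have hne : sign (s.eval w) ≠ 0 := by
      intro h
      exact hcon w hw.2.le hwv (by rw [hdw, sign_eq_zero_iff.1 h, mul_zero])
    rw [hdu, hdw, sign_mul, sign_mul, hsign, sign_neg (sub_neg.2 hw.2), sign_pos (sub_pos.2 hw.2)]
    revert hne
    cases sign (s.eval w) <;> decide
  exact hD (hR.sign_eval_eq _ hw.2.le fun x h1 h2 => hcon x h1 (h2.trans hwv))

/-- Roots in `R` of nonzero polynomials over `G` of degree less than `d` come from `G`. -/
def RootsDescend {G R : Type*} [Field G] [Field R] (f : G →+* R) (d : ℕ) : Prop :=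
  ∀ q : G[X], q ≠ 0 → q.natDegree < d → ∀ x, eval₂ f x q = 0 → ∃ c, f c = x

theorem RootsDescend.exists_isRoot {G R : Type*} [Field G] [Field R] {f : G →+* R} {d : ℕ}
    (hf : RootsDescend f d) {q : G[X]} (hq : q ≠ 0) (hd : q.natDegree < d) {x : R} (hx : eval₂ f x q = 0) :
    ∃ c, f c = x ∧ q.IsRoot c := by
  obtain ⟨c, rfl⟩ := hf q hq hd x hx
  refine ⟨c, rfl, ?_⟩
  rw [eval₂_at_apply] at hx
  exact (map_eq_zero f).1 hx

variable {G R R₁ R₂ : Type*} [Field G]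
  [Field R] [LinearOrder R] [IsStrictOrderedRing R]
  [Field R₁] [LinearOrder R₁] [IsStrictOrderedRing R₁]
  [Field R₂] [LinearOrder R₂] [IsStrictOrderedRing R₂]

/-- A polynomial without roots has constant sign. -/
theorem RootsDescend.sign_eval₂_const {f : G →+* R} {d : ℕ} (hf : RootsDescend f d) (hR : PolyIVT R)
    {q : G[X]} (hq : q ≠ 0) (hd : q.natDegree < d) (hroot : ¬ ∃ c, q.IsRoot c) (x y : R) :
    sign (eval₂ f x q) = sign (eval₂ f y q) := by
  wlog hxy : x ≤ y generalizing x y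
  · exact (this y x (le_of_not_ge hxy)).symm
  simp only [← eval_map]
  refine hR.sign_eval_eq _ hxy fun z _ _ hz => hroot ?_
  rw [eval_map] at hz
  obtain ⟨c, -, hc⟩ := hf.exists_isRoot hq hd hz
  exact ⟨c, hc⟩

/-- If `x` and `y` lie in the same position with respect to the roots of `q`, then `q` has the
same sign at both. -/
theorem sign_eval₂_eq {f₁ : G →+* R₁} {f₂ : G →+* R₂} (hR₁ : PolyIVT R₁) (hR₂ : PolyIVT R₂)
    (hs : ∀ z, sign (f₁ z) = sign (f₂ z)) {d : ℕ} (h₁ : RootsDescend f₁ d)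
    (h₂ : RootsDescend f₂ d) {x : R₁} {y : R₂} (q : G[X]) (hd : q.natDegree < d)
    (hxy : ∀ c, q.IsRoot c → sign (x - f₁ c) = sign (y - f₂ c)) :
    sign (eval₂ f₁ x q) = sign (eval₂ f₂ y q) := by
  induction hn : q.natDegree using Nat.strong_induction_on generalizing q with
  | _ n ih =>
  rcases eq_or_ne q 0 with rfl | hq
  · simp
  by_cases hroot : ∃ c, q.IsRoot c
  · obtain ⟨c, hc⟩ := hroot
    obtain ⟨r, rfl⟩ := dvd_iff_isRoot.2 hc
    have hr0 : r ≠ 0 := right_ne_zero_of_mul hq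
    rw [natDegree_mul (X_sub_C_ne_zero c) hr0, natDegree_X_sub_C] at hn hd
    have := ih _ (by omega) r (by omega)
      (fun c' hc' => hxy c' (by simp [IsRoot.def, hc'.eq_zero])) rfl
    simp only [eval₂_mul, eval₂_sub, eval₂_X, eval₂_C, sign_mul, this, hxy c hc]
  · rw [h₁.sign_eval₂_const hR₁ hq hd hroot x (f₁ 0), h₂.sign_eval₂_const hR₂ hq hd hroot y (f₂ 0),
      eval₂_at_apply, eval₂_at_apply, hs]

/-- A root of a nonzero polynomial over `G` is bounded by an element of `G`. -/
theorem exists_lt_map_of_eval₂_eq_zero (f : G →+* R) {P : G[X]} (hP : P ≠ 0) {ξ : R}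
    (hξ : eval₂ f ξ P = 0) : ∃ M, ξ < f M := by
  by_contra! hcon
  have key : ∀ (n : ℕ) (q : G[X]), q.natDegree = n → 0 < f (q.coeff n) →
      ∃ ε, 0 < f ε ∧ f ε ≤ eval₂ f ξ q := by
    intro n
    induction n with
    | zero =>
      intro q hq hpos
      refine ⟨q.coeff 0, hpos, ?_⟩
      conv_rhs => rw [eq_C_of_natDegree_eq_zero hq]
      simp
    | succ n ih =>
      intro q hq hpos
      obtain ⟨ε, hε, hle⟩ := ih q.divX (by rw [natDegree_divX_eq_natDegree_tsub_one, hq]; rfl)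
        (by rwa [coeff_divX])
      refine ⟨1, by simp, ?_⟩
      have h1 := hcon ((1 - q.coeff 0) / ε)
      have h2 := hcon 0
      rw [map_div₀, div_le_iff₀ hε, map_sub, map_one] at h1
      rw [map_zero] at h2
      conv_rhs => rw [← divX_mul_X_add q]
      rw [eval₂_add, eval₂_mul, eval₂_X, eval₂_C, map_one]
      nlinarith [mul_le_mul_of_nonneg_left hle h2]
  have hlc : f (P.coeff P.natDegree) ≠ 0 := by
    rw [Ne, map_eq_zero]; exact leadingCoeff_ne_zero.2 hP
  rcases hlc.lt_or_gt with h | h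
  · obtain ⟨ε, h1, h2⟩ := key _ (-P) rfl (by simpa using h)
    rw [eval₂_neg, hξ, neg_zero] at h2
    exact absurd h1 (not_lt.2 h2)
  · obtain ⟨ε, h1, h2⟩ := key _ P rfl h
    rw [hξ] at h2
    exact absurd h1 (not_lt.2 h2)

theorem exists_map_lt_of_eval₂_eq_zero (f : G →+* R) {P : G[X]} (hP : P ≠ 0) {ξ : R}
    (hξ : eval₂ f ξ P = 0) : ∃ m, f m < ξ := by
  obtain ⟨M, hM⟩ := exists_lt_map_of_eval₂_eq_zero f (P := P.comp (-X)) (ξ := -ξ)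
    (by
      intro h
      rcases comp_eq_zero_iff.1 h with h | h
      · exact hP h
      · have := congrArg natDegree h.2
        simp at this)
    (by rw [eval₂_comp]; simpa using hξ)
  exact ⟨-M, by rw [map_neg]; linarith⟩

theorem map_lt_map_iff_of_sign_eq {f₁ : G →+* R₁} {f₂ : G →+* R₂}
    (hs : ∀ z, sign (f₁ z) = sign (f₂ z)) (a b : G) : f₁ a < f₁ b ↔ f₂ a < f₂ b := by
  rw [← sub_pos, ← sub_pos (a := f₂ b), ← map_sub, ← map_sub, ← sign_eq_one_iff, hs,
    sign_eq_one_iff]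

/-- Between consecutive critical points a polynomial has at most one root. -/
theorem RootsDescend.eq_of_eval₂_eq_zero {f : G →+* R} (hR : PolyIVT R) {P : G[X]}
    (hf : RootsDescend f P.natDegree) (hD : derivative P ≠ 0) {a b : G}
    (hab : ∀ c, (derivative P).IsRoot c → f a < f c → f b ≤ f c) {u v : R}
    (hau : f a < u) (hub : u < f b) (hav : f a < v) (hvb : v < f b)
    (hu : eval₂ f u P = 0) (hv : eval₂ f v P = 0) : u = v := by
  wlog huv : u ≤ v generalizing u v
  · exact (this hav hvb hau hub hv hu (le_of_not_ge huv)).symm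
  by_contra hne
  obtain ⟨x, h1, h2, h3⟩ := hR.exists_derivative_eval_eq_zero (P.map f) (lt_of_le_of_ne huv hne)
    (by rwa [eval_map]) (by rwa [eval_map])
  rw [derivative_map, eval_map] at h3
  obtain ⟨c, rfl, hc⟩ := hf.exists_isRoot hD
    (natDegree_derivative_lt fun h => hD (derivative_of_natDegree_zero h)) h3
  exact absurd (hab c hc (hau.trans_le h1)) (not_le.2 (h2.trans_lt hvb))

/-- Signs of a polynomial with exactly one root `ζ` between `a` and `b`. -/
theorem sign_map_eval_eq {f : G →+* R} (hR : PolyIVT R) {P : G[X]} (hP : ∀ c, ¬ P.IsRoot c)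
    {a b : G} {ζ : R}
    (huniq : ∀ u, f a < u → u < f b → eval₂ f u P = 0 → u = ζ) {c : G} (hac : f a < f c)
    (hcb : f c < f b) :
    (f c < ζ → sign (f (P.eval c)) = sign (f (P.eval a))) ∧
      (ζ < f c → sign (f (P.eval c)) = sign (f (P.eval b))) := by
  have hne : ∀ z : G, eval₂ f (f z) P ≠ 0 := fun z hz => by
    rw [eval₂_at_apply] at hz
    exact hP z ((map_eq_zero f).1 hz)
  simp only [← eval₂_at_apply, ← eval_map] at hne huniq ⊢
  refine ⟨fun h => (hR.sign_eval_eq _ hac.le fun x h1 h2 h3 => ?_).symm,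
    fun h => hR.sign_eval_eq _ hcb.le fun x h1 h2 h3 => ?_⟩
  · rcases h1.eq_or_lt with rfl | h1
    · exact hne _ h3
    · exact absurd (huniq x h1 (h2.trans_lt hcb) h3) (h2.trans_lt h).ne
  · rcases h2.eq_or_lt with rfl | h2
    · exact hne _ h3
    · exact absurd (huniq x (hac.trans_le h1) h2 h3) (h.trans_le h1).ne'

/-- The unique root of a polynomial in an interval without critical points is a sign change. -/
theorem mul_eval_neg_of_eval₂_eq_zero {f : G →+* R} (hR : PolyIVT R) {P : G[X]}
    (hP : ∀ c, ¬ P.IsRoot c) {a b : G} {ζ : R} (haζ : f a < ζ) (hζb : ζ < f b)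
    (hζ : eval₂ f ζ P = 0) (hDζ : eval₂ f ζ (derivative P) ≠ 0)
    (huniq : ∀ u, f a < u → u < f b → eval₂ f u P = 0 → u = ζ) :
    f (P.eval a * P.eval b) < 0 := by
  have hne : ∀ z : G, eval₂ f (f z) P ≠ 0 := fun z hz => by
    rw [eval₂_at_apply] at hz
    exact hP z ((map_eq_zero f).1 hz)
  rw [map_mul, ← eval₂_at_apply, ← eval₂_at_apply]
  rw [← eval_map, ← derivative_map] at hDζ
  simp only [← eval_map] at hne huniq hζ ⊢
  obtain ⟨r, hr⟩ := dvd_iff_isRoot.2 (show (P.map f).IsRoot ζ from hζ)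
  rw [hr] at hDζ hne huniq ⊢
  have hsgn : sign (r.eval (f a)) = sign (r.eval (f b)) := by
    refine hR.sign_eval_eq _ (haζ.trans hζb).le fun x h1 h2 h3 => ?_
    rcases h1.eq_or_lt with rfl | h1
    · exact hne a (by simp [h3])
    rcases h2.eq_or_lt with rfl | h2
    · exact hne b (by simp [h3])
    have := huniq x h1 h2 (by simp [h3])
    subst this
    simp [h3] at hDζ
  have hra : r.eval (f b) ≠ 0 := fun h => hne b (by simp [h])
  rw [← sign_eq_neg_one_iff]
  simp only [eval_mul, sign_mul, hsgn, eval_sub, eval_X, eval_C, sign_neg (sub_neg.2 haζ),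
    sign_pos (sub_pos.2 hζb)]
  rcases hra.lt_or_gt with h | h
  · rw [sign_neg h]; decide
  · rw [sign_pos h]; decide

/-- A root outside `G` has a counterpart filling the same cut of `G`. -/
theorem exists_root_same_cut {f₁ : G →+* R₁} {f₂ : G →+* R₂} (hR₁ : PolyIVT R₁)
    (hR₂ : PolyIVT R₂) (hs : ∀ z, sign (f₁ z) = sign (f₂ z)) {P : G[X]} (hP0 : P ≠ 0)
    (h₁ : RootsDescend f₁ P.natDegree) (h₂ : RootsDescend f₂ P.natDegree) {ξ : R₁}
    (hξ : eval₂ f₁ ξ P = 0) (hout : ∀ c, f₁ c ≠ ξ) :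
    ∃ η, eval₂ f₂ η P = 0 ∧ ∀ c, sign (ξ - f₁ c) = sign (η - f₂ c) := by
  classical
  have hlt := map_lt_map_iff_of_sign_eq hs
  have hP : ∀ c, ¬ P.IsRoot c := by
    intro c hc
    obtain ⟨r, hr⟩ := dvd_iff_isRoot.2 hc
    have hr0 : r ≠ 0 := by rintro rfl; simp at hr; exact hP0 hr
    have hdeg : P.natDegree = 1 + r.natDegree := by
      rw [hr, natDegree_mul (X_sub_C_ne_zero c) hr0, natDegree_X_sub_C]
    rw [hr, eval₂_mul, eval₂_sub, eval₂_X, eval₂_C] at hξ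
    have := (mul_eq_zero.1 hξ).resolve_left (sub_ne_zero.2 (hout c).symm)
    obtain ⟨c', hc'⟩ := h₁ r hr0 (by omega) ξ this
    exact hout c' hc'
  have hdeg : P.natDegree ≠ 0 := by
    intro h
    rw [eq_C_of_natDegree_eq_zero h, eval₂_C, map_eq_zero] at hξ
    rw [eq_C_of_natDegree_eq_zero h, hξ, C_0] at hP0
    exact hP0 rfl
  have : CharZero G := by
    refine ⟨fun m n hmn => ?_⟩
    have := congrArg f₁ hmn
    simpa using this
  have hD : derivative P ≠ 0 := fun h => hdeg (derivative_eq_zero.1 h)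
  have hDξ : eval₂ f₁ ξ (derivative P) ≠ 0 := fun h => by
    obtain ⟨c, hc⟩ := h₁ _ hD (natDegree_derivative_lt hdeg) ξ h
    exact hout c hc
  obtain ⟨m, hm⟩ := exists_map_lt_of_eval₂_eq_zero f₁ hP0 hξ
  obtain ⟨M, hM⟩ := exists_lt_map_of_eval₂_eq_zero f₁ hP0 hξ
  obtain ⟨a, ha, hamax⟩ := Finset.exists_max_image
    ((insert m (derivative P).roots.toFinset).filter fun c => f₁ c < ξ) f₁ ⟨m, by simp [hm]⟩
  obtain ⟨b, hb, hbmin⟩ := Finset.exists_min_image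
    ((insert M (derivative P).roots.toFinset).filter fun c => ξ < f₁ c) f₁ ⟨M, by simp [hM]⟩
  have haξ : f₁ a < ξ := (Finset.mem_filter.1 ha).2
  have hξb : ξ < f₁ b := (Finset.mem_filter.1 hb).2
  have hab : ∀ c, (derivative P).IsRoot c → f₁ a < f₁ c → f₁ b ≤ f₁ c := by
    intro c hc hac
    have hmem : c ∈ (derivative P).roots.toFinset := by simpa [hD] using hc
    refine hbmin c (Finset.mem_filter.2 ⟨Finset.mem_insert_of_mem hmem, ?_⟩)
    by_contra h
    have h' := lt_of_le_of_ne (not_lt.1 h) (hout c)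
    exact absurd (hamax c (Finset.mem_filter.2 ⟨Finset.mem_insert_of_mem hmem, h'⟩))
      (not_le.2 hac)
  have hab₂ : ∀ c, (derivative P).IsRoot c → f₂ a < f₂ c → f₂ b ≤ f₂ c := by
    intro c hc hac
    rw [← not_lt, ← hlt, not_lt]
    exact hab c hc ((hlt _ _).2 hac)
  have huniq₁ : ∀ u, f₁ a < u → u < f₁ b → eval₂ f₁ u P = 0 → u = ξ := fun u hu hu' h =>
    h₁.eq_of_eval₂_eq_zero hR₁ hD hab hu hu' haξ hξb h hξ
  have hneg := mul_eval_neg_of_eval₂_eq_zero hR₁ hP haξ hξb hξ hDξ huniq₁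
  have hneg₂ : f₂ (P.eval a * P.eval b) < 0 := by
    rwa [← sign_eq_neg_one_iff, ← hs, sign_eq_neg_one_iff]
  obtain ⟨η, haη, hηb, hη⟩ := hR₂ (P.map f₂) (f₂ a) (f₂ b) ((hlt _ _).1 (haξ.trans hξb))
    (by rwa [eval_map, eval_map, eval₂_at_apply, eval₂_at_apply, ← map_mul])
  rw [eval_map] at hη
  have huniq₂ : ∀ u, f₂ a < u → u < f₂ b → eval₂ f₂ u P = 0 → u = η := fun u hu hu' h =>
    h₂.eq_of_eval₂_eq_zero hR₂ hD hab₂ hu hu' haη hηb h hη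
  have hPne : sign (f₂ (P.eval a)) ≠ sign (f₂ (P.eval b)) := by
    intro h
    rw [map_mul, ← sign_eq_neg_one_iff, sign_mul, h] at hneg₂
    revert hneg₂
    cases sign (f₂ (P.eval b)) <;> decide
  refine ⟨η, hη, fun c => ?_⟩
  have hηc : f₂ c ≠ η := by
    rintro rfl
    rw [eval₂_at_apply] at hη
    exact hP c ((map_eq_zero f₂).1 hη)
  rcases (hout c).lt_or_gt with hcξ | hcξ
  · suffices h : f₂ c < η by rw [sign_pos (sub_pos.2 hcξ), sign_pos (sub_pos.2 h)]
    by_contra hcη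
    have hcη' := lt_of_le_of_ne (not_lt.1 hcη) hηc.symm
    have hac := haη.trans hcη'
    have hcb := (hlt c b).1 (hcξ.trans hξb)
    have e1 := (sign_map_eval_eq hR₂ hP huniq₂ hac hcb).2 hcη'
    have e2 := (sign_map_eval_eq hR₁ hP huniq₁ ((hlt _ _).2 hac) (hcξ.trans hξb)).1 hcξ
    rw [hs, hs, e1] at e2
    exact hPne e2.symm
  · suffices h : η < f₂ c by rw [sign_neg (sub_neg.2 hcξ), sign_neg (sub_neg.2 h)]
    by_contra hcη
    have hcη' := lt_of_le_of_ne (not_lt.1 hcη) hηc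
    have hcb := hcη'.trans hηb
    have hac := (hlt a c).1 (haξ.trans hcξ)
    have e1 := (sign_map_eval_eq hR₂ hP huniq₂ hac hcb).1 hcη'
    have e2 := (sign_map_eval_eq hR₁ hP huniq₁ (haξ.trans hcξ) ((hlt _ _).2 hcb)).2 hcξ
    rw [hs, hs, e1] at e2
    exact hPne e2

end Polynomial

namespace Polynomial

open SignType

section

variable {G R₁ R₂ : Type*} [Field G]
  [Field R₁] [LinearOrder R₁] [IsStrictOrderedRing R₁]
  [Field R₂] [LinearOrder R₂] [IsStrictOrderedRing R₂]

theorem RootsDescend.succ_of_maximal {f₁ : G →+* R₁} {f₂ : G →+* R₂} (hR₁ : PolyIVT R₁)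
    (hR₂ : PolyIVT R₂) (hs : ∀ z, sign (f₁ z) = sign (f₂ z))
    (hmax : ∀ x y, (∀ q : G[X], sign (eval₂ f₁ x q) = sign (eval₂ f₂ y q)) → ∃ c, f₁ c = x)
    {d : ℕ} (h₁ : RootsDescend f₁ d) (h₂ : RootsDescend f₂ d) : RootsDescend f₁ (d + 1) := by
  intro P hP0 hPd ξ hξ
  rcases (Nat.lt_succ_iff.1 hPd).lt_or_eq with hlt | rfl
  · exact h₁ P hP0 hlt ξ hξ
  by_contra! hout
  obtain ⟨η, hη, hcut⟩ := exists_root_same_cut hR₁ hR₂ hs hP0 h₁ h₂ hξ hout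
  have hdeg : P.natDegree ≠ 0 := by
    intro h
    rw [eq_C_of_natDegree_eq_zero h, eval₂_C, map_eq_zero] at hξ
    rw [eq_C_of_natDegree_eq_zero h, hξ, C_0] at hP0
    exact hP0 rfl
  obtain ⟨c, hc⟩ := hmax ξ η fun q => by
    have h := sign_eval₂_eq hR₁ hR₂ hs h₁ h₂ (q % P) (natDegree_mod_lt q hdeg)
      fun c _ => hcut c
    rw [← EuclideanDomain.div_add_mod q P, eval₂_add, eval₂_add, eval₂_mul, eval₂_mul, hξ, hη,
      zero_mul, zero_mul, zero_add, zero_add]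
    exact h
  exact hout c hc

/-- If no further elements can be adjoined to `G` on both sides simultaneously, then `G` is
algebraically closed in both fields. -/
theorem rootsDescend_of_maximal {f₁ : G →+* R₁} {f₂ : G →+* R₂} (hR₁ : PolyIVT R₁)
    (hR₂ : PolyIVT R₂) (hs : ∀ z, sign (f₁ z) = sign (f₂ z))
    (hmax : ∀ x y, (∀ q : G[X], sign (eval₂ f₁ x q) = sign (eval₂ f₂ y q)) →
      ∃ c, f₁ c = x ∧ f₂ c = y) (d : ℕ) : RootsDescend f₁ d ∧ RootsDescend f₂ d := by
  induction d with
  | zero =>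
    exact ⟨fun q _ h => absurd h (Nat.not_lt_zero _),
      fun q _ h => absurd h (Nat.not_lt_zero _)⟩
  | succ d ih =>
    exact ⟨ih.1.succ_of_maximal hR₁ hR₂ hs
        (fun x y h => (hmax x y h).imp fun c hc => hc.1) ih.2,
      ih.2.succ_of_maximal hR₂ hR₁ (fun z => (hs z).symm)
        (fun y x h => (hmax x y fun q => (h q).symm).imp fun c hc => hc.2) ih.1⟩

theorem exists_sign_eval₂_eq_of_rootsDescend {f₁ : G →+* R₁} {f₂ : G →+* R₂} (hR₁ : PolyIVT R₁)
    (hR₂ : PolyIVT R₂) (hs : ∀ z, sign (f₁ z) = sign (f₂ z))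
    (h₁ : ∀ d, RootsDescend f₁ d) (h₂ : ∀ d, RootsDescend f₂ d) (ξ : R₁) (F : Finset G[X]) :
    ∃ b, ∀ q ∈ F, sign (eval₂ f₁ ξ q) = sign (eval₂ f₂ b q) := by
  classical
  by_cases hin : ∃ c, f₁ c = ξ
  · obtain ⟨c, rfl⟩ := hin
    exact ⟨f₂ c, fun q _ => by rw [eval₂_at_apply, eval₂_at_apply, hs]⟩
  push Not at hin
  let S : Finset G := F.biUnion fun q => q.roots.toFinset
  obtain ⟨b, hb1, hb2⟩ := Order.exists_between_finsets
    ((S.filter fun c => f₁ c < ξ).image f₂) ((S.filter fun c => ξ < f₁ c).image f₂) (by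
      simp only [Finset.mem_image, Finset.mem_filter]
      rintro _ ⟨c, ⟨-, hc⟩, rfl⟩ _ ⟨c', ⟨-, hc'⟩, rfl⟩
      exact (map_lt_map_iff_of_sign_eq hs c c').1 (hc.trans hc'))
  refine ⟨b, fun q hq => ?_⟩
  rcases eq_or_ne q 0 with rfl | hq0
  · simp
  refine sign_eval₂_eq hR₁ hR₂ hs (h₁ _) (h₂ _) q (Nat.lt_succ_self _) fun c hc => ?_
  have hcS : c ∈ S := Finset.mem_biUnion.2 ⟨q, hq, by simpa [hq0] using hc⟩
  rcases (hin c).lt_or_gt with h | h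
  · have := hb1 (f₂ c) (Finset.mem_image_of_mem _ (Finset.mem_filter.2 ⟨hcS, h⟩))
    rw [sign_pos (sub_pos.2 h), sign_pos (sub_pos.2 this)]
  · have := hb2 (f₂ c) (Finset.mem_image_of_mem _ (Finset.mem_filter.2 ⟨hcS, h⟩))
    rw [sign_neg (sub_neg.2 h), sign_neg (sub_neg.2 this)]

end

section

variable {A R₁ R₂ : Type*} [CommRing A]
  [Field R₁] [LinearOrder R₁] [IsStrictOrderedRing R₁]
  [Field R₂] [LinearOrder R₂] [IsStrictOrderedRing R₂]

/-- A subring of `R₁ × R₂` that is the graph of an order isomorphism between subrings. -/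
def SignCompatible {R₁ R₂ : Type*} [Ring R₁] [LinearOrder R₁] [Ring R₂] [LinearOrder R₂]
    (H : Subring (R₁ × R₂)) : Prop :=
  ∀ z ∈ H, sign z.1 = sign z.2

theorem exists_maximal_signCompatible {R₁ R₂ : Type*} [Ring R₁] [LinearOrder R₁] [Ring R₂]
    [LinearOrder R₂] {H : Subring (R₁ × R₂)} (hH : SignCompatible H) :
    ∃ M, H ≤ M ∧ Maximal SignCompatible M := by
  refine zorn_le_nonempty₀ {M | SignCompatible M} (fun c hc hchain y hy => ?_) H hH
  refine ⟨sSup c, fun z hz => ?_, fun z hz => le_sSup hz⟩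
  obtain ⟨M, hM, hzM⟩ := (Subring.mem_sSup_of_directedOn ⟨y, hy⟩ hchain.directedOn).1 hz
  exact hc hM z hzM

/-- The elements of `R₁ × R₂` that can be written as fractions with denominator a power of `s`. -/
def _root_.Subring.divPowers (M : Subring (R₁ × R₂)) {s : R₁ × R₂} (hs : s ∈ M) :
    Subring (R₁ × R₂) where
  carrier := {z | ∃ n : ℕ, z * s ^ n ∈ M}
  mul_mem' := by
    rintro z w ⟨m, hm⟩ ⟨n, hn⟩
    exact ⟨m + n, by convert M.mul_mem hm hn using 1; ring⟩
  one_mem' := ⟨0, by simp⟩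
  add_mem' := by
    rintro z w ⟨m, hm⟩ ⟨n, hn⟩
    refine ⟨m + n, ?_⟩
    convert M.add_mem (M.mul_mem hm (M.pow_mem hs n)) (M.mul_mem hn (M.pow_mem hs m)) using 1
    ring
  zero_mem' := ⟨0, by simp⟩
  neg_mem' := by
    rintro z ⟨m, hm⟩
    exact ⟨m, by rw [neg_mul]; exact M.neg_mem hm⟩

theorem SignCompatible.isField_of_maximal {M : Subring (R₁ × R₂)}
    (hM : Maximal SignCompatible M) : IsField M := by
  refine ⟨⟨0, 1, zero_ne_one⟩, mul_comm, fun {s} hs0 => ?_⟩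
  obtain ⟨⟨s, t⟩, hs⟩ := s
  have hsign := hM.prop _ hs
  simp only at hsign
  have hs' : s ≠ 0 := by
    rintro rfl
    rw [sign_zero, eq_comm, sign_eq_zero_iff] at hsign
    exact hs0 (Subtype.ext (Prod.ext rfl hsign))
  have ht' : t ≠ 0 := by
    rintro rfl
    rw [sign_zero, sign_eq_zero_iff] at hsign
    exact hs' hsign
  have hle : M.divPowers hs ≤ M := by
    refine hM.le_of_ge ?_ fun z hz => ⟨0, by simpa using hz⟩
    rintro ⟨x, y⟩ ⟨n, hn⟩
    have := hM.prop _ hn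
    simp only [Prod.mk_mul_mk, Prod.pow_mk, sign_mul, sign_pow, hsign] at this
    refine mul_right_cancel₀ (pow_ne_zero n ?_) this
    rwa [Ne, sign_eq_zero_iff]
  have hinv : ((s⁻¹, t⁻¹) : R₁ × R₂) ∈ M := hle ⟨1, by
    rw [pow_one, Prod.mk_mul_mk, inv_mul_cancel₀ hs', inv_mul_cancel₀ ht']
    exact M.one_mem⟩
  refine ⟨⟨_, hinv⟩, Subtype.ext ?_⟩
  simp [hs', ht']

/-- Transfer of sign conditions in one variable between real closed fields. -/
theorem exists_sign_eval₂_eq (hR₁ : PolyIVT R₁) (hR₂ : PolyIVT R₂) (α : A →+* R₁) (β : A →+* R₂)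
    (hs : ∀ z, sign (α z) = sign (β z)) (ξ : R₁) (F : Finset A[X]) :
    ∃ b, ∀ q ∈ F, sign (eval₂ α ξ q) = sign (eval₂ β b q) := by
  classical
  obtain ⟨M, hle, hM⟩ := exists_maximal_signCompatible (H := (α.prod β).range) (by
    rintro _ ⟨z, rfl⟩
    exact hs z)
  let : Field M := (SignCompatible.isField_of_maximal hM).toField
  let f₁ : M →+* R₁ := (RingHom.fst R₁ R₂).comp M.subtype
  let f₂ : M →+* R₂ := (RingHom.snd R₁ R₂).comp M.subtype
  have hsM : ∀ z, sign (f₁ z) = sign (f₂ z) := fun z => hM.prop _ z.2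
  have hroots := rootsDescend_of_maximal (f₁ := f₁) (f₂ := f₂) hR₁ hR₂ hsM (by
    intro x y hxy
    let e : M[X] →+* R₁ × R₂ := eval₂RingHom M.subtype (x, y)
    have he1 : ∀ q, (e q).1 = eval₂ f₁ x q := fun q =>
      hom_eval₂ q M.subtype (RingHom.fst R₁ R₂) (x, y)
    have he2 : ∀ q, (e q).2 = eval₂ f₂ y q := fun q =>
      hom_eval₂ q M.subtype (RingHom.snd R₁ R₂) (x, y)
    have hrange : e.range ≤ M := by
      refine hM.le_of_ge ?_ fun z hz => ⟨C ⟨z, hz⟩, by simp [e]⟩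
      rintro _ ⟨q, rfl⟩
      rw [he1, he2]
      exact hxy q
    exact ⟨⟨(x, y), hrange ⟨X, by simp [e]⟩⟩, rfl, rfl⟩)
  let γ : A →+* M := (α.prod β).codRestrict M fun z => hle ⟨z, rfl⟩
  obtain ⟨b, hb⟩ := exists_sign_eval₂_eq_of_rootsDescend hR₁ hR₂ hsM (fun d => (hroots d).1)
    (fun d => (hroots d).2) ξ (F.image (Polynomial.map γ))
  refine ⟨b, fun q hq => ?_⟩
  have := hb _ (Finset.mem_image_of_mem _ hq)
  rwa [eval₂_map, eval₂_map] at this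

end

end Polynomial

section Ultrapower

open Filter SignType

variable {I : Type*} (U : Ultrafilter I)

theorem Filter.Germ.coe_eval {l : Filter I} (Q : Polynomial (I → ℝ)) (a : I → ℝ) :
    (Q.map (Germ.coeRingHom l)).eval (a : Germ l ℝ) =
      ((fun i => (Q.map (Pi.evalRingHom (fun _ => ℝ) i)).eval (a i) : I → ℝ) : Germ l ℝ) := by
  have h : ∀ i, (Q.map (Pi.evalRingHom (fun _ => ℝ) i)).eval (a i) = Q.eval a i := fun i => by
    rw [Polynomial.eval_map]
    exact Polynomial.eval₂_at_apply (Pi.evalRingHom (fun _ => ℝ) i) a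
  simp only [h]
  rw [Polynomial.eval_map]
  exact Polynomial.eval₂_at_apply (Germ.coeRingHom l) a

theorem polyIVT_real : Polynomial.PolyIVT ℝ := by
  intro P a b hab h
  have hc : ContinuousOn (fun x => P.eval x) (Set.Icc a b) := P.continuous.continuousOn
  have key : (0 : ℝ) ∈ (fun x => P.eval x) '' Set.Ioo a b := by
    rcases mul_neg_iff.1 h with h | h
    · exact intermediate_value_Ioo' hab.le hc ⟨h.2, h.1⟩
    · exact intermediate_value_Ioo hab.le hc ⟨h.1, h.2⟩
  obtain ⟨x, hx, h0⟩ := key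
  exact ⟨x, hx.1, hx.2, h0⟩

theorem polyIVT_germ : Polynomial.PolyIVT (Germ (U : Filter I) ℝ) := by
  intro P a b hab h
  obtain ⟨Q, rfl⟩ := Polynomial.map_surjective (Germ.coeRingHom (U : Filter I))
    (fun z => Germ.inductionOn z fun u => ⟨u, rfl⟩) P
  induction a using Germ.inductionOn with | _ a =>
  induction b using Germ.inductionOn with | _ b =>
  have hx : ∀ i, ∃ x, a i < b i → (Q.map (Pi.evalRingHom (fun _ => ℝ) i)).eval (a i) *
      (Q.map (Pi.evalRingHom (fun _ => ℝ) i)).eval (b i) < 0 →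
      a i < x ∧ x < b i ∧ (Q.map (Pi.evalRingHom (fun _ => ℝ) i)).eval x = 0 := by
    intro i
    by_cases h : a i < b i ∧ (Q.map (Pi.evalRingHom (fun _ => ℝ) i)).eval (a i) *
      (Q.map (Pi.evalRingHom (fun _ => ℝ) i)).eval (b i) < 0
    · obtain ⟨x, hx⟩ := polyIVT_real _ _ _ h.1 h.2
      exact ⟨x, fun _ _ => hx⟩
    · exact ⟨0, fun h1 h2 => absurd ⟨h1, h2⟩ h⟩
  choose x hx using hx
  rw [Germ.coe_eval, Germ.coe_eval, ← Germ.coe_mul] at h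
  have h' := Germ.coe_lt.1 (show _ < ((fun _ => 0 : I → ℝ) : Germ (U : Filter I) ℝ) from h)
  have hab' := Germ.coe_lt.1 hab
  refine ⟨x, Germ.coe_lt.2 ?_, Germ.coe_lt.2 ?_, ?_⟩
  · filter_upwards [h', hab'] with i h1 h2 using (hx i h2 h1).1
  · filter_upwards [h', hab'] with i h1 h2 using (hx i h2 h1).2.1
  · rw [Germ.coe_eval]
    refine Germ.coe_eq.2 ?_
    filter_upwards [h', hab'] with i h1 h2 using (hx i h2 h1).2.2

theorem eventually_sign_eq_sign_coe (u : I → ℝ) :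
    ∀ᶠ i in U, sign (u i) = sign (u : Germ (U : Filter I) ℝ) := by
  rcases lt_trichotomy (u : Germ (U : Filter I) ℝ) 0 with h | h | h
  · rw [sign_neg h]
    filter_upwards [Germ.coe_lt.1 (show _ < ((fun _ => 0 : I → ℝ) : Germ (U : Filter I) ℝ) from h)]
      with i hi using sign_neg hi
  · rw [h, sign_zero]
    filter_upwards [Germ.coe_eq.1 (show _ = ((fun _ => 0 : I → ℝ) : Germ (U : Filter I) ℝ) from h)]
      with i hi
    rw [hi, sign_zero]
  · rw [sign_pos h]
    filter_upwards [Germ.coe_pos.1 h] with i hi using sign_pos hi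

end Ultrapower

section ArtinLang

open Filter SignType

theorem sign_map_real {R : Type*} [Field R] [LinearOrder R] [IsStrictOrderedRing R]
    (f : ℝ →+* R) (r : ℝ) : sign (f r) = sign r := by
  have hpos : ∀ r : ℝ, 0 < r → 0 < f r := fun r hr => by
    refine lt_of_le_of_ne ?_ fun h => hr.ne' ((map_eq_zero f).1 h.symm)
    rw [← Real.mul_self_sqrt hr.le, map_mul]
    exact mul_self_nonneg _
  rcases lt_trichotomy r 0 with h | rfl | h
  · have := hpos (-r) (neg_pos.2 h)
    rw [map_neg, neg_pos] at this
    rw [sign_neg h, sign_neg this]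
  · rw [map_zero, sign_zero, sign_zero]
  · rw [sign_pos h, sign_pos (hpos r h)]

theorem map_eq_eval₂_finSuccEquiv {R : Type*} [CommRing R] {n : ℕ}
    (φ : MvPolynomial (Fin (n + 1)) ℝ →+* R) (p : MvPolynomial (Fin (n + 1)) ℝ) :
    φ p = (finSuccEquiv ℝ n p).eval₂ (φ.comp (rename Fin.succ).toRingHom) (φ (X 0)) := by
  have h : φ = (Polynomial.eval₂RingHom (φ.comp (rename Fin.succ).toRingHom) (φ (X 0))).comp
      (finSuccEquiv ℝ n).toRingEquiv.toRingHom := by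
    refine ringHom_ext (fun r => ?_) fun i => ?_
    · simp [finSuccEquiv_apply]
    · refine Fin.cases ?_ (fun i => ?_) i
      · simp [finSuccEquiv_apply]
      · simp [finSuccEquiv_apply]
  exact DFunLike.congr_fun h p

/-- The Artin–Lang theorem: sign conditions realised in a real closed field are realised
over the reals. -/
theorem artin_lang {R : Type*} [Field R] [LinearOrder R] [IsStrictOrderedRing R]
    (hR : Polynomial.PolyIVT R) (n : ℕ) (φ : MvPolynomial (Fin n) ℝ →+* R) (F : Finset (MvPolynomial (Fin n) ℝ)) :
    ∃ a : Fin n → ℝ, ∀ p ∈ F, sign (φ p) = sign (eval a p) := by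
  classical
  induction n with
  | zero =>
    refine ⟨0, fun p _ => ?_⟩
    rw [eq_C_of_isEmpty p, eval_C]
    exact sign_map_real (φ.comp C) _
  | succ n ih =>
    let α := φ.comp (rename Fin.succ : MvPolynomial (Fin n) ℝ →ₐ[ℝ] _).toRingHom
    choose a ha using fun S => ih α S
    let U : Ultrafilter (Finset (MvPolynomial (Fin n) ℝ)) := Ultrafilter.of atTop
    let β : MvPolynomial (Fin n) ℝ →+* Germ (U : Filter (Finset (MvPolynomial (Fin n) ℝ))) ℝ :=
      (Germ.coeRingHom _).comp (RingHom.pi fun S => eval (a S))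
    have hβ : ∀ p, sign (α p) = sign (β p) := by
      intro p
      have h1 := eventually_sign_eq_sign_coe U (fun S => eval (a S) p)
      have h2 : ∀ᶠ S in (U : Filter (Finset (MvPolynomial (Fin n) ℝ))), p ∈ S := by
        refine Ultrafilter.of_le atTop ?_
        filter_upwards [Filter.eventually_ge_atTop {p}] with S hS using hS (by simp)
      obtain ⟨S, hS1, hS2⟩ := (h1.and h2).exists
      rw [ha S p hS2, hS1]
      rfl
    obtain ⟨b, hb⟩ := Polynomial.exists_sign_eval₂_eq hR (polyIVT_germ U) α β hβ (φ (X 0))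
      (F.image (finSuccEquiv ℝ n))
    induction b using Germ.inductionOn with | _ b =>
    have hev : ∀ p ∈ F, ∀ᶠ S in (U : Filter (Finset (MvPolynomial (Fin n) ℝ))),
        sign (φ p) = sign (eval (Fin.cons (b S) (a S) : Fin (n + 1) → ℝ) p) := by
      intro p hp
      have h1 := hb _ (Finset.mem_image_of_mem _ hp)
      rw [← map_eq_eval₂_finSuccEquiv φ p] at h1
      have h2 := Germ.coe_eval (l := (U : Filter (Finset (MvPolynomial (Fin n) ℝ))))
        ((finSuccEquiv ℝ n p).map (RingHom.pi fun S => eval (a S))) b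
      rw [Polynomial.map_map, Polynomial.eval_map] at h2
      rw [h2] at h1
      filter_upwards [eventually_sign_eq_sign_coe U _] with S hS
      rw [h1, ← hS, eval_eq_eval_mv_eval', Polynomial.map_map]
      rfl
    obtain ⟨S, hS⟩ := ((Filter.eventually_all_finset F).2 hev).exists
    exact ⟨_, hS⟩

end ArtinLang

section SumOfSquares

variable {n : ℕ}

theorem isSOS_sq (q : MvPolynomial (Fin n) ℝ) : IsSOS (q ^ 2) :=
  ⟨1, fun _ => q, by simp⟩

theorem isSOS_zero : IsSOS (0 : MvPolynomial (Fin n) ℝ) :=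
  ⟨0, fun _ => 0, by simp⟩

theorem IsSOS.add {p q : MvPolynomial (Fin n) ℝ} (hp : IsSOS p) (hq : IsSOS q) :
    IsSOS (p + q) := by
  obtain ⟨a, u, rfl⟩ := hp
  obtain ⟨b, v, rfl⟩ := hq
  exact ⟨a + b, Fin.append u v, by simp [Fin.sum_univ_add]⟩

theorem IsSOS.mul_sq {p : MvPolynomial (Fin n) ℝ} (hp : IsSOS p) (q : MvPolynomial (Fin n) ℝ) :
    IsSOS (p * q ^ 2) := by
  obtain ⟨a, u, rfl⟩ := hp
  exact ⟨a, fun i => u i * q, by simp [Finset.sum_mul, mul_pow]⟩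

theorem IsSOS.C_mul {p : MvPolynomial (Fin n) ℝ} (hp : IsSOS p) {c : ℝ} (hc : 0 ≤ c) :
    IsSOS (C c * p) := by
  have := hp.mul_sq (C (√c))
  rwa [← C_pow, Real.sq_sqrt hc, mul_comm] at this

theorem isSOS_sum {ι : Type*} (s : Finset ι) {p : ι → MvPolynomial (Fin n) ℝ}
    (hp : ∀ i ∈ s, IsSOS (p i)) : IsSOS (∑ i ∈ s, p i) :=
  Finset.sum_induction p IsSOS (fun _ _ => IsSOS.add) isSOS_zero hp

theorem IsSOS.eval_nonneg {p : MvPolynomial (Fin n) ℝ} (hp : IsSOS p) (x : Fin n → ℝ) :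
    0 ≤ eval x p := by
  obtain ⟨a, u, rfl⟩ := hp
  simp only [map_sum, map_pow]
  positivity

/-- Completing the square. -/
theorem isSOS_add_C_add_sq (q : MvPolynomial (Fin n) ℝ) {ε : ℝ} (hε : 0 < ε) :
    IsSOS (q + C ε + C (1 / (4 * ε)) * q ^ 2) := by
  have h : q + C ε + C (1 / (4 * ε)) * q ^ 2 = C (1 / (4 * ε)) * (q + C (2 * ε)) ^ 2 := by
    have h1 : C (1 / (4 * ε)) * C (2 * ε) * 2 = (1 : MvPolynomial (Fin n) ℝ) := by
      rw [← C_mul, ← map_ofNat C 2, ← C_mul, ← C_1]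
      congr 1
      field_simp
      norm_num
    have h2 : C (1 / (4 * ε)) * C (2 * ε) ^ 2 = (C ε : MvPolynomial (Fin n) ℝ) := by
      rw [← C_pow, ← C_mul]
      congr 1
      field_simp
      norm_num
    linear_combination -(q * h1) - h2
  rw [h]
  exact (isSOS_sq _).C_mul (by positivity)

theorem exists_isSOS_add_C_add_pow (q : MvPolynomial (Fin n) ℝ) (m : ℕ) {ε : ℝ} (hε : 0 < ε) :
    ∃ c : ℝ, 0 ≤ c ∧ IsSOS (q + C ε + C c * q ^ 2 ^ (m + 1)) := by
  induction m generalizing ε with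
  | zero => exact ⟨1 / (4 * ε), by positivity, by simpa using isSOS_add_C_add_sq q hε⟩
  | succ m ih =>
    obtain ⟨c, -, hsos⟩ := ih (half_pos hε)
    have hsq := isSOS_add_C_add_sq (-(C c * q ^ 2 ^ (m + 1))) (half_pos hε)
    refine ⟨1 / (4 * (ε / 2)) * c ^ 2, by positivity, ?_⟩
    convert hsos.add hsq using 1
    have h : (C ε : MvPolynomial (Fin n) ℝ) = C (ε / 2) + C (ε / 2) := by rw [← C_add, add_halves]
    rw [h, C_mul, C_pow, pow_succ 2 (m + 1), pow_mul]
    ring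

end SumOfSquares

section Preordering

variable {n m : ℕ} (g : Fin m → MvPolynomial (Fin n) ℝ)

/-- The multiplicative set of products of a square with a product of distinct constraints. -/
def squareProducts : Submonoid (MvPolynomial (Fin n) ℝ) where
  carrier := {p | ∃ (q : MvPolynomial (Fin n) ℝ) (S : Finset (Fin m)), p = q ^ 2 * ∏ j ∈ S, g j}
  one_mem' := ⟨1, ∅, by simp⟩
  mul_mem' := by
    rintro _ _ ⟨q, S, rfl⟩ ⟨r, S', rfl⟩
    refine ⟨q * r * ∏ j ∈ S ∩ S', g j, symmDiff S S', ?_⟩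
    have h1 : (∏ j ∈ S, g j) * ∏ j ∈ S', g j =
        (∏ j ∈ S ∪ S', g j) * ∏ j ∈ S ∩ S', g j := (Finset.prod_union_inter).symm
    have h2 : ∏ j ∈ S ∪ S', g j = (∏ j ∈ symmDiff S S', g j) * ∏ j ∈ S ∩ S', g j := by
      rw [← Finset.prod_union]
      · congr 1
        exact (symmDiff_sup_inf S S').symm
      · exact disjoint_symmDiff_inf S S'
    calc q ^ 2 * (∏ j ∈ S, g j) * (r ^ 2 * ∏ j ∈ S', g j)
        = q ^ 2 * r ^ 2 * ((∏ j ∈ S, g j) * ∏ j ∈ S', g j) := by ring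
      _ = _ := by rw [h1, h2]; ring

/-- The preordering generated by `g`. -/
noncomputable def preordering : Subsemiring (MvPolynomial (Fin n) ℝ) :=
  (squareProducts g).subsemiringClosure

theorem exists_of_mem_preordering {p : MvPolynomial (Fin n) ℝ} (hp : p ∈ preordering g) :
    ∃ σ : Finset (Fin m) → MvPolynomial (Fin n) ℝ,
      (∀ S, IsSOS (σ S)) ∧ p = ∑ S, σ S * ∏ j ∈ S, g j := by
  classical
  rw [preordering, Submonoid.subsemiringClosure_mem] at hp
  induction hp using AddSubmonoid.closure_induction with
  | mem x hx =>
    obtain ⟨q, S, rfl⟩ := hx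
    refine ⟨Pi.single S (q ^ 2), fun S' => ?_, ?_⟩
    · rcases eq_or_ne S' S with rfl | h
      · rw [Pi.single_eq_same]; exact isSOS_sq q
      · rw [Pi.single_eq_of_ne h]; exact isSOS_zero
    · rw [Finset.sum_eq_single S]
      · rw [Pi.single_eq_same]
      · intro S' _ h
        rw [Pi.single_eq_of_ne h, zero_mul]
      · simp
  | zero => exact ⟨0, fun _ => isSOS_zero, by simp⟩
  | add x y _ _ hx hy =>
    obtain ⟨σ, hσ, rfl⟩ := hx
    obtain ⟨τ, hτ, rfl⟩ := hy
    exact ⟨σ + τ, fun S => (hσ S).add (hτ S), by simp [add_mul, Finset.sum_add_distrib]⟩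

theorem sq_mul_prod_mem_preordering (q : MvPolynomial (Fin n) ℝ) (S : Finset (Fin m)) :
    q ^ 2 * ∏ j ∈ S, g j ∈ preordering g := by
  rw [preordering, Submonoid.subsemiringClosure_mem]
  exact AddSubmonoid.subset_closure ⟨q, S, rfl⟩

end Preordering

section Stengle

open SignType

variable {n m₁ m₂ : ℕ}

/-- The real Nullstellensatz relative to `h = 0`, `g ≥ 0`. -/
theorem exists_neg_pow_eq_of_vanishing (h : Fin m₁ → MvPolynomial (Fin n) ℝ)
    (g : Fin m₂ → MvPolynomial (Fin n) ℝ) (q : MvPolynomial (Fin n) ℝ)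
    (hq : ∀ x ∈ feasSet h g, eval x q = 0) :
    ∃ (l : ℕ) (φ : Fin m₁ → MvPolynomial (Fin n) ℝ)
      (σ : Finset (Fin m₂) → MvPolynomial (Fin n) ℝ),
      (∀ S, IsSOS (σ S)) ∧
        -(q ^ 2) ^ l = ∑ i, φ i * h i + ∑ S, σ S * ∏ j ∈ S, g j := by
  classical
  let J : Ideal (MvPolynomial (Fin n) ℝ) := Ideal.span (Set.range h)
  let T : Subsemiring (MvPolynomial (Fin n) ℝ) :=
    ((preordering g).map (Ideal.Quotient.mk J)).comap (Ideal.Quotient.mk J)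
  have hpre : preordering g ≤ T := fun p hp => ⟨p, hp, rfl⟩
  have hJ : ∀ p ∈ J, p ∈ T := fun p hp =>
    ⟨0, zero_mem _, by rw [map_zero, Ideal.Quotient.eq_zero_iff_mem.2 hp]⟩
  by_cases hT : ∃ l : ℕ, -(q ^ 2) ^ l ∈ T
  · obtain ⟨l, p, hp, hpl⟩ := hT
    obtain ⟨σ, hσ, rfl⟩ := exists_of_mem_preordering g hp
    have hmem := Ideal.Quotient.eq.1 hpl.symm
    obtain ⟨φ, hφ⟩ := Ideal.mem_span_range_iff_exists_fun.1 hmem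
    exact ⟨l, φ, σ, hσ, by rw [hφ]; ring⟩
  exfalso
  push Not at hT
  obtain ⟨P, hTP, htot, hP, hprime⟩ := exists_ordering_of_neg_pow_notMem T (fun a => hpre (by
    simpa [sq] using sq_mul_prod_mem_preordering g a ∅)) q hT
  obtain ⟨R, _, _, _, hR, ψ, hψ⟩ := exists_ringHom_polyIVT P htot
    (by simpa using hP 0) hprime
  obtain ⟨a, ha⟩ := artin_lang hR n ψ
    (insert q (Finset.univ.image h ∪ Finset.univ.image g))
  have haK : a ∈ feasSet h g := by
    refine ⟨fun i => ?_, fun j => ?_⟩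
    · have h1 := ha (h i) (by simp)
      have hi : h i ∈ J := Ideal.subset_span ⟨i, rfl⟩
      have h2 := (hψ (h i)).2 (hTP (hJ _ hi))
      have h3 := (hψ (-h i)).2 (hTP (hJ _ (J.neg_mem hi)))
      rw [map_neg] at h3
      rw [le_antisymm (neg_nonneg.1 h3) h2, sign_zero] at h1
      exact sign_eq_zero_iff.1 h1.symm
    · have h1 := ha (g j) (by simp)
      have h2 := (hψ (g j)).2 (hTP (hpre (by
        simpa using sq_mul_prod_mem_preordering g 1 {j})))
      exact sign_nonneg_iff.1 (h1 ▸ sign_nonneg_iff.2 h2)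
  have h1 := ha q (by simp)
  rw [hq a haK, sign_zero, sign_eq_zero_iff] at h1
  exact hP 1 ((hψ _).1 (by simp [h1]))

theorem exists_neg_two_pow_eq_of_vanishing (h : Fin m₁ → MvPolynomial (Fin n) ℝ)
    (g : Fin m₂ → MvPolynomial (Fin n) ℝ) (q : MvPolynomial (Fin n) ℝ)
    (hq : ∀ x ∈ feasSet h g, eval x q = 0) :
    ∃ (l : ℕ) (φ : Fin m₁ → MvPolynomial (Fin n) ℝ)
      (σ : Finset (Fin m₂) → MvPolynomial (Fin n) ℝ),
      (∀ S, IsSOS (σ S)) ∧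
        -q ^ 2 ^ (l + 1) = ∑ i, φ i * h i + ∑ S, σ S * ∏ j ∈ S, g j := by
  obtain ⟨l, φ, σ, hσ, heq⟩ := exists_neg_pow_eq_of_vanishing h g q hq
  obtain ⟨j, hj⟩ := Nat.exists_eq_add_of_le (Nat.lt_two_pow_self (n := l)).le
  refine ⟨l, fun i => φ i * (q ^ j) ^ 2, fun S => σ S * (q ^ j) ^ 2,
    fun S => (hσ S).mul_sq _, ?_⟩
  calc -q ^ 2 ^ (l + 1) = -(q ^ 2) ^ l * (q ^ j) ^ 2 := by
        rw [pow_succ, hj]; ring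
    _ = _ := by
        rw [heq, add_mul, Finset.sum_mul, Finset.sum_mul]
        congr 1 <;> exact Finset.sum_congr rfl fun i _ => by ring

/-- A nonnegative function on a finite set is interpolated by a sum of squares. -/
theorem exists_isSOS_eval_eq {K : Set (Fin n → ℝ)} (hK : K.Finite) (F : (Fin n → ℝ) → ℝ)
    (hF : ∀ u ∈ K, 0 ≤ F u) :
    ∃ s : MvPolynomial (Fin n) ℝ, IsSOS s ∧ ∀ u ∈ K, eval u s = F u := by
  classical
  let D : (Fin n → ℝ) → MvPolynomial (Fin n) ℝ := fun u =>
    ∏ v ∈ hK.toFinset.erase u, ∑ i, (X i - C (v i)) ^ 2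
  have hD0 : ∀ u v, v ∈ K → v ≠ u → eval v (D u) = 0 := by
    intro u v hv hvu
    rw [map_prod]
    exact Finset.prod_eq_zero (Finset.mem_erase.2 ⟨hvu, hK.mem_toFinset.2 hv⟩) (by simp)
  have hD1 : ∀ u, eval u (D u) ≠ 0 := by
    intro u
    rw [map_prod, Finset.prod_ne_zero_iff]
    intro v hv h0
    simp only [map_sum, map_pow, map_sub, eval_X, eval_C] at h0
    rw [Finset.sum_eq_zero_iff_of_nonneg fun i _ => sq_nonneg _] at h0
    refine (Finset.mem_erase.1 hv).1 (funext fun i => ?_)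
    have := h0 i (Finset.mem_univ i)
    exact (sub_eq_zero.1 (pow_eq_zero_iff two_ne_zero |>.1 this)).symm
  refine ⟨∑ u ∈ hK.toFinset, C (F u / eval u (D u) ^ 2) * D u ^ 2,
    isSOS_sum _ fun u hu => (isSOS_sq _).C_mul ?_, fun u hu => ?_⟩
  · exact div_nonneg (hF u (hK.mem_toFinset.1 hu)) (sq_nonneg _)
  · rw [map_sum, Finset.sum_eq_single u]
    · rw [map_mul, eval_C, map_pow, div_mul_cancel₀ _ (pow_ne_zero 2 (hD1 u))]
    · intro v _ hvu
      rw [map_mul, map_pow, hD0 v u hu hvu.symm]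
      simp
    · intro hu'
      exact absurd (hK.mem_toFinset.2 hu) hu'

theorem eval_nonneg_of_mem_truncIdeal_add_truncPreord {h : Fin m₁ → MvPolynomial (Fin n) ℝ}
    {g : Fin m₂ → MvPolynomial (Fin n) ℝ} {k : ℕ} {p : MvPolynomial (Fin n) ℝ}
    (hp : p ∈ truncIdeal h k + truncPreord g k) {x : Fin n → ℝ} (hx : x ∈ feasSet h g) :
    0 ≤ eval x p := by
  obtain ⟨_, ⟨φ, -, rfl⟩, _, ⟨σ, hσ, rfl⟩, rfl⟩ := Set.mem_add.1 hp
  simp only [map_add, map_sum, map_mul, map_prod, hx.1, mul_zero, Finset.sum_const_zero, zero_add]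
  exact Finset.sum_nonneg fun S _ => mul_nonneg ((hσ S).1.eval_nonneg x)
    (Finset.prod_nonneg fun j _ => hx.2 j)

/-- The certificates for `f - fm + ε` have degree bounded independently of `ε`. -/
theorem exists_forall_mem_truncIdeal_add_truncPreord (f : MvPolynomial (Fin n) ℝ)
    (h : Fin m₁ → MvPolynomial (Fin n) ℝ) (g : Fin m₂ → MvPolynomial (Fin n) ℝ)
    (hK : (feasSet h g).Finite) (fm : ℝ) (hfm : ∀ x ∈ feasSet h g, fm ≤ eval x f) :
    ∃ N : ℕ, ∀ k ≥ N, ∀ ε > 0, f - C (fm - ε) ∈ truncIdeal h k + truncPreord g k := by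
  classical
  obtain ⟨s, hs, hsK⟩ := exists_isSOS_eval_eq hK (fun x => eval x f - fm)
    fun x hx => sub_nonneg.2 (hfm x hx)
  obtain ⟨q, hq⟩ : ∃ q, q = f - C fm - s := ⟨_, rfl⟩
  obtain ⟨l, φ, σ, hσ, heq⟩ := exists_neg_two_pow_eq_of_vanishing h g q fun x hx => by
    rw [hq, map_sub, map_sub, eval_C, hsK x hx, sub_self]
  refine ⟨∑ i, (φ i * h i).totalDegree + ∑ S, (σ S * ∏ j ∈ S, g j).totalDegree +
    q.totalDegree + (q ^ 2 ^ (l + 1)).totalDegree + s.totalDegree, fun k hk ε hε => ?_⟩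
  obtain ⟨c, hc, hsos⟩ := exists_isSOS_add_C_add_pow q l hε
  have hCmul : ∀ p : MvPolynomial (Fin n) ℝ, (C c * p).totalDegree ≤ p.totalDegree := fun p => by
    simpa using totalDegree_mul (C c) p
  have hφdeg : ∀ i, (φ i * h i).totalDegree ≤ ∑ i, (φ i * h i).totalDegree := fun i =>
    Finset.single_le_sum (f := fun i => (φ i * h i).totalDegree) (fun _ _ => Nat.zero_le _)
      (Finset.mem_univ i)
  have hσdeg : ∀ S, (σ S * ∏ j ∈ S, g j).totalDegree ≤
      ∑ S, (σ S * ∏ j ∈ S, g j).totalDegree := fun S =>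
    Finset.single_le_sum (f := fun S => (σ S * ∏ j ∈ S, g j).totalDegree)
      (fun _ _ => Nat.zero_le _) (Finset.mem_univ S)
  obtain ⟨w, hw⟩ : ∃ w, w = q + C ε + C c * q ^ 2 ^ (l + 1) + s := ⟨_, rfl⟩
  have hwsos : IsSOS w := hw ▸ hsos.add hs
  have hwdeg : w.totalDegree ≤ 2 * k := by
    have h1 := hCmul (q ^ 2 ^ (l + 1))
    have h2 := totalDegree_add (q + C ε + C c * q ^ 2 ^ (l + 1)) s
    have h3 := totalDegree_add (q + C ε) (C c * q ^ 2 ^ (l + 1))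
    have h4 := totalDegree_add q (C ε)
    rw [totalDegree_C] at h4
    rw [← hw] at h2
    omega
  refine Set.mem_add.2 ⟨∑ i, C c * φ i * h i, ⟨fun i => C c * φ i, fun i => ?_, rfl⟩,
    ∑ S, (C c * σ S + Pi.single (M := fun _ => MvPolynomial (Fin n) ℝ) ∅ w S) * ∏ j ∈ S, g j,
    ⟨_, fun S => ⟨?_, ?_⟩, rfl⟩, ?_⟩
  · have h1 := hCmul (φ i * h i)
    have h2 := hφdeg i
    rw [mul_assoc]
    omega
  · refine ((hσ S).C_mul hc).add ?_
    rcases eq_or_ne S ∅ with rfl | hS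
    · rwa [Pi.single_eq_same]
    · rw [Pi.single_eq_of_ne hS]; exact isSOS_zero
  · have h1 := hCmul (σ S * ∏ j ∈ S, g j)
    have h2 := hσdeg S
    rcases eq_or_ne S ∅ with rfl | hS
    · rw [Pi.single_eq_same]
      have h3 := totalDegree_add (C c * σ ∅) w
      simp only [Finset.prod_empty, mul_one] at h1 h2 ⊢
      omega
    · rw [Pi.single_eq_of_ne hS, add_zero, mul_assoc]
      omega
  · have hsingle : ∑ S, Pi.single (M := fun _ => MvPolynomial (Fin n) ℝ) ∅ w S * ∏ j ∈ S, g j =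
        w := by
      rw [Finset.sum_eq_single ∅]
      · simp
      · intro S _ hS
        rw [Pi.single_eq_of_ne hS, zero_mul]
      · simp
    simp only [add_mul, Finset.sum_add_distrib, hsingle, mul_assoc, ← Finset.mul_sum]
    have hf : f = q + C fm + s := by rw [hq]; ring
    rw [hw, hf, C_sub]
    linear_combination -C c * heq

end Stengle

/-- If the feasible set `K` is nonempty and finite, then the preordering-based
hierarchy has finite convergence: `f_k^{pre} = f_min` for all big `k`. -/
theorem preordering_hierarchy_finite_convergence
    {n m₁ m₂ : ℕ} (f : MvPolynomial (Fin n) ℝ)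
    (h : Fin m₁ → MvPolynomial (Fin n) ℝ) (g : Fin m₂ → MvPolynomial (Fin n) ℝ)
    (hKne : (feasSet h g).Nonempty) (hKfin : (feasSet h g).Finite) :
    ∀ fm : ℝ, IsLeast ((fun x => eval x f) '' feasSet h g) fm →
      ∃ N : ℕ, ∀ k ≥ N, lasserrePreBound f h g k = (fm : EReal) := by
  rintro fm ⟨⟨x, hx, rfl⟩, hle⟩
  obtain ⟨N, hN⟩ := exists_forall_mem_truncIdeal_add_truncPreord f h g hKfin (eval x f)
    fun y hy => hle ⟨y, hy, rfl⟩
  refine ⟨N, fun k hk => le_antisymm (sSup_le ?_) (le_of_forall_lt fun c hc => ?_)⟩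
  · rintro _ ⟨r, rfl, hr⟩
    have := eval_nonneg_of_mem_truncIdeal_add_truncPreord hr hx
    rw [map_sub, eval_C, sub_nonneg] at this
    exact EReal.coe_le_coe_iff.2 this
  · obtain ⟨r, hcr, hr⟩ := EReal.lt_iff_exists_real_btwn.1 hc
    refine hcr.trans_le (le_sSup ⟨r, rfl, ?_⟩)
    have := hN k hk (eval x f - r) (sub_pos.2 (EReal.coe_lt_coe_iff.1 hr))
    rwa [sub_sub_cancel] at this
end

section
/- Let f ∈ ℝ[x₁,…,xₙ] and let h = (h₁,…,h_{m₁}) and h′ = (h′₁,…,h′_r) be two tuples of polynomials defining the same real variety, V_ℝ(h) = V_ℝ(h′). Consider the problem of minimizing f over V_ℝ(h) with no inequality constraints. Then the Lasserre sequence f_k = sup{γ : f − γ ∈ ⟨h⟩_{2k} + Σ_{2k}} has finite convergence to f_min if and only if the sequence f′_k = sup{γ : f − γ ∈ ⟨h′⟩_{2k} + Σ_{2k}} has finite convergence to f_min. -/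
section LasserreHierarchy

open MvPolynomial Pointwise

/-- The set of SOS polynomials of degree at most `2k`. -/
def sigma2k {n : ℕ} (k : ℕ) : Set (MvPolynomial (Fin n) ℝ) :=
  {p | IsSOS p ∧ p.totalDegree ≤ 2 * k}

/-- The `k`-th Lasserre bound for minimizing `f` over `V_ℝ(h)`
(no inequality constraints). -/
noncomputable def lasserreEqBound {n m : ℕ} (f : MvPolynomial (Fin n) ℝ)
    (h : Fin m → MvPolynomial (Fin n) ℝ) (k : ℕ) : EReal :=
  sSup {γ : EReal | ∃ r : ℝ, γ = (r : EReal) ∧ f - C r ∈ truncIdeal h k + sigma2k k}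

end LasserreHierarchy

section PolynomialIVT

open Polynomial

/-- The intermediate value property for polynomials over an ordered field. -/
def HasPolyIVT (R : Type*) [Field R] [LinearOrder R] : Prop :=
  ∀ (p : R[X]) (a b : R), a < b → p.eval a * p.eval b < 0 →
    ∃ c, a < c ∧ c < b ∧ p.eval c = 0

variable {R : Type*} [Field R] [LinearOrder R] [IsStrictOrderedRing R]

theorem HasPolyIVT.sign_eq_of_lt (hR : HasPolyIVT R) {p : R[X]} {a b : R} (hab : a < b)
    (h : ∀ x, a ≤ x → x ≤ b → p.eval x ≠ 0) :
    SignType.sign (p.eval a) = SignType.sign (p.eval b) := by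
  by_contra hne
  have ha := h a le_rfl hab.le
  have hb := h b hab.le le_rfl
  have : p.eval a * p.eval b < 0 := by
    rcases lt_or_gt_of_ne ha with ha | ha <;> rcases lt_or_gt_of_ne hb with hb | hb
    · exact absurd (by rw [sign_neg ha, sign_neg hb]) hne
    · exact mul_neg_of_neg_of_pos ha hb
    · exact mul_neg_of_pos_of_neg ha hb
    · exact absurd (by rw [sign_pos ha, sign_pos hb]) hne
  obtain ⟨c, h1, h2, h3⟩ := hR p a b hab this
  exact h c h1.le h2.le h3

/-- The theorem of Rolle for two consecutive roots. -/
theorem HasPolyIVT.rolle_consecutive (hR : HasPolyIVT R) {p : R[X]} (hp : p ≠ 0) {a b : R}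
    (hab : a < b) (ha : p.eval a = 0) (hb : p.eval b = 0)
    (hno : ∀ x, a < x → x < b → p.eval x ≠ 0) :
    ∃ c, a < c ∧ c < b ∧ p.derivative.eval c = 0 := by
  obtain ⟨g, hg, hga⟩ := exists_eq_pow_rootMultiplicity_mul_and_not_dvd p hp a
  set m := p.rootMultiplicity a
  have hm : m ≠ 0 := by
    intro h0
    rw [h0, pow_zero, one_mul] at hg
    exact hga (hg ▸ dvd_iff_isRoot.2 ha)
  have hg0 : g ≠ 0 := by rintro rfl; exact hga (dvd_zero _)
  obtain ⟨k, hk, hkb⟩ := exists_eq_pow_rootMultiplicity_mul_and_not_dvd g hg0 b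
  set n := g.rootMultiplicity b
  have hn : n ≠ 0 := by
    intro h0
    rw [h0, pow_zero, one_mul] at hk
    rw [hg, hk] at hb
    have hb' : (b - a) ^ m * k.eval b = 0 := by simpa using hb
    rcases mul_eq_zero.1 hb' with h | h
    · exact (pow_ne_zero m (sub_ne_zero.2 hab.ne')) h
    · exact hkb (dvd_iff_isRoot.2 h)
  have hka : k.eval a ≠ 0 := fun h => hga (hk ▸ (dvd_iff_isRoot.2 h).mul_left _)
  have hkb' : k.eval b ≠ 0 := fun h => hkb (dvd_iff_isRoot.2 h)
  have hsign : 0 < k.eval a * k.eval b := by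
    refine lt_of_le_of_ne (le_of_not_gt fun hlt => ?_) (mul_ne_zero hka hkb').symm
    obtain ⟨c, h1, h2, h3⟩ := hR k a b hab hlt
    exact hno c h1 h2 (by rw [hg, hk]; simp [h3])
  obtain ⟨m', hm'⟩ := Nat.exists_eq_succ_of_ne_zero hm
  obtain ⟨n', hn'⟩ := Nat.exists_eq_succ_of_ne_zero hn
  set w : R[X] := (C (m : R) * (X - C b) + C (n : R) * (X - C a)) * k
    + (X - C a) * (X - C b) * derivative k with hw
  have hder : derivative p = (X - C a) ^ m' * (X - C b) ^ n' * w := by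
    rw [hg, hk, hw, hm', hn']
    simp only [derivative_mul, derivative_X_sub_C_pow, Nat.succ_eq_add_one, Nat.add_sub_cancel]
    push_cast
    simp only [map_add, map_natCast, map_one]
    ring
  have hwneg : w.eval a * w.eval b < 0 := by
    have e1 : w.eval a = m * (a - b) * k.eval a := by simp [hw]
    have e2 : w.eval b = n * (b - a) * k.eval b := by simp [hw]
    have hmpos : (0 : R) < m := by exact_mod_cast Nat.pos_of_ne_zero hm
    have hnpos : (0 : R) < n := by exact_mod_cast Nat.pos_of_ne_zero hn
    have : w.eval a * w.eval b = -((m * n * (b - a) ^ 2) * (k.eval a * k.eval b)) := by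
      rw [e1, e2]; ring
    rw [this, neg_lt_zero]
    have := sub_pos.2 hab
    positivity
  obtain ⟨c, h1, h2, h3⟩ := hR w a b hab hwneg
  exact ⟨c, h1, h2, by rw [hder]; simp [h3]⟩

/-- The theorem of Rolle. -/
theorem HasPolyIVT.rolle (hR : HasPolyIVT R) {p : R[X]} {a b : R}
    (hab : a < b) (ha : p.eval a = 0) (hb : p.eval b = 0) :
    ∃ c, a < c ∧ c < b ∧ p.derivative.eval c = 0 := by
  by_cases hp : p = 0
  · obtain ⟨c, h1, h2⟩ := exists_between hab
    exact ⟨c, h1, h2, by simp [hp]⟩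
  have hne : (p.roots.toFinset.filter (a < ·)).Nonempty :=
    ⟨b, by simp [hp, hab, hb]⟩
  have hmem := Finset.min'_mem _ hne
  set b' := (p.roots.toFinset.filter (a < ·)).min' hne with hb'
  have hle : b' ≤ b := Finset.min'_le _ _ (by simp [hp, hab, hb])
  simp only [Finset.mem_filter, Multiset.mem_toFinset, mem_roots hp, IsRoot.def] at hmem
  obtain ⟨c, h1, h2, h3⟩ := hR.rolle_consecutive hp hmem.2 ha hmem.1 fun x hx1 hx2 hx =>
    absurd (Finset.min'_le (p.roots.toFinset.filter (a < ·)) x (by simp [hp, hx, hx1]))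
      (not_le.2 hx2)
  exact ⟨c, h1, h2.trans_le hle, h3⟩

/-- The mean value theorem. -/
theorem HasPolyIVT.mean_value (hR : HasPolyIVT R) (p : R[X]) {a b : R} (hab : a < b) :
    ∃ c, a < c ∧ c < b ∧ p.eval b - p.eval a = p.derivative.eval c * (b - a) := by
  have hne : b - a ≠ 0 := sub_ne_zero.2 hab.ne'
  obtain ⟨c, h1, h2, h3⟩ := hR.rolle
    (p := p - C (p.eval a) - C ((p.eval b - p.eval a) / (b - a)) * (X - C a)) hab
    (by simp) (by simp [hne])
  refine ⟨c, h1, h2, ?_⟩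
  simp only [derivative_sub, derivative_mul, derivative_C, derivative_X, eval_sub, eval_mul,
    eval_add, eval_zero, eval_C, eval_one] at h3
  field_simp at h3
  linear_combination -h3

theorem Polynomial.exists_forall_ge_of_leadingCoeff_pos (p : R[X]) (hp : 0 < p.natDegree)
    (hlc : 0 < p.leadingCoeff) (B : R) : ∃ M, ∀ x, M ≤ x → B ≤ p.eval x := by
  induction hn : p.natDegree generalizing p B with
  | zero => omega
  | succ n ih =>
    have hdeg : p.divX.natDegree = n := by rw [natDegree_divX_eq_natDegree_tsub_one, hn]; rfl
    have hlc' : 0 < p.divX.leadingCoeff := by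
      rw [leadingCoeff, hdeg, coeff_divX, ← hn]; exact hlc
    obtain ⟨K, hK, M, hM⟩ : ∃ K > 0, ∃ M, ∀ x, M ≤ x → K ≤ p.divX.eval x := by
      rcases Nat.eq_zero_or_pos n with h0 | h0
      · refine ⟨p.divX.leadingCoeff, hlc', 0, fun x _ => ?_⟩
        rw [eq_C_of_natDegree_eq_zero (hdeg.trans h0)]
        simp
      · obtain ⟨M, hM⟩ := ih p.divX (hdeg ▸ h0) hlc' 1 hdeg
        exact ⟨1, one_pos, M, hM⟩
    refine ⟨max M (max 0 ((B - p.coeff 0) / K)), fun x hx => ?_⟩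
    have h1 := hM x (le_trans (le_max_left _ _) hx)
    have h2 : 0 ≤ x := le_trans (le_trans (le_max_left _ _) (le_max_right _ _)) hx
    have h3 : (B - p.coeff 0) / K ≤ x :=
      le_trans (le_trans (le_max_right _ _) (le_max_right _ _)) hx
    rw [div_le_iff₀ hK] at h3
    have h4 : x * K ≤ x * p.divX.eval x := mul_le_mul_of_nonneg_left h1 h2
    have h5 : p.eval x = p.divX.eval x * x + p.coeff 0 := by
      conv_lhs => rw [← divX_mul_X_add p]
      simp
    rw [h5]
    linarith

theorem Polynomial.exists_forall_ge_sign_eval (p : R[X]) :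
    ∃ M, ∀ x, M ≤ x → SignType.sign (p.eval x) = SignType.sign p.leadingCoeff := by
  rcases Nat.eq_zero_or_pos p.natDegree with h0 | h0
  · refine ⟨0, fun x _ => ?_⟩
    rw [eq_C_of_natDegree_eq_zero h0]
    simp
  have hp : p.leadingCoeff ≠ 0 := by
    rw [Ne, leadingCoeff_eq_zero]; rintro rfl; simp at h0
  rcases lt_or_gt_of_ne hp with hneg | hpos
  · obtain ⟨M, hM⟩ := exists_forall_ge_of_leadingCoeff_pos (-p) (by simpa) (by simpa) 1
    refine ⟨M, fun x hx => ?_⟩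
    have := hM x hx
    rw [eval_neg] at this
    rw [sign_neg hneg, sign_neg (by linarith)]
  · obtain ⟨M, hM⟩ := exists_forall_ge_of_leadingCoeff_pos p h0 hpos 1
    refine ⟨M, fun x hx => ?_⟩
    rw [sign_pos hpos, sign_pos (by linarith [hM x hx])]

theorem Polynomial.exists_forall_le_sign_eval (p : R[X]) :
    ∃ M, ∀ x, x ≤ M →
      SignType.sign (p.eval x) = (-1) ^ p.natDegree * SignType.sign p.leadingCoeff := by
  obtain ⟨M, hM⟩ := exists_forall_ge_sign_eval (p.comp (-X))
  refine ⟨-M, fun x hx => ?_⟩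
  have := hM (-x) (by linarith)
  rw [comp_neg_X_leadingCoeff_eq, sign_mul, sign_pow, Left.sign_neg, sign_one] at this
  simpa using this

end PolynomialIVT

section CutMatch

open Order

variable {R S : Type*} [LinearOrder R] [LinearOrder S]

/-- `x` and `y` lie in corresponding cells of the two sides of a finite partial isomorphism. -/
def CutMatch (f : PartialIso R S) (x : R) (y : S) : Prop :=
  ∀ c ∈ f.val, cmp c.1 x = cmp c.2 y

theorem mem_partialIso_comm {f : PartialIso R S} {x : R} {y : S} :
    (y, x) ∈ f.comm.val ↔ (x, y) ∈ f.val := by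
  change (y, x) ∈ f.val.image _ ↔ _
  simp [Prod.ext_iff]

theorem CutMatch.comm {f : PartialIso R S} {x : R} {y : S} (h : CutMatch f x y) :
    CutMatch f.comm y x := by
  rintro ⟨c, d⟩ hc
  exact (h _ (mem_partialIso_comm.1 hc)).symm

theorem CutMatch.of_comm {f : PartialIso R S} {x : R} {y : S} (h : CutMatch f.comm y x) :
    CutMatch f x y := by
  rintro ⟨c, d⟩ hc
  exact (h _ (mem_partialIso_comm.2 hc)).symm

theorem CutMatch.eq_of_mem {f : PartialIso R S} {x : R} {y z : S} (h : CutMatch f x y)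
    (hz : (x, z) ∈ f.val) : z = y :=
  (eq_iff_eq_of_cmp_eq_cmp (h _ hz)).1 rfl

theorem cutMatch_of_mem {f : PartialIso R S} {c : R × S} (hc : c ∈ f.val) :
    CutMatch f c.1 c.2 :=
  fun d hd => f.prop d hd c hc

theorem CutMatch.mono {f g : PartialIso R S} (hfg : f.val ⊆ g.val) {x : R} {y : S}
    (h : CutMatch g x y) : CutMatch f x y :=
  fun c hc => h c (hfg hc)

theorem cutMatch_of_between {f : PartialIso R S} {c d : R × S} {x : R} {y : S}
    (hc : c ∈ f.val) (hd : d ∈ f.val)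
    (hcx : c.1 < x) (hxd : x < d.1) (hcy : c.2 < y) (hyd : y < d.2)
    (hno : ∀ e ∈ f.val, e.1 ≤ c.1 ∨ d.1 ≤ e.1) : CutMatch f x y := by
  intro e he
  rcases hno e he with h | h
  · have he2 : e.2 ≤ c.2 := (le_iff_le_of_cmp_eq_cmp (f.prop e he c hc)).1 h
    rw [(cmp_eq_lt_iff _ _).2 (h.trans_lt hcx), (cmp_eq_lt_iff _ _).2 (he2.trans_lt hcy)]
  · have he2 : d.2 ≤ e.2 := (le_iff_le_of_cmp_eq_cmp (f.prop d hd e he)).1 h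
    rw [(cmp_eq_gt_iff _ _).2 (hxd.trans_le h), (cmp_eq_gt_iff _ _).2 (hyd.trans_le he2)]

/-- The domain element of `f` immediately below `x`. -/
theorem exists_greatest_below {f : PartialIso R S} {x : R} (h : ∃ a ∈ f.val, a.1 < x) :
    ∃ c ∈ f.val, c.1 < x ∧ ∀ e ∈ f.val, e.1 < x → e.1 ≤ c.1 := by
  obtain ⟨a, ha, hax⟩ := h
  obtain ⟨c, hc, hmax⟩ := (f.val.filter (·.1 < x)).exists_max_image Prod.fst
    ⟨a, Finset.mem_filter.2 ⟨ha, hax⟩⟩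
  rw [Finset.mem_filter] at hc
  exact ⟨c, hc.1, hc.2, fun e he hex => hmax e (Finset.mem_filter.2 ⟨he, hex⟩)⟩

/-- The domain element of `f` immediately above `x`. -/
theorem exists_least_above {f : PartialIso R S} {x : R} (h : ∃ b ∈ f.val, x < b.1) :
    ∃ c ∈ f.val, x < c.1 ∧ ∀ e ∈ f.val, x < e.1 → c.1 ≤ e.1 := by
  obtain ⟨b, hb, hbx⟩ := h
  obtain ⟨c, hc, hmin⟩ := (f.val.filter (x < ·.1)).exists_min_image Prod.fst
    ⟨b, Finset.mem_filter.2 ⟨hb, hbx⟩⟩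
  rw [Finset.mem_filter] at hc
  exact ⟨c, hc.1, hc.2, fun e he hex => hmin e (Finset.mem_filter.2 ⟨he, hex⟩)⟩

theorem exists_partialIso_insert (f : PartialIso R S) {x : R} {y : S} (h : CutMatch f x y) :
    ∃ g : PartialIso R S, g.val = insert (x, y) f.val := by
  refine ⟨⟨insert (x, y) f.val, fun p hp q hq => ?_⟩, rfl⟩
  rw [Finset.mem_insert] at hp hq
  rcases hp with rfl | hp <;> rcases hq with rfl | hq
  · simp only [cmp_self_eq_eq]
  · exact cmp_eq_cmp_symm.1 (h _ hq)
  · exact h _ hp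
  · exact f.prop _ hp _ hq

theorem exists_cutMatch [DenselyOrdered S] [NoMinOrder S] [NoMaxOrder S] [Nonempty S]
    (f : PartialIso R S) (x : R) : ∃ y, CutMatch f x y :=
  f.exists_across x

end CutMatch

section SignMatching

open Polynomial Order

variable {R S : Type*} [Field R] [LinearOrder R] [Field S] [LinearOrder S]

/-- The pairs of polynomials in `W` have equal signs on corresponding cells of `f`. -/
def SignMatch (W : Set (R[X] × S[X])) (f : PartialIso R S) : Prop :=
  ∀ x y, CutMatch f x y → ∀ w ∈ W,
    SignType.sign (w.1.eval x) = SignType.sign (w.2.eval y)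

theorem SignMatch.comm {f : PartialIso R S} {W : Set (R[X] × S[X])} (h : SignMatch W f) :
    SignMatch (Prod.swap ⁻¹' W) f.comm :=
  fun x y hxy w hw => (h y x hxy.of_comm w.swap hw).symm

theorem SignMatch.mono {f g : PartialIso R S} {W V : Set (R[X] × S[X])} (h : SignMatch W f)
    (hfg : f.val ⊆ g.val) (hVW : V ⊆ W) : SignMatch V g :=
  fun x y hxy w hw => h x y (hxy.mono hfg) w (hVW hw)

variable [IsStrictOrderedRing R] [IsStrictOrderedRing S]

/-- Roots of the nonzero polynomials in a matched family lie in the domain of `f`. -/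
theorem SignMatch.exists_mem_of_root {f : PartialIso R S} {W : Set (R[X] × S[X])}
    (h : SignMatch W f) {w : R[X] × S[X]} (hw : w ∈ W) (hw0 : w.1 ≠ 0) {x : R}
    (hx : w.1.eval x = 0) : ∃ y, (x, y) ∈ f.val := by
  by_contra! hno
  obtain ⟨y, hy⟩ := exists_cutMatch f x
  obtain ⟨z, hz1, hz2⟩ := exists_between_finsets {x}
    (((f.val.image Prod.fst) ∪ w.1.roots.toFinset).filter (x < ·)) (by simp)
  have hxz : x < z := hz1 x (by simp)
  have hzy : CutMatch f z y := by
    intro c hc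
    rw [← hy c hc]
    have hcx : c.1 ≠ x := fun he => hno c.2 (by rw [← he]; exact hc)
    rcases lt_or_gt_of_ne hcx with hlt | hlt
    · rw [(cmp_eq_lt_iff _ _).2 hlt, (cmp_eq_lt_iff _ _).2 (hlt.trans hxz)]
    · have : z < c.1 := hz2 _ (by
        simp only [Finset.mem_filter, Finset.mem_union, Finset.mem_image]
        exact ⟨Or.inl ⟨c, hc, rfl⟩, hlt⟩)
      rw [(cmp_eq_gt_iff _ _).2 hlt, (cmp_eq_gt_iff _ _).2 this]
  have h0 := (h z y hzy w hw).trans (h x y hy w hw).symm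
  rw [hx, sign_zero, sign_eq_zero_iff] at h0
  exact lt_irrefl z (hz2 z (by
    simp only [Finset.mem_filter, Finset.mem_union, Multiset.mem_toFinset, mem_roots hw0]
    exact ⟨Or.inr h0, hxz⟩))

theorem SignMatch.eq_zero {f : PartialIso R S} {W : Set (R[X] × S[X])}
    (h : SignMatch W f) {w : R[X] × S[X]} (hw : w ∈ W) (hw0 : w.2 = 0) : w.1 = 0 := by
  refine Polynomial.funext fun x => ?_
  obtain ⟨y, hy⟩ := exists_cutMatch f x
  have := h x y hy w hw
  rw [hw0, eval_zero, sign_zero, sign_eq_zero_iff] at this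
  rw [this, eval_zero]

/-- Discard from `f` the pairs which are not roots of the family. -/
theorem SignMatch.exists_forall_root (hS : HasPolyIVT S) {f : PartialIso R S}
    {W : Set (R[X] × S[X])} (h : SignMatch W f) :
    ∃ g : PartialIso R S, g.val ⊆ f.val ∧ SignMatch W g ∧
      ∀ c ∈ g.val, ∃ w ∈ W, w.1 ≠ 0 ∧ w.1.eval c.1 = 0 := by
  classical
  refine ⟨⟨f.val.filter fun c => ∃ w ∈ W, w.1 ≠ 0 ∧ w.1.eval c.1 = 0, fun p hp q hq =>
    f.prop p (Finset.mem_filter.1 hp).1 q (Finset.mem_filter.1 hq).1⟩, Finset.filter_subset _ _, ?_,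
    fun c hc => (Finset.mem_filter.1 hc).2⟩
  intro x y hxy w hw
  obtain ⟨z, hz⟩ := exists_cutMatch f x
  rw [h x z hz w hw]
  by_cases hw0 : w.2 = 0
  · simp [hw0]
  have hw1 : w.1 ≠ 0 := fun h1 => hw0 (h.comm.eq_zero (w := w.swap) hw h1)
  have key : ∀ t, w.2.eval t = 0 → cmp t z = cmp t y := by
    intro t ht
    obtain ⟨s, hs⟩ := h.comm.exists_mem_of_root (w := w.swap) hw hw0 ht
    have hst := mem_partialIso_comm.1 hs
    have hs0 : w.1.eval s = 0 := by
      have := h _ _ (cutMatch_of_mem hst) w hw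
      rwa [ht, sign_zero, sign_eq_zero_iff] at this
    exact (hz _ hst).symm.trans (hxy _ (Finset.mem_filter.2 ⟨hst, w, hw, hw1, hs0⟩))
  rcases lt_trichotomy z y with hzy | rfl | hzy
  · refine hS.sign_eq_of_lt hzy fun t h1 h2 ht => ?_
    have h3 := (le_iff_le_of_cmp_eq_cmp (cmp_eq_cmp_symm.1 (key t ht))).1 h1
    have h4 := (le_iff_le_of_cmp_eq_cmp (key t ht)).2 h2
    exact absurd hzy (not_lt.2 (h3.trans h4))
  · rfl
  · refine (hS.sign_eq_of_lt hzy fun t h1 h2 ht => ?_).symm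
    have h3 := (le_iff_le_of_cmp_eq_cmp (cmp_eq_cmp_symm.1 (key t ht))).2 h1
    have h4 := (le_iff_le_of_cmp_eq_cmp (key t ht)).1 h2
    exact absurd hzy (not_lt.2 (h3.trans h4))

/-- A root of `p` in `R` is matched by a root of `q` in `S`, if `p` and `q` have the same signs
at the matched points and their derivatives belong to the matched family. -/
theorem SignMatch.exists_root_cutMatch (hR : HasPolyIVT R) (hS : HasPolyIVT S)
    {f : PartialIso R S} {W : Set (R[X] × S[X])} (h : SignMatch W f) {p : R[X]} {q : S[X]}
    (hd : (derivative p, derivative q) ∈ W) (hd0 : derivative p ≠ 0)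
    (hpq : ∀ c ∈ f.val, SignType.sign (p.eval c.1) = SignType.sign (q.eval c.2))
    (hE : ∀ x, p.eval x = 0 → (∃ a ∈ f.val, a.1 < x) ∧ ∃ b ∈ f.val, x < b.1)
    {x : R} (hx : p.eval x = 0) : ∃ y, q.eval y = 0 ∧ CutMatch f x y := by
  by_cases hmem : ∃ y, (x, y) ∈ f.val
  · obtain ⟨y, hy⟩ := hmem
    refine ⟨y, ?_, cutMatch_of_mem hy⟩
    have := hpq _ hy
    rwa [hx, sign_zero, eq_comm, sign_eq_zero_iff] at this
  obtain ⟨c, hc, hcx, hcmax⟩ := exists_greatest_below (hE x hx).1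
  obtain ⟨d, hdm, hxd, hdmin⟩ := exists_least_above (hE x hx).2
  have hno : ∀ e ∈ f.val, e.1 ≤ c.1 ∨ d.1 ≤ e.1 := by
    intro e he
    rcases lt_trichotomy e.1 x with h1 | h1 | h1
    · exact Or.inl (hcmax e he h1)
    · exact absurd ⟨e.2, by rw [← h1]; exact he⟩ hmem
    · exact Or.inr (hdmin e he h1)
  have hder : ∀ t, c.1 < t → t < d.1 → (derivative p).eval t ≠ 0 := by
    intro t h1 h2 h0
    obtain ⟨y, hy⟩ := h.exists_mem_of_root hd hd0 h0
    rcases hno _ hy with h3 | h3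
    · exact absurd h1 (not_lt.2 h3)
    · exact absurd h2 (not_lt.2 h3)
  obtain ⟨s, hs1, hs2, hs⟩ := hR.mean_value p hcx
  obtain ⟨t, ht1, ht2, ht⟩ := hR.mean_value p hxd
  have hsign := hR.sign_eq_of_lt (hs2.trans ht1) fun z h1 h2 =>
    hder z (hs1.trans_le h1) (h2.trans_lt ht2)
  have hneg : p.eval c.1 * p.eval d.1 < 0 := by
    rw [hx, zero_sub] at hs
    rw [hx, sub_zero] at ht
    have e1 := sub_pos.2 hcx
    have e2 := sub_pos.2 hxd
    have hcs : SignType.sign (p.eval c.1) = -SignType.sign ((derivative p).eval s) := by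
      rw [← neg_eq_iff_eq_neg, ← Left.sign_neg, hs, sign_mul, sign_pos e1, mul_one]
    have hdt : SignType.sign (p.eval d.1) = SignType.sign ((derivative p).eval t) := by
      rw [ht, sign_mul, sign_pos e2, mul_one]
    rw [← sign_eq_neg_one_iff, sign_mul, hcs, hdt, ← hsign]
    rcases lt_or_gt_of_ne (hder s hs1 (hs2.trans hxd)) with h1 | h1
    · rw [sign_neg h1]; rfl
    · rw [sign_pos h1]; rfl
  have hneg' : q.eval c.2 * q.eval d.2 < 0 := by
    rw [← sign_eq_neg_one_iff, sign_mul] at hneg ⊢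
    rwa [← hpq c hc, ← hpq d hdm]
  have hcd : c.2 < d.2 := (lt_iff_lt_of_cmp_eq_cmp (f.prop c hc d hdm)).1 (hcx.trans hxd)
  obtain ⟨y, hy1, hy2, hy⟩ := hS q c.2 d.2 hcd hneg'
  exact ⟨y, hy, cutMatch_of_between hc hdm hcx hxd hy1 hy2 hno⟩

/-- Two distinct roots of `p` are separated by the domain of `f`. -/
theorem SignMatch.exists_between_roots (hR : HasPolyIVT R)
    {f : PartialIso R S} {W : Set (R[X] × S[X])} (h : SignMatch W f) {p : R[X]} {q : S[X]}
    (hd : (derivative p, derivative q) ∈ W) (hd0 : derivative p ≠ 0) {x y : R} (hxy : x < y)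
    (hx : p.eval x = 0) (hy : p.eval y = 0) : ∃ c ∈ f.val, x < c.1 ∧ c.1 < y := by
  obtain ⟨z, h1, h2, h3⟩ := hR.rolle hxy hx hy
  obtain ⟨t, ht⟩ := h.exists_mem_of_root hd hd0 h3
  exact ⟨_, ht, h1, h2⟩

theorem exists_partialIso_bounding_roots (f : PartialIso R S) {p : R[X]} {q : S[X]}
    (hp : p ≠ 0) (hq : q ≠ 0) (hdeg : p.natDegree = q.natDegree)
    (hlc : SignType.sign p.leadingCoeff = SignType.sign q.leadingCoeff)
    (hpq : ∀ c ∈ f.val, SignType.sign (p.eval c.1) = SignType.sign (q.eval c.2)) :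
    ∃ g : PartialIso R S, f.val ⊆ g.val ∧ g.val.Nonempty ∧
      (∀ c ∈ g.val, SignType.sign (p.eval c.1) = SignType.sign (q.eval c.2)) ∧
      (∀ x, p.eval x = 0 → (∃ a ∈ g.val, a.1 < x) ∧ ∃ b ∈ g.val, x < b.1) ∧
      (∀ y, q.eval y = 0 → (∃ a ∈ g.val, a.2 < y) ∧ ∃ b ∈ g.val, y < b.2) := by
  obtain ⟨Np, hNp⟩ := p.exists_forall_ge_sign_eval
  obtain ⟨Nq, hNq⟩ := q.exists_forall_ge_sign_eval
  obtain ⟨Lp, hLp⟩ := p.exists_forall_le_sign_eval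
  obtain ⟨Lq, hLq⟩ := q.exists_forall_le_sign_eval
  obtain ⟨M, hM, -⟩ := exists_between_finsets (insert Np (f.val.image Prod.fst)) ∅ (by simp)
  obtain ⟨M', hM', -⟩ := exists_between_finsets (insert Nq (f.val.image Prod.snd)) ∅ (by simp)
  obtain ⟨m, -, hm⟩ := exists_between_finsets ∅
    (insert Lp (insert M (f.val.image Prod.fst))) (by simp)
  obtain ⟨m', -, hm'⟩ := exists_between_finsets ∅
    (insert Lq (insert M' (f.val.image Prod.snd))) (by simp)
  simp only [Finset.mem_insert, forall_eq_or_imp, Finset.forall_mem_image] at hM hM' hm hm'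
  obtain ⟨g, hg⟩ := exists_partialIso_insert f (x := M) (y := M') fun c hc => by
    rw [(cmp_eq_lt_iff _ _).2 (hM.2 hc), (cmp_eq_lt_iff _ _).2 (hM'.2 hc)]
  obtain ⟨k, hk⟩ := exists_partialIso_insert g (x := m) (y := m') fun c hc => by
    rw [hg, Finset.mem_insert] at hc
    rcases hc with rfl | hc
    · rw [(cmp_eq_gt_iff _ _).2 hm.2.1, (cmp_eq_gt_iff _ _).2 hm'.2.1]
    · rw [(cmp_eq_gt_iff _ _).2 (hm.2.2 hc), (cmp_eq_gt_iff _ _).2 (hm'.2.2 hc)]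
  have hmk : (m, m') ∈ k.val := by simp [hk]
  have hMk : (M, M') ∈ k.val := by simp [hk, hg]
  have hp0 : SignType.sign p.leadingCoeff ≠ 0 := by simpa using hp
  have hq0 : SignType.sign q.leadingCoeff ≠ 0 := by simpa using hq
  refine ⟨k, by rw [hk, hg]; intro c hc; simp [hc], ⟨_, hmk⟩, ?_, ?_, ?_⟩
  · intro c hc
    rw [hk, hg, Finset.mem_insert, Finset.mem_insert] at hc
    rcases hc with rfl | rfl | hc
    · rw [hLp _ hm.1.le, hLq _ hm'.1.le, hdeg, hlc]
    · rw [hNp _ hM.1.le, hNq _ hM'.1.le, hlc]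
    · exact hpq c hc
  · intro x hx
    refine ⟨⟨_, hmk, not_le.1 fun hle => ?_⟩, ⟨_, hMk, not_le.1 fun hle => ?_⟩⟩
    · have := hLp x (hle.trans hm.1.le)
      rw [hx, sign_zero, eq_comm, mul_eq_zero] at this
      exact this.elim (pow_ne_zero _ (by decide)) hp0
    · have := hNp x (hM.1.le.trans hle)
      rw [hx, sign_zero] at this
      exact hp0 this.symm
  · intro x hx
    refine ⟨⟨_, hmk, not_le.1 fun hle => ?_⟩, ⟨_, hMk, not_le.1 fun hle => ?_⟩⟩
    · have := hLq x (hle.trans hm'.1.le)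
      rw [hx, sign_zero, eq_comm, mul_eq_zero] at this
      exact this.elim (pow_ne_zero _ (by decide)) hq0
    · have := hNq x (hM'.1.le.trans hle)
      rw [hx, sign_zero] at this
      exact hq0 this.symm

/-- If all roots of `p` lie in the domain of `f`, they are separated by points where `p` does
not vanish, and signs agree at the points of `f`, then they agree everywhere. -/
theorem sign_eval_eq_of_cutMatch (hR : HasPolyIVT R) (hS : HasPolyIVT S) {f : PartialIso R S}
    {p : R[X]} {q : S[X]} (hne : f.val.Nonempty)
    (hpq : ∀ c ∈ f.val, SignType.sign (p.eval c.1) = SignType.sign (q.eval c.2))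
    (hE : ∀ x, p.eval x = 0 → (∃ a ∈ f.val, a.1 < x) ∧ ∃ b ∈ f.val, x < b.1)
    (hp : ∀ x, p.eval x = 0 → ∃ y, (x, y) ∈ f.val)
    (hq : ∀ y, q.eval y = 0 → ∃ x, (x, y) ∈ f.val)
    (hsep : ∀ x y, x < y → p.eval x = 0 → p.eval y = 0 → ∃ c ∈ f.val, x < c.1 ∧ c.1 < y)
    {x : R} {y : S} (hxy : CutMatch f x y) :
    SignType.sign (p.eval x) = SignType.sign (q.eval y) := by
  by_cases hmem : ∃ z, (x, z) ∈ f.val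
  · obtain ⟨z, hz⟩ := hmem
    rw [← hxy.eq_of_mem hz]
    exact hpq _ hz
  have hlow : ∀ c ∈ f.val, c.1 < x → (∀ e ∈ f.val, e.1 < x → e.1 ≤ c.1) → p.eval c.1 ≠ 0 →
      SignType.sign (p.eval x) = SignType.sign (q.eval y) := by
    intro c hc hcx hmax h0
    have h0' : q.eval c.2 ≠ 0 := by
      rwa [Ne, ← sign_eq_zero_iff, ← hpq c hc, sign_eq_zero_iff]
    have hbetween : ∀ e ∈ f.val, c.1 < e.1 → x < e.1 := by
      intro e he hce
      rcases lt_trichotomy e.1 x with h | h | h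
      · exact absurd hce (not_lt.2 (hmax e he h))
      · exact absurd ⟨e.2, by rw [← h]; exact he⟩ hmem
      · exact h
    have h1 := hR.sign_eq_of_lt (p := p) hcx fun t ht1 ht2 ht => by
      obtain ⟨z, hz⟩ := hp t ht
      rcases ht1.eq_or_lt with h | h
      · exact h0 (h ▸ ht)
      · exact absurd ht2 (not_le.2 (hbetween _ hz h))
    have h2 := hS.sign_eq_of_lt (p := q) ((lt_iff_lt_of_cmp_eq_cmp (hxy c hc)).1 hcx)
      fun t ht1 ht2 ht => by
        obtain ⟨z, hz⟩ := hq t ht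
        rcases ht1.eq_or_lt with h | h
        · exact h0' (h ▸ ht)
        · have := hbetween _ hz ((lt_iff_lt_of_cmp_eq_cmp (f.prop _ hc _ hz)).2 h)
          exact absurd ht2 (not_le.2 ((lt_iff_lt_of_cmp_eq_cmp
            (cmp_eq_cmp_symm.1 (hxy _ hz))).1 this))
    rw [← h1, ← h2, hpq c hc]
  have hup : ∀ c ∈ f.val, x < c.1 → (∀ e ∈ f.val, x < e.1 → c.1 ≤ e.1) → p.eval c.1 ≠ 0 →
      SignType.sign (p.eval x) = SignType.sign (q.eval y) := by
    intro c hc hcx hmin h0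
    have h0' : q.eval c.2 ≠ 0 := by
      rwa [Ne, ← sign_eq_zero_iff, ← hpq c hc, sign_eq_zero_iff]
    have hbetween : ∀ e ∈ f.val, e.1 < c.1 → e.1 < x := by
      intro e he hce
      rcases lt_trichotomy e.1 x with h | h | h
      · exact h
      · exact absurd ⟨e.2, by rw [← h]; exact he⟩ hmem
      · exact absurd hce (not_lt.2 (hmin e he h))
    have h1 := hR.sign_eq_of_lt (p := p) hcx fun t ht1 ht2 ht => by
      obtain ⟨z, hz⟩ := hp t ht
      rcases ht2.eq_or_lt with h | h
      · exact h0 (h ▸ ht)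
      · exact absurd ht1 (not_le.2 (hbetween _ hz h))
    have h2 := hS.sign_eq_of_lt (p := q)
      ((lt_iff_lt_of_cmp_eq_cmp (cmp_eq_cmp_symm.1 (hxy c hc))).1 hcx)
      fun t ht1 ht2 ht => by
        obtain ⟨z, hz⟩ := hq t ht
        rcases ht2.eq_or_lt with h | h
        · exact h0' (h ▸ ht)
        · have := hbetween _ hz ((lt_iff_lt_of_cmp_eq_cmp (f.prop _ hz _ hc)).2 h)
          exact absurd ht1 (not_le.2 ((lt_iff_lt_of_cmp_eq_cmp (hxy _ hz)).1 this))
    rw [h1, h2, hpq c hc]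
  by_cases hL : ∃ a ∈ f.val, a.1 < x
  · obtain ⟨c, hc, hcx, hcmax⟩ := exists_greatest_below hL
    by_cases hc0 : p.eval c.1 = 0
    · obtain ⟨b, hb, hcb⟩ := (hE _ hc0).2
      have hxb : x < b.1 := by
        rcases lt_trichotomy b.1 x with h | h | h
        · exact absurd hcb (not_lt.2 (hcmax b hb h))
        · exact absurd ⟨b.2, by rw [← h]; exact hb⟩ hmem
        · exact h
      obtain ⟨d, hd, hxd, hdmin⟩ := exists_least_above ⟨b, hb, hxb⟩
      by_cases hd0 : p.eval d.1 = 0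
      · obtain ⟨e, he, h1, h2⟩ := hsep _ _ (hcx.trans hxd) hc0 hd0
        rcases lt_trichotomy e.1 x with h | h | h
        · exact absurd h1 (not_lt.2 (hcmax e he h))
        · exact absurd ⟨e.2, by rw [← h]; exact he⟩ hmem
        · exact absurd h2 (not_lt.2 (hdmin e he h))
      · exact hup d hd hxd hdmin hd0
    · exact hlow c hc hcx hcmax hc0
  · obtain ⟨a, ha⟩ := hne
    push Not at hL
    have hxa : x < a.1 := lt_of_le_of_ne (hL a ha) fun h =>
      hmem ⟨a.2, by rw [h]; exact ha⟩
    obtain ⟨d, hd, hxd, hdmin⟩ := exists_least_above ⟨a, ha, hxa⟩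
    refine hup d hd hxd hdmin fun hd0 => ?_
    obtain ⟨e, he, hed⟩ := (hE _ hd0).1
    have hxe : x < e.1 := lt_of_le_of_ne (hL e he) fun h =>
      hmem ⟨e.2, by rw [h]; exact he⟩
    exact absurd hed (not_lt.2 (hdmin e he hxe))

/-- The inductive step of the Cohen–Hörmander sign determination: a polynomial may be added to a
matched family containing its derivative, if its signs match at the matched points. -/
theorem SignMatch.exists_insert (hR : HasPolyIVT R) (hS : HasPolyIVT S)
    {f : PartialIso R S} {W : Set (R[X] × S[X])} (h : SignMatch W f) {p : R[X]} {q : S[X]}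
    (hd : (derivative p, derivative q) ∈ W) (hdeg0 : 0 < p.natDegree)
    (hdeg : p.natDegree = q.natDegree)
    (hlc : SignType.sign p.leadingCoeff = SignType.sign q.leadingCoeff)
    (hpq : ∀ c ∈ f.val, SignType.sign (p.eval c.1) = SignType.sign (q.eval c.2)) :
    ∃ g, SignMatch (insert (p, q) W) g := by
  classical
  have hp : p ≠ 0 := by rintro rfl; simp at hdeg0
  have hq : q ≠ 0 := by rintro rfl; simp [hdeg] at hdeg0
  have hdp : derivative p ≠ 0 := fun h0 =>
    hdeg0.ne' (derivative_eq_zero.1 h0)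
  have hdq : derivative q ≠ 0 := fun h0 =>
    (hdeg ▸ hdeg0).ne' (derivative_eq_zero.1 h0)
  obtain ⟨g, hfg, hne, hpqg, hEp, hEq⟩ :=
    exists_partialIso_bounding_roots f hp hq hdeg hlc hpq
  have hg : SignMatch W g := h.mono hfg subset_rfl
  have hroot : ∀ x, ∃ y, p.eval x = 0 → q.eval y = 0 ∧ CutMatch g x y := by
    intro x
    by_cases hx : p.eval x = 0
    · obtain ⟨y, hy⟩ := hg.exists_root_cutMatch hR hS hd hdp hpqg hEp hx
      exact ⟨y, fun _ => hy⟩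
    · exact ⟨0, fun h0 => absurd h0 hx⟩
  choose φ hφ using hroot
  have hmono : ∀ x x', p.eval x = 0 → p.eval x' = 0 → x < x' → φ x < φ x' := by
    intro x x' hx hx' hlt
    obtain ⟨c, hc, h1, h2⟩ := hg.exists_between_roots hR hd hdp hlt hx hx'
    exact ((lt_iff_lt_of_cmp_eq_cmp (cmp_eq_cmp_symm.1 ((hφ x hx).2 c hc))).1 h1).trans
      ((lt_iff_lt_of_cmp_eq_cmp ((hφ x' hx').2 c hc)).1 h2)
  have hT : ∀ c ∈ p.roots.toFinset.image fun x => (x, φ x), p.eval c.1 = 0 ∧ c.2 = φ c.1 := by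
    intro c hc
    simp only [Finset.mem_image, Multiset.mem_toFinset, mem_roots hp] at hc
    obtain ⟨x, hx, rfl⟩ := hc
    exact ⟨hx, rfl⟩
  let k : PartialIso R S := ⟨g.val ∪ p.roots.toFinset.image fun x => (x, φ x), by
    intro c hc d hd
    rw [Finset.mem_union] at hc hd
    rcases hc with hc | hc <;> rcases hd with hd | hd
    · exact g.prop c hc d hd
    · rw [(hT d hd).2]
      exact (hφ _ (hT d hd).1).2 c hc
    · rw [(hT c hc).2]
      exact cmp_eq_cmp_symm.1 ((hφ _ (hT c hc).1).2 d hd)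
    · obtain ⟨hc1, hc2⟩ := hT c hc
      obtain ⟨hd1, hd2⟩ := hT d hd
      rw [hc2, hd2]
      rcases lt_trichotomy c.1 d.1 with hlt | heq | hlt
      · rw [(cmp_eq_lt_iff _ _).2 hlt, (cmp_eq_lt_iff _ _).2 (hmono _ _ hc1 hd1 hlt)]
      · rw [heq, cmp_self_eq_eq, cmp_self_eq_eq]
      · rw [(cmp_eq_gt_iff _ _).2 hlt, (cmp_eq_gt_iff _ _).2 (hmono _ _ hd1 hc1 hlt)]⟩
  have hgk : g.val ⊆ k.val := Finset.subset_union_left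
  have hrk : ∀ x, p.eval x = 0 → (x, φ x) ∈ k.val := fun x hx =>
    Finset.mem_union_right _ (Finset.mem_image.2 ⟨x, by simp [hp, hx], rfl⟩)
  refine ⟨k, fun x y hxy w hw => ?_⟩
  rcases hw with rfl | hw
  swap
  · exact hg x y (hxy.mono hgk) w hw
  refine sign_eval_eq_of_cutMatch (p := p) (q := q) hR hS (hne.mono hgk) ?_ ?_
    (fun x hx => ⟨_, hrk x hx⟩) ?_ ?_ hxy
  · intro c hc
    rcases Finset.mem_union.1 hc with hc | hc
    · exact hpqg c hc
    · obtain ⟨h1, h2⟩ := hT c hc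
      rw [h1, h2, (hφ _ h1).1, sign_zero, sign_zero]
  · intro x hx
    obtain ⟨⟨a, ha, hax⟩, b, hb, hxb⟩ := hEp x hx
    exact ⟨⟨a, hgk ha, hax⟩, b, hgk hb, hxb⟩
  · intro y hy
    obtain ⟨x, hx, hxy⟩ := hg.comm.exists_root_cutMatch (p := q) (q := p) hS hR hd hdq
      (by rintro ⟨c, d⟩ hc; exact (hpqg _ (mem_partialIso_comm.1 hc)).symm)
      (by
        intro z hz
        obtain ⟨⟨a, ha, haz⟩, b, hb, hzb⟩ := hEq z hz
        exact ⟨⟨a.swap, mem_partialIso_comm.2 ha, haz⟩, b.swap, mem_partialIso_comm.2 hb, hzb⟩) hy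
    have hxy' := hxy.of_comm
    refine ⟨x, ?_⟩
    suffices φ x = y by rw [← this]; exact hrk x hx
    obtain ⟨h1, h2⟩ := hφ x hx
    have aux : ∀ u v, q.eval u = 0 → q.eval v = 0 → CutMatch g x u → CutMatch g x v →
        ¬ u < v := by
      intro u v hu hv hxu hxv hlt
      obtain ⟨c, hc, hc1, hc2⟩ := hg.comm.exists_between_roots (p := q) (q := p) hS hd hdq
        hlt hu hv
      have hc' : c.swap ∈ g.val := mem_partialIso_comm.1 hc
      have e1 := (lt_iff_lt_of_cmp_eq_cmp (cmp_eq_cmp_symm.1 (hxu _ hc'))).2 hc1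
      have e2 := (lt_iff_lt_of_cmp_eq_cmp (hxv _ hc')).2 hc2
      exact lt_asymm e1 e2
    exact le_antisymm (not_lt.1 (aux _ _ hy h1 hxy' h2)) (not_lt.1 (aux _ _ h1 hy h2 hxy'))
  · intro x x' hlt hx hx'
    obtain ⟨c, hc, h1, h2⟩ := hg.exists_between_roots hR hd hdp hlt hx hx'
    exact ⟨c, hgk hc, h1, h2⟩

end SignMatching

section SignTransfer

open Polynomial Order

/-- Pseudo-division of polynomials over a commutative ring. -/
theorem Polynomial.exists_pseudoRemainder {A : Type*} [CommRing A] (p u : A[X])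
    (hu : 0 < u.natDegree) :
    ∃ (k : ℕ) (s r : A[X]), C u.leadingCoeff ^ k * p = s * u + r ∧
      r.natDegree < u.natDegree := by
  induction hn : p.natDegree using Nat.strong_induction_on generalizing p with
  | _ n ih =>
    rcases lt_or_ge n u.natDegree with hlt | hge
    · exact ⟨0, 0, p, by simp, hn ▸ hlt⟩
    · obtain ⟨d, rfl⟩ := Nat.exists_eq_add_of_le hge
      set p₁ := C u.leadingCoeff * p - C p.leadingCoeff * (X ^ d * u) with hp₁
      have hle : p₁.natDegree ≤ u.natDegree + d := by
        refine (natDegree_sub_le _ _).trans (max_le ?_ ?_)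
        · exact (natDegree_C_mul_le _ _).trans hn.le
        · refine (natDegree_C_mul_le _ _).trans (natDegree_mul_le.trans ?_)
          have := natDegree_X_pow_le (R := A) d
          omega
      have hcoeff : p₁.coeff (u.natDegree + d) = 0 := by
        rw [hp₁, coeff_sub, coeff_C_mul, coeff_C_mul, coeff_X_pow_mul, coeff_natDegree, ← hn,
          coeff_natDegree]
        ring
      have hlt : p₁.natDegree < u.natDegree + d := by
        refine lt_of_le_of_ne hle fun heq => ?_
        rw [← heq, coeff_natDegree, leadingCoeff_eq_zero] at hcoeff
        rw [hcoeff, natDegree_zero] at heq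
        omega
      obtain ⟨k, s, r, h1, h2⟩ := ih _ hlt p₁ rfl
      refine ⟨k + 1, s + C u.leadingCoeff ^ k * C p.leadingCoeff * X ^ d, r, ?_, h2⟩
      rw [hp₁] at h1
      linear_combination h1

/-- The pairs of specializations of the polynomials in `P` along two ring homomorphisms. -/
def specializations {A R S : Type*} [CommRing A] [CommRing R] [CommRing S] (φ : A →+* R)
    (ψ : A →+* S) (P : Multiset A[X]) : Set (R[X] × S[X]) :=
  {w | ∃ p ∈ P, w = (p.map φ, p.map ψ)}

theorem Polynomial.map_eraseLead_of_leadingCoeff {A R : Type*} [CommRing A] [CommRing R]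
    (φ : A →+* R) {u : A[X]} (h : φ u.leadingCoeff = 0) : u.eraseLead.map φ = u.map φ := by
  conv_rhs => rw [← u.eraseLead_add_C_mul_X_pow, Polynomial.map_add, Polynomial.map_mul, map_C, h,
    C_0, zero_mul, add_zero]

variable {A R S : Type*} [CommRing A] [Field R] [LinearOrder R] [IsStrictOrderedRing R]
  [Field S] [LinearOrder S] [IsStrictOrderedRing S]

theorem sign_eq_of_pseudoRemainder {φ : A →+* R} {ψ : A →+* S} {p u s r : A[X]} {k : ℕ}
    (hr : C u.leadingCoeff ^ k * p = s * u + r)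
    (hφ : φ u.leadingCoeff ≠ 0)
    (hlc : SignType.sign (φ u.leadingCoeff) = SignType.sign (ψ u.leadingCoeff))
    {x : R} {y : S} (hx : (u.map φ).eval x = 0) (hy : (u.map ψ).eval y = 0)
    (hxy : SignType.sign ((r.map φ).eval x) = SignType.sign ((r.map ψ).eval y)) :
    SignType.sign ((p.map φ).eval x) = SignType.sign ((p.map ψ).eval y) := by
  have h1 : φ u.leadingCoeff ^ k * (p.map φ).eval x = (r.map φ).eval x := by
    have := congrArg (fun t => (t.map φ).eval x) hr
    simpa [hx] using this
  have h2 : ψ u.leadingCoeff ^ k * (p.map ψ).eval y = (r.map ψ).eval y := by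
    have := congrArg (fun t => (t.map ψ).eval y) hr
    simpa [hy] using this
  rw [← h1, ← h2, sign_mul, sign_mul, sign_pow, sign_pow, ← hlc] at hxy
  exact mul_left_cancel₀ (pow_ne_zero _ (by simpa using hφ)) hxy

/-- The Cohen–Hörmander step with all leading coefficients nonvanishing. -/
theorem exists_signMatch_cons (hR : HasPolyIVT R) (hS : HasPolyIVT S) {p : A[X]}
    {P Y : Multiset A[X]} (hp : 0 < p.natDegree)
    (hrem : ∀ u ∈ P + {derivative p}, 0 < u.natDegree →
      ∃ (k : ℕ) (s r : A[X]), C u.leadingCoeff ^ k * p = s * u + r ∧ r ∈ Y)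
    {φ : A →+* R} {ψ : A →+* S}
    (hlc : ∀ u ∈ p ::ₘ P, 0 < u.natDegree → φ u.leadingCoeff ≠ 0)
    (hsign : ∀ u ∈ p ::ₘ (P + {derivative p}),
      SignType.sign (φ u.leadingCoeff) = SignType.sign (ψ u.leadingCoeff))
    {f : PartialIso R S} (hf : SignMatch (specializations φ ψ (P + {derivative p} + Y)) f) :
    ∃ g, SignMatch (specializations φ ψ (p ::ₘ P)) g := by
  have hφp : φ p.leadingCoeff ≠ 0 := hlc p (by simp) hp
  have hsp := hsign p (by simp)
  have hψp : ψ p.leadingCoeff ≠ 0 := by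
    rwa [Ne, ← sign_eq_zero_iff, ← hsp, sign_eq_zero_iff]
  have hdlc : φ (derivative p).leadingCoeff ≠ 0 := by
    have hc : (derivative p).coeff (p.natDegree - 1) = p.leadingCoeff * p.natDegree := by
      rw [coeff_derivative, Nat.sub_add_cancel hp, coeff_natDegree]
      congr 1
      exact_mod_cast congrArg (Nat.cast (R := A)) (Nat.sub_add_cancel hp)
    have hne : φ ((derivative p).coeff (p.natDegree - 1)) ≠ 0 := by
      rw [hc, map_mul, map_natCast]
      exact mul_ne_zero hφp (Nat.cast_ne_zero.2 hp.ne')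
    have hdeg : (derivative p).natDegree = p.natDegree - 1 :=
      natDegree_eq_of_le_of_coeff_ne_zero (natDegree_derivative_le p)
        fun h0 => hne (by rw [h0, map_zero])
    rwa [leadingCoeff, hdeg]
  have hW : SignMatch (specializations φ ψ (P + {derivative p})) f := by
    refine hf.mono subset_rfl ?_
    rintro _ ⟨u, hu, rfl⟩
    exact ⟨u, Multiset.mem_add.2 (Or.inl hu), rfl⟩
  obtain ⟨g, hgf, hg, hroot⟩ := hW.exists_forall_root hS
  have hpq : ∀ c ∈ g.val,
      SignType.sign ((p.map φ).eval c.1) = SignType.sign ((p.map ψ).eval c.2) := by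
    intro c hc
    obtain ⟨w, hw, hw0, hwc⟩ := hroot c hc
    have hwc' := hg _ _ (cutMatch_of_mem hc) w hw
    obtain ⟨u, hu, rfl⟩ := hw
    rw [hwc, sign_zero, eq_comm, sign_eq_zero_iff] at hwc'
    have hu0 : 0 < u.natDegree := by
      refine Nat.pos_of_ne_zero fun h0 => hw0 ?_
      rw [eq_C_of_natDegree_eq_zero h0] at hwc ⊢
      simp only [map_C, eval_C] at hwc ⊢
      rw [hwc, C_0]
    obtain ⟨k, s, r, hr, hrY⟩ := hrem u hu hu0
    refine sign_eq_of_pseudoRemainder hr ?_ (hsign u (Multiset.mem_cons_of_mem hu)) hwc hwc'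
      (hf _ _ (cutMatch_of_mem (hgf hc)) (r.map φ, r.map ψ)
        ⟨r, Multiset.mem_add.2 (Or.inr hrY), rfl⟩)
    rcases Multiset.mem_add.1 hu with hu | hu
    · exact hlc u (Multiset.mem_cons_of_mem hu) hu0
    · rw [Multiset.mem_singleton.1 hu]; exact hdlc
  have hdφ := natDegree_map_of_leadingCoeff_ne_zero φ hφp
  have hdψ := natDegree_map_of_leadingCoeff_ne_zero ψ hψp
  obtain ⟨k, hk⟩ := hg.exists_insert hR hS (p := p.map φ) (q := p.map ψ)
    ⟨derivative p, by simp, by rw [derivative_map, derivative_map]⟩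
    (by rwa [hdφ]) (by rw [hdφ, hdψ])
    (by rwa [leadingCoeff_map_of_leadingCoeff_ne_zero φ hφp,
      leadingCoeff_map_of_leadingCoeff_ne_zero ψ hψp]) hpq
  refine ⟨k, hk.mono subset_rfl ?_⟩
  rintro _ ⟨u, hu, rfl⟩
  rcases Multiset.mem_cons.1 hu with rfl | hu
  · exact Or.inl rfl
  · exact Or.inr ⟨u, Multiset.mem_add.2 (Or.inl hu), rfl⟩

/-- The signs realized by finitely many polynomials in one variable are determined by the signs
of finitely many polynomials in their coefficients. -/
theorem exists_finset_signMatch (hR : HasPolyIVT R) (hS : HasPolyIVT S) (P : Multiset A[X]) :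
    ∃ Q : Finset A, ∀ (φ : A →+* R) (ψ : A →+* S),
      (∀ a ∈ Q, SignType.sign (φ a) = SignType.sign (ψ a)) →
        ∃ f, SignMatch (specializations φ ψ P) f := by
  classical
  induction P using (InvImage.wf (fun P : Multiset A[X] => P.map natDegree)
    Multiset.wellFounded_isDershowitzMannaLT).induction with
  | _ P ih =>
  by_cases hconst : ∀ p ∈ P, p.natDegree = 0
  · refine ⟨P.toFinset.image (coeff · 0), fun φ ψ hQ => ⟨default, ?_⟩⟩
    rintro x y - _ ⟨p, hp, rfl⟩
    have := hQ _ (Finset.mem_image_of_mem (coeff · 0) (Multiset.mem_toFinset.2 hp))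
    rw [eq_C_of_natDegree_eq_zero (hconst p hp)]
    simpa using this
  push Not at hconst
  obtain ⟨p₀, hp₀, hp₀'⟩ := hconst
  obtain ⟨p, hp, hmax⟩ := P.toFinset.exists_max_image natDegree ⟨p₀, by simpa using hp₀⟩
  rw [Multiset.mem_toFinset] at hp
  have hpdeg : 0 < p.natDegree :=
    (Nat.pos_of_ne_zero hp₀').trans_le (hmax p₀ (by simpa using hp₀))
  obtain ⟨P₁, rfl⟩ := Multiset.exists_cons_of_mem hp
  have hdp : (derivative p).natDegree < p.natDegree := natDegree_derivative_lt hpdeg.ne'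
  have hrem : ∀ u : A[X], ∃ r : A[X], r.natDegree < p.natDegree ∧
      (u ∈ P₁ + {derivative p} → 0 < u.natDegree →
        ∃ (k : ℕ) (s : A[X]), C u.leadingCoeff ^ k * p = s * u + r) := by
    intro u
    by_cases hu : u ∈ P₁ + {derivative p} ∧ 0 < u.natDegree
    · obtain ⟨k, s, r, h1, h2⟩ := exists_pseudoRemainder p u hu.2
      refine ⟨r, h2.trans_le ?_, fun _ _ => ⟨k, s, h1⟩⟩
      rcases Multiset.mem_add.1 hu.1 with h | h
      · exact hmax u (by simp [h])
      · rw [Multiset.mem_singleton.1 h]; exact hdp.le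
    · exact ⟨0, by simpa using hpdeg, fun h1 h2 => absurd ⟨h1, h2⟩ hu⟩
  choose rem hremdeg hrem using hrem
  have hred : ∀ u : A[X], ∃ Q : Finset A, u ∈ p ::ₘ P₁ → 0 < u.natDegree →
      ∀ (φ : A →+* R) (ψ : A →+* S),
      (∀ a ∈ Q, SignType.sign (φ a) = SignType.sign (ψ a)) →
        ∃ f, SignMatch (specializations φ ψ ((p ::ₘ P₁).erase u + {u.eraseLead})) f := by
    intro u
    by_cases hu : u ∈ p ::ₘ P₁ ∧ 0 < u.natDegree
    · obtain ⟨Q, hQ⟩ := ih ((p ::ₘ P₁).erase u + {u.eraseLead})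
        ⟨((p ::ₘ P₁).erase u).map natDegree, {u.eraseLead.natDegree}, {u.natDegree}, by simp,
          by simp, by
            conv_lhs => rw [← Multiset.cons_erase hu.1]
            beta_reduce
            rw [Multiset.map_cons, ← Multiset.singleton_add, add_comm], by
            have := u.eraseLead_natDegree_le
            simp only [Multiset.mem_singleton, exists_eq_left, forall_eq]
            omega⟩
      exact ⟨Q, fun _ _ => hQ⟩
    · exact ⟨∅, fun h1 h2 => absurd ⟨h1, h2⟩ hu⟩
  choose Qred hQred using hred
  obtain ⟨Qmain, hQmain⟩ := ih (P₁ + {derivative p} + (P₁ + {derivative p}).map rem)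
    ⟨P₁.map natDegree, ({derivative p} + (P₁ + {derivative p}).map rem).map natDegree,
      {p.natDegree}, by simp, by simp [add_assoc], by
        beta_reduce
        rw [Multiset.map_cons, ← Multiset.singleton_add, add_comm], by
        simp only [Multiset.mem_singleton, exists_eq_left, Multiset.mem_map,
          forall_exists_index, and_imp, forall_apply_eq_imp_iff₂, Multiset.mem_add]
        rintro v (rfl | ⟨u, -, rfl⟩)
        · exact hdp
        · exact hremdeg u⟩
  refine ⟨Qmain ∪ (p ::ₘ P₁).toFinset.biUnion Qred ∪
    (p ::ₘ (P₁ + {derivative p})).toFinset.image leadingCoeff, fun φ ψ hQ => ?_⟩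
  have hsign : ∀ u ∈ p ::ₘ (P₁ + {derivative p}),
      SignType.sign (φ u.leadingCoeff) = SignType.sign (ψ u.leadingCoeff) := fun u hu =>
    hQ _ (Finset.mem_union_right _ (Finset.mem_image_of_mem _ (Multiset.mem_toFinset.2 hu)))
  by_cases hvan : ∃ u ∈ p ::ₘ P₁, 0 < u.natDegree ∧ φ u.leadingCoeff = 0
  · obtain ⟨u, hu, hu0, hφu⟩ := hvan
    have hψu : ψ u.leadingCoeff = 0 := by
      rw [← sign_eq_zero_iff, ← hsign u (by
        rcases Multiset.mem_cons.1 hu with rfl | h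
        · simp
        · simp [h]), sign_eq_zero_iff]
      exact hφu
    obtain ⟨f, hf⟩ := hQred u hu hu0 φ ψ fun a ha =>
      hQ a (Finset.mem_union_left _ (Finset.mem_union_right _
        (Finset.mem_biUnion.2 ⟨u, Multiset.mem_toFinset.2 hu, ha⟩)))
    refine ⟨f, hf.mono subset_rfl ?_⟩
    rintro _ ⟨v, hv, rfl⟩
    by_cases hvu : v = u
    · subst hvu
      exact ⟨v.eraseLead, by simp, by
        rw [map_eraseLead_of_leadingCoeff φ hφu, map_eraseLead_of_leadingCoeff ψ hψu]⟩
    · exact ⟨v, Multiset.mem_add.2 (Or.inl ((Multiset.mem_erase_of_ne hvu).2 hv)), rfl⟩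
  · push Not at hvan
    obtain ⟨f, hf⟩ := hQmain φ ψ fun a ha =>
      hQ a (Finset.mem_union_left _ (Finset.mem_union_left _ ha))
    refine exists_signMatch_cons hR hS hpdeg (fun u hu hu0 => ?_) hvan hsign hf
    obtain ⟨k, s, hks⟩ := hrem u hu hu0
    exact ⟨k, s, rem u, hks, Multiset.mem_map_of_mem _ hu⟩

theorem MvPolynomial.aeval_cons_eq_eval_finSuccEquiv {k T : Type*} [CommRing k] [CommRing T]
    [Algebra k T] {n : ℕ} (p : MvPolynomial (Fin (n + 1)) k) (t : T) (z : Fin n → T) :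
    MvPolynomial.aeval (Fin.cons t z : Fin (n + 1) → T) p =
      ((MvPolynomial.finSuccEquiv k n p).map
        (MvPolynomial.aeval z : MvPolynomial (Fin n) k →ₐ[k] T).toRingHom).eval t := by
  induction p using MvPolynomial.induction_on with
  | C a => simp [MvPolynomial.finSuccEquiv_apply]
  | add p q hp hq => rw [map_add, map_add, Polynomial.map_add, Polynomial.eval_add, hp, hq]
  | mul_X p i hp =>
    rw [map_mul, map_mul, Polynomial.map_mul, Polynomial.eval_mul, hp]
    congr 1
    refine Fin.cases ?_ (fun j => ?_) i
    · simp [MvPolynomial.finSuccEquiv_X_zero]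
    · simp [MvPolynomial.finSuccEquiv_X_succ]

/-- **Tarski's transfer principle** for sign conditions with coefficients in a common subring. -/
theorem exists_sign_eval_eq {k : Type*} [CommRing k] [Algebra k R] [Algebra k S]
    (hR : HasPolyIVT R) (hS : HasPolyIVT S)
    (hk : ∀ a : k, SignType.sign (algebraMap k R a) = SignType.sign (algebraMap k S a))
    {n : ℕ} (P : Finset (MvPolynomial (Fin n) k)) (x : Fin n → R) :
    ∃ y : Fin n → S, ∀ p ∈ P,
      SignType.sign (MvPolynomial.aeval x p) = SignType.sign (MvPolynomial.aeval y p) := by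
  induction n with
  | zero =>
    refine ⟨Fin.elim0, fun p _ => ?_⟩
    obtain ⟨a, rfl⟩ := MvPolynomial.C_surjective (Fin 0) p
    simpa using hk a
  | succ n ih =>
    obtain ⟨Q, hQ⟩ := exists_finset_signMatch hR hS
      (P.val.map (MvPolynomial.finSuccEquiv k n))
    obtain ⟨y, hy⟩ := ih Q (Fin.tail x)
    obtain ⟨f, hf⟩ := hQ (MvPolynomial.aeval (Fin.tail x)).toRingHom
      (MvPolynomial.aeval y).toRingHom hy
    obtain ⟨b, hb⟩ := exists_cutMatch f (x 0)
    refine ⟨Fin.cons b y, fun p hp => ?_⟩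
    rw [← Fin.cons_self_tail x, MvPolynomial.aeval_cons_eq_eval_finSuccEquiv,
      MvPolynomial.aeval_cons_eq_eval_finSuccEquiv]
    exact hf _ _ hb _ ⟨_, Multiset.mem_map_of_mem _ hp, rfl⟩

end SignTransfer

section RealClosure

open Polynomial

universe u

theorem IsSumSq.map_ringHom {A B : Type*} [CommRing A] [CommRing B] (φ : A →+* B) {a : A}
    (ha : IsSumSq a) : IsSumSq (φ a) := by
  induction ha with
  | zero => rw [map_zero]; exact .zero
  | sq_add a _ ih => rw [map_add, map_mul]; exact .sq_add _ ih

theorem IsSemireal.of_ringHom {A B : Type*} [CommRing A] [CommRing B] [IsSemireal B]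
    (φ : A →+* B) : IsSemireal A :=
  .of_not_isSumSq_neg_one fun h =>
    IsSemireal.not_isSumSq_neg_one B (by simpa using h.map_ringHom φ)

/-- A field none of whose proper algebraic extensions is semireal. -/
def HasNoSemirealExtension (E : Type*) [Field E] : Prop :=
  ∀ f : E[X], Irreducible f → 1 < f.natDegree → IsSumSq (-1 : AdjoinRoot f)

theorem Subfield.exists_isSumSq_of_isChain {Ω : Type*} [Field Ω] {c : Set (Subfield Ω)}
    (hc : IsChain (· ≤ ·) c) (hne : c.Nonempty) {a : ↥(sSup c)} (ha : IsSumSq a) :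
    ∃ F ∈ c, ∃ s : F, IsSumSq s ∧ (s : Ω) = a := by
  induction ha with
  | zero =>
    obtain ⟨F, hF⟩ := hne
    exact ⟨F, hF, 0, .zero, rfl⟩
  | @sq_add b s _ ih =>
    obtain ⟨F, hF, t, ht, hts⟩ := ih
    obtain ⟨G, hG, hbG⟩ := (Subfield.mem_sSup_of_directedOn hne hc.directedOn).1 b.2
    obtain ⟨H, hH, hFH, hGH⟩ := hc.directedOn F hF G hG
    refine ⟨H, hH, ⟨b, hGH hbG⟩ * ⟨b, hGH hbG⟩ + Subfield.inclusion hFH t,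
      .sq_add _ (ht.map_ringHom _), ?_⟩
    simp [← hts, Subfield.inclusion]

/-- Every semireal field embeds in a semireal field without semireal algebraic extensions. -/
theorem exists_hasNoSemirealExtension (K : Type u) [Field K] [IsSemireal K] :
    ∃ (E : Type u) (_ : Field E) (_ : K →+* E), IsSemireal E ∧ HasNoSemirealExtension E := by
  let Ω := AlgebraicClosure K
  let ι : K →+* Ω := algebraMap K Ω
  have hK : IsSemireal ι.fieldRange :=
    .of_ringHom (RingEquiv.ofBijective ι.rangeRestrictField
      ι.rangeRestrictField_bijective).symm.toRingHom
  obtain ⟨E, hKE, hE⟩ := zorn_le_nonempty₀ {F : Subfield Ω | IsSemireal F}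
    (fun c hc hchain F hF => ⟨sSup c, .of_not_isSumSq_neg_one fun h => by
      obtain ⟨F, hF, s, hs, hs1⟩ := Subfield.exists_isSumSq_of_isChain hchain ⟨F, hF⟩ h
      have hs' : s = -1 := Subtype.ext (by simpa using hs1)
      have : IsSemireal F := hc hF
      exact IsSemireal.not_isSumSq_neg_one F (hs' ▸ hs), fun _ => le_sSup⟩)
    ι.fieldRange hK
  refine ⟨E, inferInstance, (Subfield.inclusion hKE).comp ι.rangeRestrictField, hE.prop,
    fun f hf hdeg => ?_⟩
  by_contra hsum
  have : Fact (Irreducible f) := ⟨hf⟩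
  have : IsSemireal (AdjoinRoot f) := .of_not_isSumSq_neg_one hsum
  obtain ⟨α, hα⟩ := IsAlgClosed.exists_eval₂_eq_zero (algebraMap E Ω) f
    (fun h => by rw [natDegree_eq_of_degree_eq_some (n := 0) h] at hdeg; omega)
  let θ : AdjoinRoot f →+* Ω := AdjoinRoot.lift (algebraMap E Ω) α hα
  have hθ : IsSemireal θ.fieldRange :=
    .of_ringHom (RingEquiv.ofBijective θ.rangeRestrictField
      θ.rangeRestrictField_bijective).symm.toRingHom
  have hEθ : E ≤ θ.fieldRange := fun e he =>
    ⟨AdjoinRoot.of f ⟨e, he⟩, AdjoinRoot.lift_of hα⟩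
  have hαE : α ∈ E := hE.le_of_ge hθ hEθ ⟨AdjoinRoot.root f, AdjoinRoot.lift_root hα⟩
  have hroot : f.IsRoot ⟨α, hαE⟩ := by
    have h1 := eval₂_at_apply (p := f) (algebraMap E Ω) ⟨α, hαE⟩
    exact (algebraMap E Ω).injective (by rw [← h1, map_zero]; exact hα)
  have := natDegree_eq_of_degree_eq_some (n := 1) (degree_eq_one_of_irreducible_of_root hf hroot)
  omega

variable {E : Type*} [Field E]

/-- A sum of squares modulo `f` is represented by a sum of squares of small degree. -/
theorem exists_isSumSq_mk_eq {f : E[X]} (hf : 0 < f.natDegree) {s : AdjoinRoot f}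
    (hs : IsSumSq s) :
    ∃ g : E[X], IsSumSq g ∧ g.natDegree ≤ 2 * (f.natDegree - 1) ∧
      IsSumSq (g.coeff (2 * (f.natDegree - 1))) ∧ AdjoinRoot.mk f g = s := by
  induction hs with
  | zero => exact ⟨0, .zero, by simp, by rw [coeff_zero]; exact .zero, map_zero _⟩
  | @sq_add a s _ ih =>
    obtain ⟨g, h1, h2, h3, h4⟩ := ih
    obtain ⟨u, rfl⟩ := AdjoinRoot.mk_surjective a
    have hu : (u % f).natDegree ≤ f.natDegree - 1 :=
      Nat.le_sub_one_of_lt (natDegree_mod_lt u hf.ne')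
    have hmk : AdjoinRoot.mk f (u % f) = AdjoinRoot.mk f u := by
      rw [AdjoinRoot.mk_eq_mk]
      exact (EuclideanDomain.mod_eq_sub_mul_div u f) ▸ ⟨-(u / f), by ring⟩
    refine ⟨u % f * (u % f) + g, .sq_add _ h1, natDegree_add_le_of_degree_le ?_ h2, ?_, ?_⟩
    · refine natDegree_mul_le.trans ?_
      omega
    · rw [coeff_add, two_mul, coeff_mul_add_eq_of_natDegree_le hu hu, ← two_mul]
      exact .sq_add _ h3
    · rw [map_add, map_mul, hmk, h4]

theorem HasNoSemirealExtension.exists_one_add_eq_mul (hE : HasNoSemirealExtension E) {f : E[X]}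
    (hf : Irreducible f) (hdeg : 1 < f.natDegree) :
    ∃ g h : E[X], IsSumSq g ∧ g.natDegree ≤ 2 * (f.natDegree - 1) ∧
      IsSumSq (g.coeff (2 * (f.natDegree - 1))) ∧ 1 + g = f * h := by
  obtain ⟨g, h1, h2, h3, h4⟩ := exists_isSumSq_mk_eq (by omega) (hE f hf hdeg)
  have : AdjoinRoot.mk f (1 + g) = 0 := by rw [map_add, map_one, h4]; ring
  obtain ⟨h, hh⟩ := AdjoinRoot.mk_eq_zero.1 this
  exact ⟨g, h, h1, h2, h3, hh⟩

theorem IsSumSq.inv {a : E} (ha : IsSumSq a) : IsSumSq a⁻¹ := by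
  rcases eq_or_ne a 0 with rfl | h
  · simp
  · rw [show a⁻¹ = a * (a⁻¹ * a⁻¹) by field_simp]
    exact ha.mul (.mul_self _)

theorem IsSumSq.eq_zero_of_neg [IsSemireal E] {a : E} (ha : IsSumSq a) (ha' : IsSumSq (-a)) :
    a = 0 := by
  by_contra h
  refine IsSemireal.not_isSumSq_neg_one E ?_
  rw [show (-1 : E) = a⁻¹ * -a by field_simp]
  exact ha.inv.mul ha'

theorem HasNoSemirealExtension.isSumSq_or_neg (hE : HasNoSemirealExtension E) [IsSemireal E]
    (a : E) : IsSumSq a ∨ IsSumSq (-a) := by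
  by_cases ha : IsSquare a
  · exact Or.inl ha.isSumSq
  right
  have hd : (X ^ 2 - C a).natDegree = 2 := natDegree_X_pow_sub_C
  have hirr : Irreducible (X ^ 2 - C a) := by
    refine irreducible_of_degree_le_three_of_not_isRoot (by simp [hd]) fun x hx => ha ⟨x, ?_⟩
    rw [IsRoot, eval_sub, eval_pow, eval_X, eval_C, sub_eq_zero, sq] at hx
    exact hx.symm
  obtain ⟨g, h, h1, h2, h3, h4⟩ := hE.exists_one_add_eq_mul hirr (by omega)
  rw [hd] at h2 h3
  have hh : h.natDegree = 0 := by
    by_contra hne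
    have h0 : h ≠ 0 := by rintro rfl; simp at hne
    have := natDegree_mul hirr.ne_zero h0
    rw [← h4, hd] at this
    have := (natDegree_add_le 1 g)
    simp at this
    omega
  rw [eq_C_of_natDegree_eq_zero hh] at h4
  have e1 := congrArg (eval 0) h4
  have e2 := congrArg (coeff · 2) h4
  simp [coeff_one] at e1 e2
  have hg0 : IsSumSq (eval 0 g) := h1.map_ringHom (evalRingHom 0)
  simp only [Nat.reduceSub, mul_one] at h3
  have hne : h.coeff 0 ≠ 0 := by
    intro h0
    rw [h0, mul_zero, neg_zero] at e1
    exact IsSemireal.one_add_ne_zero hg0 e1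
  rw [show -a = (1 + eval 0 g) * (h.coeff 0)⁻¹ by rw [e1]; field_simp]
  exact (IsSumSq.one.add hg0).mul (e2 ▸ h3).inv

theorem HasNoSemirealExtension.exists_linearOrder (hE : HasNoSemirealExtension E)
    [IsSemireal E] : ∃ _ : LinearOrder E, IsStrictOrderedRing E := by
  classical
  let P : RingCone E :=
    { Subsemiring.sumSq E with
      eq_zero_of_mem_of_neg_mem' := fun {a} h h' =>
        (Subsemiring.mem_sumSq.1 h).eq_zero_of_neg (Subsemiring.mem_sumSq.1 h') }
  have : HasMemOrNegMem P := ⟨fun a => (hE.isSumSq_or_neg a).imp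
    Subsemiring.mem_sumSq.2 Subsemiring.mem_sumSq.2⟩
  let : LinearOrder E := .mkOfAddGroupCone P
  have : IsOrderedRing E := .mkOfCone P
  exact ⟨inferInstance, IsOrderedRing.toIsStrictOrderedRing E⟩

theorem HasNoSemirealExtension.hasPolyIVT [LinearOrder E] [IsStrictOrderedRing E]
    (hE : HasNoSemirealExtension E) : HasPolyIVT E := by
  intro p a b hab hp
  induction hn : p.natDegree using Nat.strong_induction_on generalizing p with
  | _ n ih =>
  have hp0 : p ≠ 0 := by rintro rfl; simp at hp
  have hunit : ¬ IsUnit p := fun hu => by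
    obtain ⟨c, -, rfl⟩ := isUnit_iff.1 hu
    rw [eval_C, eval_C] at hp
    exact absurd hp (mul_self_nonneg c).not_gt
  by_cases hirr : Irreducible p
  · have hpos : 0 < p.natDegree := hirr.natDegree_pos
    rcases (Nat.succ_le_of_lt hpos).eq_or_lt with h1 | h1
    · obtain ⟨c, hc, d, rfl⟩ := natDegree_eq_one.1 h1.symm
      simp only [eval_add, eval_mul, eval_C, eval_X] at hp ⊢
      have hroot : c * (-d / c) + d = 0 := by field_simp; ring
      have hkey : (c * c) * ((a - -d / c) * (b - -d / c)) < 0 := by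
        convert hp using 1
        field_simp
        ring
      have hlt := (pos_iff_neg_of_mul_neg hkey).1 (mul_self_pos.2 hc)
      rcases mul_neg_iff.1 hlt with ⟨h2, h3⟩ | ⟨h2, h3⟩
      · linarith
      · exact ⟨-d / c, by linarith, by linarith, hroot⟩
    · obtain ⟨g, h, hg, hgd, -, hgh⟩ := hE.exists_one_add_eq_mul hirr h1
      have hpos : ∀ x, 0 < p.eval x * h.eval x := fun x => by
        have h2 := congrArg (eval x) hgh
        rw [eval_add, eval_one, eval_mul] at h2
        rw [← h2]
        have : 0 ≤ eval x g := (hg.map_ringHom (evalRingHom x)).nonneg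
        linarith
      have h0 : h ≠ 0 := by
        rintro rfl
        simpa using hpos a
      have hlt : h.natDegree < n := by
        have h2 := natDegree_mul hp0 h0
        rw [← hgh] at h2
        have h3 := natDegree_add_le 1 g
        rw [natDegree_one] at h3
        omega
      obtain ⟨c, -, -, hc⟩ := ih _ hlt h (by
        have := mul_pos (hpos a) (hpos b)
        by_contra hcon
        nlinarith) rfl
      have := hpos c
      rw [hc, mul_zero] at this
      exact absurd this (lt_irrefl 0)
  · obtain ⟨q, r, hq, hr, rfl⟩ : ∃ q r, ¬ IsUnit q ∧ ¬ IsUnit r ∧ p = q * r := by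
      rw [irreducible_iff] at hirr
      push Not at hirr
      obtain ⟨q, r, h1, h2, h3⟩ := hirr hunit
      exact ⟨q, r, h2, h3, h1⟩
    have hq0 := left_ne_zero_of_mul hp0
    have hr0 := right_ne_zero_of_mul hp0
    have hqd := natDegree_pos_iff_degree_pos.2 (degree_pos_of_ne_zero_of_nonunit hq0 hq)
    have hrd := natDegree_pos_iff_degree_pos.2 (degree_pos_of_ne_zero_of_nonunit hr0 hr)
    rw [natDegree_mul hq0 hr0] at hn
    have hprod : (q.eval a * q.eval b) * (r.eval a * r.eval b) < 0 := by
      rw [eval_mul, eval_mul] at hp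
      linarith
    rcases mul_neg_iff.1 hprod with ⟨-, h1⟩ | ⟨h1, -⟩
    · obtain ⟨c, hac, hcb, hc⟩ := ih _ (by omega) r h1 rfl
      exact ⟨c, hac, hcb, by rw [eval_mul, hc, mul_zero]⟩
    · obtain ⟨c, hac, hcb, hc⟩ := ih _ (by omega) q h1 rfl
      exact ⟨c, hac, hcb, by rw [eval_mul, hc, zero_mul]⟩

theorem exists_hasPolyIVT_of_isSemireal (K : Type u) [Field K] [IsSemireal K] :
    ∃ (E : Type u) (_ : Field E) (_ : LinearOrder E) (_ : K →+* E),
      IsStrictOrderedRing E ∧ HasPolyIVT E := by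
  obtain ⟨E, _, ι, _, hE⟩ := exists_hasNoSemirealExtension K
  obtain ⟨_, _⟩ := hE.exists_linearOrder
  exact ⟨E, _, _, ι, ‹_›, hE.hasPolyIVT⟩

end RealClosure

open MvPolynomial Pointwise

section RealNullstellensatz

theorem hasPolyIVT_real : HasPolyIVT ℝ := by
  intro p a b hab hp
  have hcont : ContinuousOn (fun x => p.eval x) (Set.Icc a b) := p.continuous.continuousOn
  rcases mul_neg_iff.1 hp with ⟨ha, hb⟩ | ⟨ha, hb⟩
  · obtain ⟨c, hc, hc0⟩ := intermediate_value_Ioo' hab.le hcont ⟨hb, ha⟩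
    exact ⟨c, hc.1, hc.2, hc0⟩
  · obtain ⟨c, hc, hc0⟩ := intermediate_value_Ioo hab.le hcont ⟨ha, hb⟩
    exact ⟨c, hc.1, hc.2, hc0⟩

theorem sign_map_real_s9 {E : Type*} [Field E] [LinearOrder E] [IsStrictOrderedRing E]
    (φ : ℝ →+* E) (a : ℝ) : SignType.sign (φ a) = SignType.sign a := by
  have hpos : ∀ b : ℝ, 0 < b → 0 < φ b := fun b hb => by
    rw [← Real.mul_self_sqrt hb.le, map_mul]
    exact mul_self_pos.2 ((map_ne_zero φ).2 (Real.sqrt_ne_zero'.2 hb))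
  rcases lt_trichotomy a 0 with ha | rfl | ha
  · have := hpos (-a) (neg_pos.2 ha)
    rw [map_neg, neg_pos] at this
    rw [sign_neg this, sign_neg ha]
  · simp
  · rw [sign_pos (hpos a ha), sign_pos ha]

variable {A : Type*} [CommRing A]

/-- The submonoid of elements `g ^ (2 * l) + q` with `q` a sum of squares. -/
def evenPowAddSumSq (g : A) : Submonoid A where
  carrier := {a | ∃ (l : ℕ) (q : A), IsSumSq q ∧ a = g ^ (2 * l) + q}
  one_mem' := ⟨0, 0, .zero, by simp⟩
  mul_mem' := by
    rintro _ _ ⟨l, p, hp, rfl⟩ ⟨m, q, hq, rfl⟩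
    have hsq : ∀ k : ℕ, IsSumSq (g ^ (2 * k)) := fun k => by
      rw [two_mul, pow_add]; exact .mul_self _
    exact ⟨l + m, g ^ (2 * l) * q + (g ^ (2 * m) * p + p * q),
      ((hsq l).mul hq).add (((hsq m).mul hp).add (hp.mul hq)), by ring⟩

theorem add_isSumSq_mem_evenPowAddSumSq {g a s : A} (ha : a ∈ evenPowAddSumSq g)
    (hs : IsSumSq s) : a + s ∈ evenPowAddSumSq g := by
  obtain ⟨l, q, hq, rfl⟩ := ha
  exact ⟨l, q + s, hq.add hs, by ring⟩

theorem exists_isPrime_isReal_notMem [IsNoetherianRing A] {I : Ideal A} {g : A}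
    (hg : Disjoint (I : Set A) (evenPowAddSumSq g)) :
    ∃ J : Ideal A, J.IsPrime ∧ I ≤ J ∧ g ∉ J ∧
      ∀ b s : A, IsSumSq s → b * b + s ∈ J → b ∈ J := by
  obtain ⟨J, ⟨hIJ, hJ⟩, hmax⟩ : ∃ J : Ideal A, (I ≤ J ∧ Disjoint (J : Set A) (evenPowAddSumSq g)) ∧
      ∀ J' : Ideal A, I ≤ J' ∧ Disjoint (J' : Set A) (evenPowAddSumSq g) → ¬ J < J' :=
    set_has_maximal_iff_noetherian.2 ‹IsNoetherianRing A› _ ⟨I, le_rfl, hg⟩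
  have hmax' : ∀ J' : Ideal A, J < J' → ¬ Disjoint (J' : Set A) (evenPowAddSumSq g) :=
    fun J' hlt hd => hmax J' ⟨hIJ.trans hlt.le, hd⟩ hlt
  refine ⟨J, J.isPrime_of_maximally_disjoint _ hJ hmax', hIJ, fun hgJ => ?_, fun b s hs hb => ?_⟩
  · exact Set.disjoint_left.1 hJ (J.mul_mem_left g hgJ) ⟨1, 0, .zero, by ring⟩
  · by_contra hbJ
    obtain ⟨a, ha, haS⟩ := Set.not_disjoint_iff.1
      (hmax' (J ⊔ Ideal.span {b}) (Submodule.lt_sup_iff_notMem.2 hbJ))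
    obtain ⟨j, hj, _, hc, rfl⟩ := Submodule.mem_sup.1 ha
    obtain ⟨c, rfl⟩ := Ideal.mem_span_singleton.1 hc
    refine Set.disjoint_left.1 hJ ?_ (add_isSumSq_mem_evenPowAddSumSq (mul_mem haS haS)
      (hs.mul (.mul_self c)))
    have : (j + b * c) * (j + b * c) + s * (c * c) =
        (j + 2 * (b * c)) * j + c * c * (b * b + s) := by ring
    rw [this]
    exact J.add_mem (J.mul_mem_left _ hj) (J.mul_mem_left _ hb)

theorem isSemireal_fractionRing_quotient {J : Ideal A} [J.IsPrime]
    (hJ : ∀ b s : A, IsSumSq s → b * b + s ∈ J → b ∈ J) :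
    IsSemireal (FractionRing (A ⧸ J)) := by
  let φ : A →+* FractionRing (A ⧸ J) := (algebraMap (A ⧸ J) _).comp (Ideal.Quotient.mk J)
  have hker : ∀ a, φ a = 0 ↔ a ∈ J := fun a => by
    rw [← Ideal.Quotient.eq_zero_iff_mem]
    exact map_eq_zero_iff _ (IsFractionRing.injective (A ⧸ J) _)
  have key : ∀ s : FractionRing (A ⧸ J), IsSumSq s →
      ∃ b t : A, b ∉ J ∧ IsSumSq t ∧ φ t = φ b * φ b * s := by
    intro s hs
    induction hs with
    | zero => exact ⟨1, 0, (Ideal.ne_top_iff_one J).1 (Ideal.IsPrime.ne_top ‹_›), .zero, by simp⟩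
    | @sq_add a s _ ih =>
      obtain ⟨b, t, hb, ht, hbt⟩ := ih
      obtain ⟨u, v, hv, rfl⟩ := IsFractionRing.div_surjective (A := A ⧸ J) a
      obtain ⟨u, rfl⟩ := Ideal.Quotient.mk_surjective u
      obtain ⟨v, rfl⟩ := Ideal.Quotient.mk_surjective v
      have hvJ : v ∉ J := fun h =>
        nonZeroDivisors.ne_zero hv (Ideal.Quotient.eq_zero_iff_mem.2 h)
      have hv0 : φ v ≠ 0 := fun h => hvJ ((hker v).1 h)
      refine ⟨b * v, b * u * (b * u) + v * v * t,
        fun h => (Ideal.IsPrime.mem_or_mem ‹_› h).elim hb hvJ,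
        .sq_add _ ((IsSumSq.mul_self v).mul ht), ?_⟩
      change _ = φ (b * v) * φ (b * v) * (φ u / φ v * (φ u / φ v) + s)
      rw [map_add, map_mul, map_mul φ (v * v) t, hbt]
      simp only [map_mul]
      field_simp
  refine .of_not_isSumSq_neg_one fun h => ?_
  obtain ⟨b, t, hb, ht, hbt⟩ := key _ h
  refine hb (hJ b t ht ((hker _).1 ?_))
  rw [map_add, map_mul, hbt]
  ring

/-- The **real Nullstellensatz**. -/
theorem real_nullstellensatz {n m : ℕ} (h : Fin m → MvPolynomial (Fin n) ℝ)
    (g : MvPolynomial (Fin n) ℝ) (hg : ∀ x ∈ realVariety h, eval x g = 0) :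
    ∃ (l : ℕ) (q : MvPolynomial (Fin n) ℝ), IsSumSq q ∧
      g ^ (2 * l) + q ∈ Ideal.span (Set.range h) := by
  classical
  by_contra hcon
  push Not at hcon
  obtain ⟨J, hJprime, hIJ, hgJ, hJreal⟩ :=
    exists_isPrime_isReal_notMem (I := Ideal.span (Set.range h)) (g := g)
      (Set.disjoint_right.2 (by rintro _ ⟨l, q, hq, rfl⟩; exact hcon l q hq))
  have := isSemireal_fractionRing_quotient hJreal
  obtain ⟨E, _, _, ι, _, hE⟩ := exists_hasPolyIVT_of_isSemireal
    (FractionRing (MvPolynomial (Fin n) ℝ ⧸ J))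
  let φ : MvPolynomial (Fin n) ℝ →+* E :=
    (ι.comp (algebraMap (MvPolynomial (Fin n) ℝ ⧸ J) _)).comp (Ideal.Quotient.mk J)
  have hker : ∀ a, φ a = 0 ↔ a ∈ J := fun a => by
    rw [← Ideal.Quotient.eq_zero_iff_mem]
    exact (map_eq_zero_iff ι ι.injective).trans
      (map_eq_zero_iff _ (IsFractionRing.injective (MvPolynomial (Fin n) ℝ ⧸ J) _))
  let : Algebra ℝ E := (φ.comp C).toAlgebra
  have haeval : ∀ p, aeval (fun i => φ (X i)) p = φ p := fun p => by
    have : (aeval (fun i => φ (X i)) : MvPolynomial (Fin n) ℝ →ₐ[ℝ] E).toRingHom = φ :=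
      ringHom_ext (fun a => by simp; rfl) (fun i => by simp)
    exact congrArg (fun ψ : MvPolynomial (Fin n) ℝ →+* E => ψ p) this
  obtain ⟨y, hy⟩ := exists_sign_eval_eq hE hasPolyIVT_real
    (fun a => sign_map_real_s9 (algebraMap ℝ E) a) (insert g (Finset.univ.image h))
    (fun i => φ (X i))
  simp only [haeval, aeval_eq_eval] at hy
  have hyV : y ∈ realVariety h := fun i => by
    have h1 := hy (h i) (by simp)
    rw [(hker _).2 (hIJ (Ideal.subset_span ⟨i, rfl⟩)), sign_zero, eq_comm, sign_eq_zero_iff] at h1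
    exact h1
  have h2 := hy g (by simp)
  have h3 : eval y g = 0 := hg y hyV
  rw [h3, sign_zero, sign_eq_zero_iff, hker] at h2
  exact hgJ h2

end RealNullstellensatz

section Lasserre

variable {n : ℕ}

theorem isSOS_iff_isSumSq {p : MvPolynomial (Fin n) ℝ} : IsSOS p ↔ IsSumSq p := by
  constructor
  · rintro ⟨m, q, rfl⟩
    exact .sum_sq _ _
  · intro hp
    induction hp with
    | zero => exact ⟨0, Fin.elim0, by simp⟩
    | sq_add a _ ih =>
      obtain ⟨m, q, rfl⟩ := ih
      exact ⟨m + 1, Fin.cons a q, by simp [Fin.sum_univ_succ, sq]⟩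

theorem isSumSq_C {c : ℝ} (hc : 0 ≤ c) : IsSumSq (C c : MvPolynomial (Fin n) ℝ) := by
  rw [← Real.mul_self_sqrt hc, C_mul]
  exact .mul_self _

/-- A sufficiently large multiple of a high even power compensates a linear term up to `ε`. -/
theorem exists_isSumSq_add_mul_pow (m : ℕ) {ε : ℝ} (hε : 0 < ε) :
    ∃ c : ℝ, 0 ≤ c ∧ ∀ p : MvPolynomial (Fin n) ℝ,
      IsSumSq (C ε + p + C c * p ^ 2 ^ (m + 1)) := by
  induction m generalizing ε with
  | zero =>
    refine ⟨1 / (4 * ε), by positivity, fun p => ?_⟩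
    have h1 : (C (1 / (4 * ε)) * C (4 * ε) : MvPolynomial (Fin n) ℝ) = 1 := by
      rw [← C_mul, one_div_mul_cancel (by positivity), C_1]
    have h2 : (C (4 * ε) : MvPolynomial (Fin n) ℝ) = 4 * C ε := by
      rw [C_mul]; rfl
    have : C ε + p + C (1 / (4 * ε)) * p ^ 2 ^ (0 + 1) =
        C (1 / (4 * ε)) * ((2 * C ε + p) * (2 * C ε + p)) := by
      rw [h2] at h1
      linear_combination -(C ε + p) * h1
    rw [this]
    exact (isSumSq_C (by positivity)).mul (.mul_self _)
  | succ m ih =>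
    obtain ⟨c, hc, hsum⟩ := ih (half_pos hε)
    refine ⟨c * c * (1 / (2 * ε)), by positivity, fun p => ?_⟩
    have h1 : (C (1 / (2 * ε)) * (2 * C ε) : MvPolynomial (Fin n) ℝ) = 1 := by
      rw [show (2 : MvPolynomial (Fin n) ℝ) = C 2 from rfl, ← C_mul, ← C_mul,
        one_div_mul_cancel (by positivity), C_1]
    have h2 : (2 * C (ε / 2) : MvPolynomial (Fin n) ℝ) = C ε := by
      rw [show (2 : MvPolynomial (Fin n) ℝ) = C 2 from rfl, ← C_mul, mul_div_cancel₀ _ two_ne_zero]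
    have : C ε + p + C (c * c * (1 / (2 * ε))) * p ^ 2 ^ (m + 1 + 1) =
        C (ε / 2) + p + C c * p ^ 2 ^ (m + 1) + C (1 / (2 * ε)) *
          ((C ε - C c * p ^ 2 ^ (m + 1)) * (C ε - C c * p ^ 2 ^ (m + 1))) := by
      rw [C_mul, C_mul, pow_succ 2 (m + 1), pow_mul]
      linear_combination (-C (ε / 2) + C c * p ^ 2 ^ (m + 1)) * h1 +
        (C (1 / (2 * ε)) * C ε - 1) * h2
    rw [this]
    exact (hsum p).add ((isSumSq_C (by positivity)).mul (.mul_self _))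

theorem truncIdeal_add_sigma2k_mono {m : ℕ} (h : Fin m → MvPolynomial (Fin n) ℝ) {k l : ℕ}
    (hkl : k ≤ l) : truncIdeal h k + sigma2k k ⊆ truncIdeal h l + sigma2k l := by
  refine Set.add_subset_add ?_ ?_
  · rintro p ⟨φ, hφ, rfl⟩
    exact ⟨φ, fun i => (hφ i).trans (by omega), rfl⟩
  · exact fun p hp => ⟨hp.1, hp.2.trans (by omega)⟩

theorem add_mem_truncIdeal_add_sigma2k {m : ℕ} {h : Fin m → MvPolynomial (Fin n) ℝ} {k : ℕ}
    {p q : MvPolynomial (Fin n) ℝ} (hp : p ∈ truncIdeal h k + sigma2k k)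
    (hq : q ∈ truncIdeal h k + sigma2k k) : p + q ∈ truncIdeal h k + sigma2k k := by
  obtain ⟨_, ⟨φ, hφ, rfl⟩, s, hs, rfl⟩ := hp
  obtain ⟨_, ⟨ψ, hψ, rfl⟩, t, ht, rfl⟩ := hq
  refine ⟨∑ i, (φ i + ψ i) * h i, ⟨_, fun i => ?_, rfl⟩, s + t, ⟨?_, ?_⟩, ?_⟩
  · rw [add_mul]
    exact (totalDegree_add _ _).trans (max_le (hφ i) (hψ i))
  · exact isSOS_iff_isSumSq.2 ((isSOS_iff_isSumSq.1 hs.1).add (isSOS_iff_isSumSq.1 ht.1))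
  · exact (totalDegree_add _ _).trans (max_le hs.2 ht.2)
  · simp only [add_mul, Finset.sum_add_distrib]
    ring

theorem mem_truncIdeal_add_sigma2k_of_sigma2k {m : ℕ} {h : Fin m → MvPolynomial (Fin n) ℝ}
    {k : ℕ} {p : MvPolynomial (Fin n) ℝ} (hp : p ∈ sigma2k k) :
    p ∈ truncIdeal h k + sigma2k k :=
  ⟨0, ⟨0, by simp, by simp⟩, p, hp, zero_add p⟩

theorem exists_cofactors_of_mem_truncIdeal {m : ℕ} {h : Fin m → MvPolynomial (Fin n) ℝ} {k : ℕ}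
    {p : MvPolynomial (Fin n) ℝ} (hp : p ∈ truncIdeal h k) :
    ∃ φ : Fin m → MvPolynomial (Fin n) ℝ, (∀ i, (φ i).totalDegree ≤ 2 * k) ∧
      p = ∑ i, φ i * h i := by
  classical
  obtain ⟨φ, hφ, rfl⟩ := hp
  refine ⟨fun i => if h i = 0 then 0 else φ i, fun i => ?_, Finset.sum_congr rfl fun i _ => ?_⟩
  · by_cases hi : h i = 0
    · simp [hi]
    · simp only [if_neg hi]
      by_cases hφi : φ i = 0
      · simp [hφi]
      · have := hφ i
        rw [totalDegree_mul_of_isDomain hφi hi] at this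
        omega
  · by_cases hi : h i = 0 <;> simp [hi]

/-- If `g` vanishes on `V_ℝ(h)`, then all multiples of `g` of bounded degree are, up to any
positive constant, in a common truncation of the ideal of `h` plus sums of squares. -/
theorem exists_C_add_mul_mem {m : ℕ} {h : Fin m → MvPolynomial (Fin n) ℝ}
    {g : MvPolynomial (Fin n) ℝ} (hg : ∀ x ∈ realVariety h, eval x g = 0) (d : ℕ) :
    ∃ k : ℕ, ∀ φ : MvPolynomial (Fin n) ℝ, φ.totalDegree ≤ d → ∀ ε : ℝ, 0 < ε →
      C ε + φ * g ∈ truncIdeal h k + sigma2k k := by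
  obtain ⟨l, q₀, hq₀, hmem⟩ := real_nullstellensatz h g hg
  obtain ⟨a, ha⟩ := Nat.exists_eq_add_of_le (Nat.lt_two_pow_self (n := l)).le
  set M := 2 ^ (l + 1) with hM
  have hM2 : M = 2 * a + 2 * l := by rw [hM, pow_succ, ha]; ring
  have hM1 : 1 ≤ M := Nat.one_le_two_pow
  set q := g ^ (2 * a) * q₀ with hq
  have hsq : ∀ (p : MvPolynomial (Fin n) ℝ) (k : ℕ), IsSumSq (p ^ (2 * k)) := fun p k => by
    rw [two_mul, pow_add]; exact .mul_self _
  have hqS : IsSumSq q := (hsq g a).mul hq₀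
  have hmem' : g ^ M + q ∈ Ideal.span (Set.range h) := by
    rw [hM2, pow_add, hq, ← mul_add]
    exact Ideal.mul_mem_left _ _ hmem
  obtain ⟨ψ, hψ⟩ := Ideal.mem_span_range_iff_exists_fun.1 hmem'
  refine ⟨M * (d + g.totalDegree) + M * d + q.totalDegree + ∑ j, (ψ j * h j).totalDegree,
    fun φ hφ ε hε => ?_⟩
  obtain ⟨c, hc, hcs⟩ := exists_isSumSq_add_mul_pow (n := n) l hε
  have hφM : (φ ^ M).totalDegree ≤ M * d :=
    (totalDegree_pow _ _).trans (Nat.mul_le_mul_left _ hφ)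
  have hφg : (φ * g).totalDegree ≤ d + g.totalDegree :=
    (totalDegree_mul _ _).trans (Nat.add_le_add_right hφ _)
  have hφgM : ((φ * g) ^ M).totalDegree ≤ M * (d + g.totalDegree) :=
    (totalDegree_pow _ _).trans (Nat.mul_le_mul_left _ hφg)
  have hle : d + g.totalDegree ≤ M * (d + g.totalDegree) := Nat.le_mul_of_pos_left _ hM1
  have hCmul : ∀ (b : ℝ) (p : MvPolynomial (Fin n) ℝ), (C b * p).totalDegree ≤ p.totalDegree :=
    fun b p => (totalDegree_mul _ _).trans (by rw [totalDegree_C, zero_add])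
  refine ⟨∑ j, C (-c) * (φ ^ M * ψ j) * h j, ⟨_, fun j => ?_, rfl⟩,
    (C ε + φ * g + C c * (φ * g) ^ M) + C c * (φ ^ M * q), ⟨?_, ?_⟩, ?_⟩
  · have h1 : (ψ j * h j).totalDegree ≤ ∑ j, (ψ j * h j).totalDegree :=
      Finset.single_le_sum (f := fun j => (ψ j * h j).totalDegree) (fun _ _ => Nat.zero_le _)
        (Finset.mem_univ j)
    rw [mul_assoc, mul_assoc]
    have h2 := (hCmul (-c) (φ ^ M * (ψ j * h j))).trans (totalDegree_mul _ _)
    omega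
  · refine isSOS_iff_isSumSq.2 ((hcs _).add ((isSumSq_C hc).mul (.mul ?_ hqS)))
    rw [hM2, ← mul_add]
    exact hsq _ _
  · have h1 := totalDegree_add (C ε) (φ * g)
    rw [totalDegree_C] at h1
    have h2 := totalDegree_add (C ε + φ * g) (C c * (φ * g) ^ M)
    have h3 := hCmul c ((φ * g) ^ M)
    have h4 := (hCmul c (φ ^ M * q)).trans (totalDegree_mul _ _)
    refine (totalDegree_add _ _).trans (max_le (h2.trans (max_le (h1.trans ?_) ?_)) ?_)
    · rw [max_eq_right (Nat.zero_le _)]; omega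
    · omega
    · omega
  · have h1 : ∑ j, C (-c) * (φ ^ M * ψ j) * h j = C (-c) * φ ^ M * (g ^ M + q) := by
      rw [← hψ, Finset.mul_sum]
      exact Finset.sum_congr rfl fun j _ => by ring
    beta_reduce
    rw [h1, C_neg]
    ring

theorem lasserreEqBound_le_fMin {m : ℕ} (f : MvPolynomial (Fin n) ℝ)
    (h : Fin m → MvPolynomial (Fin n) ℝ) (k : ℕ) :
    lasserreEqBound f h k ≤ fMin f (realVariety h) := by
  refine sSup_le ?_
  rintro _ ⟨r, rfl, _, ⟨φ, -, rfl⟩, σ, ⟨hσ, -⟩, heq⟩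
  refine le_iInf₂ fun x hx => EReal.coe_le_coe_iff.2 ?_
  have h1 := congrArg (eval x) heq
  have h2 : 0 ≤ eval x σ := ((isSOS_iff_isSumSq.1 hσ).map_ringHom (eval x)).nonneg
  have h3 : ∀ i, eval x (h i) = 0 := hx
  simp [h3] at h1
  linarith

theorem lasserreEqBound_eventually_eq_fMin_of_realVariety_eq {m r : ℕ}
    {f : MvPolynomial (Fin n) ℝ} {h : Fin m → MvPolynomial (Fin n) ℝ}
    {h' : Fin r → MvPolynomial (Fin n) ℝ} (hvar : realVariety h = realVariety h') {N : ℕ}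
    (hN : lasserreEqBound f h N = fMin f (realVariety h)) :
    ∃ N' : ℕ, ∀ k ≥ N', lasserreEqBound f h' k = fMin f (realVariety h) := by
  choose κ hκ using fun i : Fin m => exists_C_add_mul_mem (h := h') (g := h i)
    (fun x hx => (hvar ▸ hx : x ∈ realVariety h) i) (2 * N)
  refine ⟨N + ∑ i, κ i, fun k hk => le_antisymm (hvar ▸ lasserreEqBound_le_fMin f h' k)
    (le_of_forall_lt fun c hc => ?_)⟩
  rw [← hN] at hc
  obtain ⟨_, ⟨γ, rfl, p, hp, σ, hσ, hpσ⟩, hcγ⟩ := lt_sSup_iff.1 hc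
  obtain ⟨t, hct, htγ⟩ := EReal.lt_iff_exists_real_btwn.1 hcγ
  refine hct.trans_le (le_sSup ⟨t, rfl, ?_⟩)
  have htγ' : t < γ := EReal.coe_lt_coe_iff.1 htγ
  obtain ⟨φ, hφ, rfl⟩ := exists_cofactors_of_mem_truncIdeal hp
  set ε := (γ - t) / (m + 1) with hε
  have hε0 : 0 < ε := div_pos (sub_pos.2 htγ') (by positivity)
  have hγ : γ = t + (m * ε + ε) := by
    rw [hε]; field_simp; ring
  have hsum : ∀ s : Finset (Fin m),
      ∑ i ∈ s, (C ε + φ i * h i) ∈ truncIdeal h' k + sigma2k k := by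
    intro s
    induction s using Finset.cons_induction with
    | empty =>
      exact mem_truncIdeal_add_sigma2k_of_sigma2k ⟨isSOS_iff_isSumSq.2 .zero, by simp⟩
    | cons i s hi ih =>
      rw [Finset.sum_cons]
      refine add_mem_truncIdeal_add_sigma2k
        (truncIdeal_add_sigma2k_mono h' ?_ (hκ i _ (hφ i) ε hε0)) ih
      have := Finset.single_le_sum (f := κ) (fun _ _ => Nat.zero_le _) (Finset.mem_univ i)
      omega
  have hrest : C ε + σ ∈ truncIdeal h' k + sigma2k k := by
    refine mem_truncIdeal_add_sigma2k_of_sigma2k ⟨isSOS_iff_isSumSq.2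
      ((isSumSq_C hε0.le).add (isSOS_iff_isSumSq.1 hσ.1)), (totalDegree_add _ _).trans ?_⟩
    rw [totalDegree_C, max_eq_right (Nat.zero_le _)]
    exact hσ.2.trans (by omega)
  have heq : f - C t = ∑ i, (C ε + φ i * h i) + (C ε + σ) := by
    have h1 : f = ∑ i, φ i * h i + σ + C γ := by
      rw [← sub_eq_iff_eq_add]; exact hpσ.symm
    rw [h1, hγ, Finset.sum_add_distrib, Finset.sum_const, Finset.card_univ, Fintype.card_fin,
      C_add, C_add, C_mul, nsmul_eq_mul, map_natCast]
    ring
  rw [heq]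
  exact add_mem_truncIdeal_add_sigma2k (hsum _) hrest

end Lasserre

/-- If `V_ℝ(h) = V_ℝ(h')`, then for minimizing `f` over this variety with no
inequality constraints, the Lasserre hierarchy using `h` has finite convergence
to `f_min` iff the one using `h'` does. -/
theorem lasserre_eq_finite_convergence_indep
    {n m₁ r : ℕ} (f : MvPolynomial (Fin n) ℝ)
    (h : Fin m₁ → MvPolynomial (Fin n) ℝ) (h' : Fin r → MvPolynomial (Fin n) ℝ)
    (hvar : realVariety h = realVariety h') :
    (∃ N : ℕ, ∀ k ≥ N, lasserreEqBound f h k = fMin f (realVariety h)) ↔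
      (∃ N : ℕ, ∀ k ≥ N, lasserreEqBound f h' k = fMin f (realVariety h)) := by
  constructor
  · rintro ⟨N, hN⟩
    exact lasserreEqBound_eventually_eq_fMin_of_realVariety_eq hvar (hN N le_rfl)
  · rintro ⟨N, hN⟩
    rw [hvar] at hN ⊢
    exact lasserreEqBound_eventually_eq_fMin_of_realVariety_eq hvar.symm (hN N le_rfl)
end
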